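/- arXiv:2110.07949 — 2 statements merged into one kernel-verified Lean document; each statement's English description precedes it below -/
import Mathlib

section
/- Suppose the interaction range satisfies r_n/√n → ∞ and r_n/n^{3/4} → 0 as n → ∞. Then, under the law μ_n, the rescaled magnetization S_n/(r_n^{1/3}·√n) converges in distribution to the centered Gaussian law N(0, (2/3)^{1/3}). -/
open MeasureTheory ProbabilityTheory Real Filter Topology

noncomputable section

/-- The Hamiltonian of the model: each spin interacts with its `2r` nearest
neighbours on the discrete circle `ℤ/nℤ`. -/
def Ham (n r : ℕ) (x : Fin n → ℝ) : ℝ :=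
  -(1 / (2 * (r : ℝ))) *
    ∑ i : Fin n, ∑ j ∈ Finset.Icc 1 r, x i * x ⟨((i : ℕ) + j) % n, Nat.mod_lt _ i.pos⟩

/-- The self-adjusted temperature. -/
def Temp (n : ℕ) (x : Fin n → ℝ) : ℝ := (∑ i : Fin n, (x i) ^ 2) / n

/-- The magnetization. -/
def Mag (n : ℕ) (x : Fin n → ℝ) : ℝ := ∑ i : Fin n, x i

/-- The unnormalized measure `exp(-H_n/T_n) 1_{T_n>0} dν^{⊗n}`. -/
def preμ (n r : ℕ) : Measure (Fin n → ℝ) :=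
  (Measure.pi fun _ : Fin n => (gaussianReal 0 1 : Measure ℝ)).withDensity
    fun x => if 0 < Temp n x then ENNReal.ofReal (Real.exp (-(Ham n r x) / Temp n x)) else 0

/-- The probability measure `μ_n` of the model. -/
def μmeas (n r : ℕ) : Measure (Fin n → ℝ) := (preμ n r Set.univ)⁻¹ • preμ n r

theorem integrable_mul_gaussian_of_bounded {ψ : ℝ → ℝ} (hψ : Continuous ψ) {C : ℝ}
    (hC : ∀ x, |ψ x| ≤ C) : Integrable fun x => ψ x * exp (-(x ^ 2 / 2)) := by
  have h := integrable_exp_neg_mul_sq (b := 1 / 2) (by norm_num)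
  refine (h.congr (.of_forall fun x => ?_)).bdd_mul hψ.aestronglyMeasurable (c := C)
    (.of_forall hC)
  simp only
  congr 1
  ring

/-- Mills' bound for the tail of a Gaussian integral. -/
theorem mul_abs_integral_Ioi_gaussian_le {ψ : ℝ → ℝ} {C : ℝ}
    (hC : ∀ x, |ψ x| ≤ C) {w : ℝ} (hw : 0 ≤ w) :
    w * |∫ t in Set.Ioi w, ψ t * exp (-(t ^ 2 / 2))| ≤ C * exp (-(w ^ 2 / 2)) := by
  have hd : ∀ x ∈ Set.Ici w,
      HasDerivAt (fun t => -exp (-(t ^ 2 / 2))) (x * exp (-(x ^ 2 / 2))) x := by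
    intro x _
    have := (((hasDerivAt_pow 2 x).div_const 2).neg.exp).neg
    convert! this using 1
    simp
    ring
  have ht : Tendsto (fun t : ℝ => -exp (-(t ^ 2 / 2))) atTop (𝓝 0) := by
    rw [← neg_zero]
    refine (tendsto_exp_neg_atTop_nhds_zero.comp ?_).neg
    exact (tendsto_pow_atTop two_ne_zero).atTop_div_const two_pos
  have hpos : ∀ x ∈ Set.Ioi w, 0 ≤ x * exp (-(x ^ 2 / 2)) := fun x hx =>
    mul_nonneg (hw.trans (le_of_lt hx)) (exp_pos _).le
  have hint := integrableOn_Ioi_deriv_of_nonneg' hd hpos ht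
  have hval := integral_Ioi_of_hasDerivAt_of_nonneg' hd hpos ht
  have hC0 : 0 ≤ C := (abs_nonneg _).trans (hC 0)
  rw [← abs_of_nonneg hw, ← abs_mul, ← integral_const_mul, abs_of_nonneg hw]
  calc |∫ t in Set.Ioi w, w * (ψ t * exp (-(t ^ 2 / 2)))|
      ≤ ∫ t in Set.Ioi w, C * (t * exp (-(t ^ 2 / 2))) := by
        rw [← Real.norm_eq_abs]
        refine norm_integral_le_of_norm_le (hint.const_mul C) ?_
        filter_upwards [ae_restrict_mem measurableSet_Ioi] with t ht
        rw [Real.norm_eq_abs, abs_mul, abs_mul, abs_of_nonneg hw, abs_of_pos (exp_pos _)]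
        have h1 : w * |ψ t| ≤ t * C :=
          mul_le_mul (le_of_lt ht) (hC t) (abs_nonneg _) (hw.trans (le_of_lt ht))
        nlinarith [mul_le_mul_of_nonneg_right h1 (exp_pos (-(t ^ 2 / 2))).le]
    _ = C * exp (-(w ^ 2 / 2)) := by
        rw [integral_const_mul, hval]
        ring

/-- A bounded solution of Stein's equation `f' w - w * f w = ψ w`. -/
theorem exists_stein_solution {ψ : ℝ → ℝ} (hψ : Continuous ψ) {C : ℝ} (hC : ∀ x, |ψ x| ≤ C)
    (h0 : ∫ x, ψ x * exp (-(x ^ 2 / 2)) = 0) :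
    ∃ (f f' : ℝ → ℝ) (K : ℝ), (∀ x, HasDerivAt f (f' x) x) ∧ Continuous f' ∧
      (∀ x, f' x - x * f x = ψ x) ∧
      (∀ x, |f x| ≤ K) ∧ (∀ x, |x * f x| ≤ K) ∧ (∀ x, |f' x| ≤ K) := by
  have hint := integrable_mul_gaussian_of_bounded hψ hC
  have hcont : Continuous fun x => ψ x * exp (-(x ^ 2 / 2)) := by fun_prop
  set J : ℝ → ℝ := fun w => ∫ t in Set.Iic w, ψ t * exp (-(t ^ 2 / 2)) with hJ
  have hJd : ∀ w, HasDerivAt J (ψ w * exp (-(w ^ 2 / 2))) w := by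
    intro w
    have h1 : J = fun w => J 0 + ∫ t in (0 : ℝ)..w, ψ t * exp (-(t ^ 2 / 2)) := by
      funext w
      rw [← intervalIntegral.integral_Iic_sub_Iic hint.integrableOn hint.integrableOn]
      simp [hJ]
    rw [h1]
    exact (intervalIntegral.integral_hasDerivAt_right hint.intervalIntegrable
      (hcont.stronglyMeasurableAtFilter _ _) hcont.continuousAt).const_add _
  have hJneg : ∀ w, J w = -∫ t in Set.Ioi w, ψ t * exp (-(t ^ 2 / 2)) := by
    intro w
    have h2 := intervalIntegral.integral_Iic_add_Ioi (b := w)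
      hint.integrableOn hint.integrableOn
    rw [h0] at h2
    simp only [hJ]
    linarith
  have hJbd : ∀ w, |w * J w| ≤ C * exp (-(w ^ 2 / 2)) := by
    intro w
    rcases le_total 0 w with hw | hw
    · rw [hJneg, mul_neg, abs_neg, abs_mul, abs_of_nonneg hw]
      exact mul_abs_integral_Ioi_gaussian_le hC hw
    · have := mul_abs_integral_Ioi_gaussian_le (ψ := fun t => ψ (-t))
        (fun x => hC (-x)) (neg_nonneg.2 hw)
      have h3 := integral_comp_neg_Ioi (-w) (fun t => ψ t * exp (-(t ^ 2 / 2)))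
      simp only [neg_sq, neg_neg] at h3 this
      rw [h3] at this
      rw [abs_mul, abs_of_nonpos hw]
      exact this
  set f : ℝ → ℝ := fun w => exp (w ^ 2 / 2) * J w with hf
  have hexp : ∀ w : ℝ, exp (w ^ 2 / 2) * exp (-(w ^ 2 / 2)) = 1 := fun w => by
    rw [← exp_add, add_neg_cancel, exp_zero]
  have hfd : ∀ w, HasDerivAt f (ψ w + w * f w) w := by
    intro w
    have := (((hasDerivAt_pow 2 w).div_const 2).exp).mul (hJd w)
    convert! this using 1
    simp only [hf]
    have := hexp w
    push_cast
    linear_combination (-ψ w) * this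
  have hfc : Continuous f := continuous_iff_continuousAt.2 fun w => (hfd w).continuousAt
  have hwf : ∀ w, |w * f w| ≤ C := by
    intro w
    have h4 : w * f w = exp (w ^ 2 / 2) * (w * J w) := by simp only [hf]; ring
    rw [h4, abs_mul, abs_of_pos (exp_pos _)]
    calc _ ≤ exp (w ^ 2 / 2) * (C * exp (-(w ^ 2 / 2))) := by gcongr; exact hJbd w
      _ = C := by linear_combination C * hexp w
  obtain ⟨B, hB⟩ := (isCompact_Icc (a := (-1 : ℝ)) (b := 1)).exists_bound_of_continuousOn
    hfc.continuousOn
  have hB0 : 0 ≤ B := (norm_nonneg _).trans (hB 0 (by simp))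
  have hC0 : 0 ≤ C := (abs_nonneg _).trans (hC 0)
  refine ⟨f, fun w => ψ w + w * f w, B + 2 * C, hfd, by fun_prop, fun x => by ring, ?_, ?_, ?_⟩
  · intro x
    by_cases hx : |x| ≤ 1
    · have := hB x (abs_le.1 hx)
      rw [Real.norm_eq_abs] at this
      linarith
    · have h5 := hwf x
      rw [abs_mul] at h5
      push Not at hx
      nlinarith [abs_nonneg (f x)]
  · intro x
    linarith [hwf x]
  · intro x
    linarith [hwf x, hC x, abs_add_le (ψ x) (x * f x)]

/-- The eigenvalue `(1/r) ∑_{j=1}^r cos (j θ)` of the averaging operator at frequency `θ`. -/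
def cosAvg (r : ℕ) (θ : ℝ) : ℝ := (∑ j ∈ Finset.Icc 1 r, cos (j * θ)) / r

/-- The frequencies `2 π k / n` of the discrete circle. -/
def freq (n k : ℕ) : ℝ := 2 * π * k / n

theorem two_mul_sin_half_mul_sum_cos (r : ℕ) (θ : ℝ) :
    2 * sin (θ / 2) * ∑ j ∈ Finset.Icc 1 r, cos (j * θ) =
      sin ((r + 1 / 2) * θ) - sin (θ / 2) := by
  induction r with
  | zero => simp; ring_nf
  | succ m ih =>
    rw [Finset.sum_Icc_succ_top (by omega), mul_add, ih]
    have h1 : ((m + 1 : ℕ) + 1 / 2 : ℝ) * θ = ((m + 1 : ℕ) : ℝ) * θ + θ / 2 := by ring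
    have h2 : ((m : ℝ) + 1 / 2) * θ = ((m + 1 : ℕ) : ℝ) * θ - θ / 2 := by push_cast; ring
    rw [h1, h2, sin_add, sin_sub]
    ring

theorem sum_range_cos_freq {n : ℕ} (hn : 0 < n) (m : ℤ) :
    ∑ k ∈ Finset.range n, cos (m * freq n k) = if (n : ℤ) ∣ m then (n : ℝ) else 0 := by
  have hn0 : (n : ℝ) ≠ 0 := by positivity
  split_ifs with h
  · obtain ⟨l, rfl⟩ := h
    have : ∀ k ∈ Finset.range n, cos (((n * l : ℤ) : ℝ) * freq n k) = 1 := by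
      intro k _
      have h1 : ((n * l : ℤ) : ℝ) * freq n k = ((l * k : ℤ) : ℝ) * (2 * π) := by
        rw [freq]; push_cast; field_simp
      rw [h1, cos_int_mul_two_pi]
    rw [Finset.sum_congr rfl this]
    simp
  · have hs : sin (π * m / n) ≠ 0 := by
      rw [Ne, sin_eq_zero_iff]
      rintro ⟨l, hl⟩
      apply h
      refine ⟨l, ?_⟩
      have h3 : (l : ℝ) * n = m := by
        field_simp at hl
        exact hl
      have h4 : (l * n : ℤ) = m := by exact_mod_cast h3
      rw [← h4, mul_comm]
    have key : ∀ N : ℕ, 2 * sin (π * m / n) * ∑ k ∈ Finset.range N, cos (m * freq n k) =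
        sin ((N - 1 / 2) * (2 * π * m / n)) + sin (π * m / n) := by
      intro N
      induction N with
      | zero =>
        simp only [Finset.range_zero, Finset.sum_empty]
        rw [show ((0 : ℕ) - 1 / 2 : ℝ) * (2 * π * m / n) = -(π * m / n) by push_cast; ring, sin_neg]
        ring
      | succ N ih =>
        rw [Finset.sum_range_succ, mul_add, ih]
        have h1 : ((N + 1 : ℕ) - 1 / 2 : ℝ) * (2 * π * m / n) = m * freq n N + π * m / n := by
          rw [freq]; push_cast; ring
        have h2 : ((N : ℝ) - 1 / 2) * (2 * π * m / n) = m * freq n N - π * m / n := by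
          rw [freq]; ring
        rw [h1, h2, sin_add, sin_sub]
        ring
    have h5 := key n
    have h6 : ((n : ℝ) - 1 / 2) * (2 * π * m / n) = m * (2 * π) - π * m / n := by field_simp
    rw [h6, sin_int_mul_two_pi_sub, neg_add_cancel] at h5
    simpa [hs] using h5

theorem sum_cosAvg {n r : ℕ} (hrn : r < n) :
    ∑ k ∈ Finset.range n, cosAvg r (freq n k) = 0 := by
  simp_rw [cosAvg]
  rw [← Finset.sum_div, Finset.sum_comm, Finset.sum_eq_zero, zero_div]
  intro j hj
  rw [Finset.mem_Icc] at hj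
  have := sum_range_cos_freq (n := n) (by omega) (j : ℤ)
  rw [if_neg] at this
  · exact_mod_cast this
  · intro h
    have := Int.le_of_dvd (by omega) h
    omega

theorem sum_cosAvg_sq {n r : ℕ} (hr : 0 < r) (hrn : 2 * r < n) :
    ∑ k ∈ Finset.range n, cosAvg r (freq n k) ^ 2 = n / (2 * r) := by
  have hn : 0 < n := by omega
  have key : ∀ i ∈ Finset.Icc 1 r, ∀ j ∈ Finset.Icc 1 r,
      ∑ k ∈ Finset.range n, cos (i * freq n k) * cos (j * freq n k) =
        if i = j then (n : ℝ) / 2 else 0 := by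
    intro i hi j hj
    rw [Finset.mem_Icc] at hi hj
    have h1 := sum_range_cos_freq hn ((i : ℤ) + j)
    have h2 := sum_range_cos_freq hn ((i : ℤ) - j)
    rw [if_neg (fun h => by have := Int.le_of_dvd (by omega) h; omega)] at h1
    have h3 : ∀ k, cos (i * freq n k) * cos (j * freq n k) =
        (cos (((i + j : ℤ) : ℝ) * freq n k) + cos (((i - j : ℤ) : ℝ) * freq n k)) / 2 := by
      intro k
      push_cast
      rw [add_mul, sub_mul, cos_add, cos_sub]
      ring
    simp_rw [h3]
    rw [← Finset.sum_div, Finset.sum_add_distrib, h1, h2]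
    split_ifs with h4 h5 h5
    · ring
    · exfalso
      apply h5
      have h6 := Int.eq_zero_of_abs_lt_dvd h4 (by rw [abs_lt]; omega)
      omega
    · exfalso
      apply h4
      simp [h5]
    · simp
  have h7 : ∀ k, cosAvg r (freq n k) ^ 2 =
      (∑ i ∈ Finset.Icc 1 r, ∑ j ∈ Finset.Icc 1 r,
        cos (i * freq n k) * cos (j * freq n k)) / r ^ 2 := by
    intro k
    rw [cosAvg, div_pow, sq (Finset.sum _ _), Finset.sum_mul_sum]
  simp_rw [h7]
  rw [← Finset.sum_div, Finset.sum_comm]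
  have h8 : ∀ i ∈ Finset.Icc 1 r, ∑ k ∈ Finset.range n, ∑ j ∈ Finset.Icc 1 r,
      cos (i * freq n k) * cos (j * freq n k) = (n : ℝ) / 2 := by
    intro i hi
    rw [Finset.sum_comm, Finset.sum_congr rfl (key i hi)]
    simp only [Finset.sum_ite_eq, if_pos hi]
  rw [Finset.sum_congr rfl h8]
  have : (r : ℝ) ≠ 0 := by positivity
  simp
  field_simp

theorem cosAvg_zero {r : ℕ} (hr : 0 < r) : cosAvg r 0 = 1 := by
  have : (r : ℝ) ≠ 0 := by positivity
  simp [cosAvg, this]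

theorem abs_cosAvg_le (r : ℕ) (θ : ℝ) : |cosAvg r θ| ≤ 1 := by
  rw [cosAvg, abs_div, Nat.abs_cast]
  refine div_le_one_of_le₀ ?_ (Nat.cast_nonneg r)
  calc _ ≤ ∑ j ∈ Finset.Icc 1 r, |cos (j * θ)| := Finset.abs_sum_le_sum_abs _ _
    _ ≤ ∑ j ∈ Finset.Icc 1 r, (1 : ℝ) := Finset.sum_le_sum fun j _ => abs_cos_le_one _
    _ = r := by simp

theorem cosAvg_freq_sub {n r k : ℕ} (hk : k ≤ n) (hn : 0 < n) :
    cosAvg r (freq n (n - k)) = cosAvg r (freq n k) := by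
  have hn0 : (n : ℝ) ≠ 0 := by positivity
  unfold cosAvg
  congr 1
  refine Finset.sum_congr rfl fun j _ => ?_
  have : (j : ℝ) * freq n (n - k) = j * (2 * π) - j * freq n k := by
    rw [freq, freq, Nat.cast_sub hk]; field_simp
  rw [this, cos_nat_mul_two_pi_sub]

theorem cosAvg_freq_le_half {n r k : ℕ} (hr : 0 < r) (h1 : n ≤ 2 * r * k)
    (h2 : n ≤ 2 * r * (n - k)) (hk : k ≤ n) (hn : 0 < n) : cosAvg r (freq n k) ≤ 1 / 2 := by
  wlog hkn : 2 * k ≤ n generalizing k with H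
  · rw [← cosAvg_freq_sub hk hn]
    refine H h2 ?_ (Nat.sub_le _ _) (by omega)
    rwa [Nat.sub_sub_self hk]
  have hr0 : (0 : ℝ) < r := by positivity
  have hn0 : (0 : ℝ) < n := by positivity
  have hkn' : (2 : ℝ) * k ≤ n := by exact_mod_cast hkn
  have h1' : (n : ℝ) ≤ 2 * r * k := by exact_mod_cast h1
  have hs : 1 / (r : ℝ) ≤ sin (freq n k / 2) := by
    have h3 : freq n k / 2 = π * (k / n) := by rw [freq]; ring
    have h4 : (k : ℝ) / n ≤ 1 / 2 := by rw [div_le_iff₀ hn0]; linarith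
    have h5 := mul_le_sin (x := freq n k / 2) (by rw [freq]; positivity)
      (by rw [h3]; nlinarith [pi_pos])
    have h6 : 2 / π * (freq n k / 2) = 2 * k / n := by rw [freq]; field_simp
    rw [h6] at h5
    refine le_trans ?_ h5
    rw [div_le_div_iff₀ hr0 hn0]
    linarith
  have h7 := two_mul_sin_half_mul_sum_cos r (freq n k)
  set σ := ∑ j ∈ Finset.Icc 1 r, cos (j * freq n k)
  have h8 : cosAvg r (freq n k) = σ / r := rfl
  rw [h8, div_le_iff₀ hr0]
  by_contra! h9
  have h10 := sin_le_one ((r + 1 / 2) * freq n k)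
  have h11 : 0 < sin (freq n k / 2) := lt_of_lt_of_le (by positivity) hs
  have h12 : 1 ≤ sin (freq n k / 2) * r := by rwa [div_le_iff₀ hr0] at hs
  nlinarith

theorem sum_Icc_sq (r : ℕ) :
    ∑ j ∈ Finset.Icc 1 r, (j : ℝ) ^ 2 = r * (r + 1) * (2 * r + 1) / 6 := by
  induction r with
  | zero => simp
  | succ m ih =>
    rw [Finset.sum_Icc_succ_top (by omega), ih]
    push_cast
    ring

theorem one_sub_cosAvg {r : ℕ} (hr : 0 < r) (θ : ℝ) :
    1 - cosAvg r θ = (∑ j ∈ Finset.Icc 1 r, (1 - cos (j * θ))) / r := by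
  have : (r : ℝ) ≠ 0 := by positivity
  rw [cosAvg, Finset.sum_sub_distrib]
  simp [sub_div, this]

theorem one_sub_cosAvg_le {r : ℕ} (hr : 0 < r) (θ : ℝ) :
    1 - cosAvg r θ ≤ θ ^ 2 * ((r + 1) * (2 * r + 1)) / 12 := by
  have hr0 : (0 : ℝ) < r := by positivity
  rw [one_sub_cosAvg hr, div_le_iff₀ hr0]
  calc _ ≤ ∑ j ∈ Finset.Icc 1 r, (θ ^ 2 / 2) * (j : ℝ) ^ 2 := by
        refine Finset.sum_le_sum fun j _ => ?_
        have := one_sub_sq_div_two_le_cos (x := j * θ)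
        nlinarith
    _ = _ := by rw [← Finset.mul_sum, sum_Icc_sq]; ring

theorem cos_le_one_sub_sq_add (u : ℝ) : cos u ≤ 1 - u ^ 2 / 2 + u ^ 4 / 2 := by
  by_cases hu : |u| ≤ 1
  · have := (abs_le.1 (cos_bound hu)).2
    have h4 : |u| ^ 4 = u ^ 4 := by rw [← abs_pow, abs_of_nonneg (by positivity)]
    rw [h4] at this
    nlinarith [show 0 ≤ u ^ 4 by positivity]
  · push Not at hu
    have h1 : 1 ≤ u ^ 2 := by rw [← sq_abs]; nlinarith
    nlinarith [cos_le_one u]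

theorem le_one_sub_cosAvg {r : ℕ} (hr : 0 < r) (θ : ℝ) :
    θ ^ 2 * ((r + 1) * (2 * r + 1)) / 12 - (θ * r) ^ 4 / 2 ≤ 1 - cosAvg r θ := by
  have hr0 : (0 : ℝ) < r := by positivity
  rw [one_sub_cosAvg hr, le_div_iff₀ hr0]
  calc _ = ∑ j ∈ Finset.Icc 1 r, ((θ ^ 2 / 2) * (j : ℝ) ^ 2 - (θ * r) ^ 4 / 2) := by
        rw [Finset.sum_sub_distrib, ← Finset.mul_sum, sum_Icc_sq]
        simp
        ring
    _ ≤ _ := by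
        refine Finset.sum_le_sum fun j hj => ?_
        rw [Finset.mem_Icc] at hj
        have hj' : (j : ℝ) ≤ r := by exact_mod_cast hj.2
        have h1 := cos_le_one_sub_sq_add (j * θ)
        have h2 : (j * θ) ^ 4 ≤ (θ * r) ^ 4 := by
          rw [mul_comm, mul_pow, mul_pow]
          gcongr
        nlinarith

theorem quadratic_le_one_sub_cosAvg {r : ℕ} (hr : 0 < r) {θ : ℝ} (hθ : |θ| * r ≤ π) :
    2 / 5 * ((r * θ) ^ 2 / 6) ≤ 1 - cosAvg r θ := by
  have hr0 : (0 : ℝ) < r := by positivity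
  rw [one_sub_cosAvg hr, le_div_iff₀ hr0]
  have hpi : 1 / 5 ≤ 2 / π ^ 2 := by
    rw [div_le_div_iff₀ (by norm_num) (by positivity)]
    nlinarith [pi_lt_d2, pi_pos]
  calc _ ≤ ∑ j ∈ Finset.Icc 1 r, (θ ^ 2 / 5) * (j : ℝ) ^ 2 := by
        rw [← Finset.mul_sum, sum_Icc_sq]
        have : 0 ≤ θ ^ 2 * r * (3 * r + 1) := by positivity
        nlinarith
    _ ≤ _ := by
        refine Finset.sum_le_sum fun j hj => ?_
        rw [Finset.mem_Icc] at hj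
        have hj' : (j : ℝ) ≤ r := by exact_mod_cast hj.2
        have h1 := cos_le_one_sub_mul_cos_sq (x := j * θ) (by
          rw [abs_mul, Nat.abs_cast]
          nlinarith [abs_nonneg θ])
        have h2 : 1 / 5 * (j * θ) ^ 2 ≤ 2 / π ^ 2 * (j * θ) ^ 2 := by gcongr
        nlinarith

/-- Near the zero frequency the resolvent terms are those of the quadratic approximation. -/
theorem abs_resolvent_term_sub_le {r : ℕ} (hr : 0 < r) {θ c : ℝ} (hθ : |θ| * r ≤ π) (hc : 0 < c)
    (hrc : 1 ≤ r * c) :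
    |cosAvg r θ ^ 2 / (1 + c - cosAvg r θ) - 1 / (c + (r * θ) ^ 2 / 6)| ≤ 50 := by
  have hr0 : (0 : ℝ) < r := by positivity
  have hr1 : (1 : ℝ) ≤ r := by exact_mod_cast hr
  have h1 := quadratic_le_one_sub_cosAvg hr hθ
  have h2 := le_one_sub_cosAvg hr θ
  have h3 := one_sub_cosAvg_le hr θ
  have hl := abs_le.1 (abs_cosAvg_le r θ)
  set l := cosAvg r θ
  set x := (r * θ) ^ 2 / 6 with hx
  have hx0 : 0 ≤ x := by positivity
  have hθr : θ ^ 2 * r ≤ 6 * c * x := by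
    have : θ ^ 2 * r * 1 ≤ θ ^ 2 * r * (r * c) := by gcongr
    rw [hx]; nlinarith
  have hup : (1 - l) - x ≤ 2 * c * x + 18 * x ^ 2 := by
    have e1 : θ ^ 2 * ((r + 1) * (2 * r + 1)) / 12 - x = θ ^ 2 * (3 * r + 1) / 12 := by
      rw [hx]; ring
    nlinarith [sq_nonneg θ, sq_nonneg x]
  have hlo : -(2 * c * x + 18 * x ^ 2) ≤ (1 - l) - x := by
    have e1 : θ ^ 2 * ((r + 1) * (2 * r + 1)) / 12 - x = θ ^ 2 * (3 * r + 1) / 12 := by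
      rw [hx]; ring
    have e2 : (θ * r) ^ 4 / 2 = 18 * x ^ 2 := by rw [hx]; ring
    have e3 : 0 ≤ θ ^ 2 * (3 * r + 1) / 12 := by positivity
    nlinarith [mul_nonneg hc.le hx0]
  have hD : 0 < 1 + c - l := by linarith
  have hX : 0 < c + x := by linarith
  have e4 : l ^ 2 / (1 + c - l) - 1 / (c + x) =
      (-((1 - l) * (1 + l)) * (c + x) + (x - (1 - l))) / ((1 + c - l) * (c + x)) := by
    field_simp
    ring
  have hP : 0 < (1 + c - l) * (c + x) := by positivity
  rw [e4, abs_div, abs_of_pos hP, div_le_iff₀ hP]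
  have h5 : |(-((1 - l) * (1 + l)) * (c + x) + (x - (1 - l)))| ≤
      2 * ((1 + c - l) * (c + x)) + (2 * c * x + 18 * x ^ 2) := by
    have h6 : (1 - l) * (1 + l) ≤ 2 * (1 + c - l) := by nlinarith
    have h7 : 0 ≤ (1 - l) * (1 + l) := mul_nonneg (by linarith) (by linarith)
    have h8 := mul_le_mul_of_nonneg_right h6 hX.le
    have h9 := mul_nonneg h7 hX.le
    rw [abs_le]
    constructor <;> nlinarith
  have h10 : 2 * c * x ≤ 2 * ((1 + c - l) * (c + x)) := by
    have : c * x ≤ (1 + c - l) * (c + x) := by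
      apply mul_le_mul <;> linarith
    linarith
  have h11 : 18 * x ^ 2 ≤ 45 * ((1 + c - l) * (c + x)) := by
    have : (2 / 5 * x) * x ≤ (1 + c - l) * (c + x) := by
      apply mul_le_mul <;> linarith
    nlinarith
  linarith

theorem arctan_sub_mem {u v : ℝ} (hu : 0 ≤ u) (huv : u ≤ v) :
    1 / (1 + v ^ 2) * (v - u) ≤ arctan v - arctan u ∧
      arctan v - arctan u ≤ 1 / (1 + u ^ 2) * (v - u) := by
  have hd : DifferentiableOn ℝ arctan (interior (Set.Icc u v)) :=
    differentiable_arctan.differentiableOn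
  constructor
  · refine (convex_Icc u v).mul_sub_le_image_sub_of_le_deriv continuous_arctan.continuousOn hd
      (fun x hx => ?_) u (Set.left_mem_Icc.2 huv) v (Set.right_mem_Icc.2 huv) huv
    rw [interior_Icc] at hx
    rw [Real.deriv_arctan]
    have : 0 ≤ x := hu.trans hx.1.le
    have := hx.2.le
    simp only
    gcongr
  · refine (convex_Icc u v).image_sub_le_mul_sub_of_deriv_le continuous_arctan.continuousOn hd
      (fun x hx => ?_) u (Set.left_mem_Icc.2 huv) v (Set.right_mem_Icc.2 huv) huv
    rw [interior_Icc] at hx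
    rw [Real.deriv_arctan]
    have := hx.1.le
    simp only
    gcongr

theorem mul_sum_le_arctan {w : ℝ} (hw : 0 ≤ w) (m : ℕ) :
    w * ∑ k ∈ Finset.Icc 1 m, 1 / (1 + (w * k) ^ 2) ≤ arctan (w * m) := by
  induction m with
  | zero => simp
  | succ m ih =>
    rw [Finset.sum_Icc_succ_top (by omega), mul_add]
    have := (arctan_sub_mem (u := w * m) (v := w * (m + 1 : ℕ)) (by positivity)
      (by push_cast; nlinarith)).1
    have e : w * ((m + 1 : ℕ) : ℝ) - w * m = w := by push_cast; ring
    rw [e] at this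
    linarith

theorem arctan_le_mul_sum {w : ℝ} (hw : 0 ≤ w) (m : ℕ) :
    arctan (w * (m + 1)) ≤ w + w * ∑ k ∈ Finset.Icc 1 m, 1 / (1 + (w * k) ^ 2) := by
  induction m with
  | zero =>
    have := (arctan_sub_mem (u := 0) (v := w) le_rfl hw).2
    simp at this ⊢
    linarith
  | succ m ih =>
    rw [Finset.sum_Icc_succ_top (by omega), mul_add w (Finset.sum _ _)]
    have := (arctan_sub_mem (u := w * (m + 1 : ℕ)) (v := w * ((m + 1 : ℕ) + 1)) (by positivity)
      (by nlinarith)).2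
    have e : w * (((m + 1 : ℕ) : ℝ) + 1) - w * (m + 1 : ℕ) = w := by ring
    rw [e] at this
    push_cast at this ih ⊢
    linarith

theorem sum_range_eq_of_symm {n m : ℕ} (hm : 2 * m + 1 ≤ n) (t : ℕ → ℝ)
    (ht : ∀ k ≤ n, t (n - k) = t k) :
    ∑ k ∈ Finset.range n, t k = t 0 + 2 * ∑ k ∈ Finset.Icc 1 m, t k +
      ∑ k ∈ Finset.Ico (m + 1) (n - m), t k := by
  have h1 : ∑ k ∈ Finset.Ico (n - m) n, t k = ∑ k ∈ Finset.Icc 1 m, t k := by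
    refine Finset.sum_bij' (fun k _ => n - k) (fun k _ => n - k) ?_ ?_ ?_ ?_ ?_
    · intro k hk; simp only [Finset.mem_Ico, Finset.mem_Icc] at *; omega
    · intro k hk; simp only [Finset.mem_Ico, Finset.mem_Icc] at *; omega
    · intro k hk; simp only [Finset.mem_Ico] at hk; omega
    · intro k hk; simp only [Finset.mem_Icc] at hk; omega
    · intro k hk
      simp only [Finset.mem_Ico] at hk
      rw [ht k (by omega)]
  have h2 : Finset.Icc 1 m = Finset.Ico 1 (m + 1) := by
    ext; simp only [Finset.mem_Icc, Finset.mem_Ico]; omega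
  rw [Finset.range_eq_Ico, Finset.sum_eq_sum_Ico_succ_bot (by omega),
    ← Finset.sum_Ico_consecutive t (show 0 + 1 ≤ m + 1 by omega) (show m + 1 ≤ n by omega),
    ← Finset.sum_Ico_consecutive t (show m + 1 ≤ n - m by omega) (show n - m ≤ n by omega), h1, h2]
  ring

/-- The resolvent sum of the circulant operator up to the identity part. -/
def resolventSum (n r : ℕ) (c : ℝ) : ℝ :=
  ∑ k ∈ Finset.range n, cosAvg r (freq n k) ^ 2 / (1 + c - cosAvg r (freq n k))

theorem abs_resolventSum_sub_le {n r : ℕ} (hr : 2 ≤ r) (hrn : 2 * r < n) {c : ℝ} (hc : 0 < c)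
    (hrc : 1 ≤ r * c) :
    |resolventSum n r c - 2 * ∑ k ∈ Finset.Icc 1 (n / (2 * r)),
        1 / (c + (r * freq n k) ^ 2 / 6)| ≤ 1 / c + 51 * (n / r) := by
  have hn : 0 < n := by omega
  have hrpos : 0 < r := by omega
  have hr0 : (0 : ℝ) < r := by positivity
  have hn0 : (0 : ℝ) < n := by positivity
  set m := n / (2 * r) with hm
  have hm1 : 2 * r * m ≤ n := Nat.mul_div_le n (2 * r)
  have hm2 : n < 2 * r * (m + 1) := Nat.lt_mul_div_succ n (by omega)
  have hm3 : 2 * m + 1 ≤ n := by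
    have : 4 * m ≤ 2 * r * m := Nat.mul_le_mul_right _ (by omega)
    omega
  set t : ℕ → ℝ := fun k => cosAvg r (freq n k) ^ 2 / (1 + c - cosAvg r (freq n k)) with ht
  have hsplit : resolventSum n r c = t 0 + 2 * ∑ k ∈ Finset.Icc 1 m, t k +
      ∑ k ∈ Finset.Ico (m + 1) (n - m), t k :=
    sum_range_eq_of_symm hm3 t fun k hk => by simp only [ht, cosAvg_freq_sub hk hn]
  have ht0 : t 0 = 1 / c := by
    simp only [ht, freq, Nat.cast_zero, mul_zero, zero_div, cosAvg_zero hrpos]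
    norm_num
  have hnear : |∑ k ∈ Finset.Icc 1 m, t k -
      ∑ k ∈ Finset.Icc 1 m, 1 / (c + (r * freq n k) ^ 2 / 6)| ≤ 50 * m := by
    rw [← Finset.sum_sub_distrib]
    refine (Finset.abs_sum_le_sum_abs _ _).trans ?_
    calc _ ≤ ∑ k ∈ Finset.Icc 1 m, (50 : ℝ) := by
          refine Finset.sum_le_sum fun k hk => ?_
          rw [Finset.mem_Icc] at hk
          refine abs_resolvent_term_sub_le hrpos ?_ hc hrc
          have h0 : 0 ≤ freq n k := by rw [freq]; positivity
          have h1 : (2 * r * k : ℝ) ≤ n := by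
            exact_mod_cast (Nat.mul_le_mul_left (2 * r) hk.2).trans hm1
          rw [abs_of_nonneg h0, freq, div_mul_eq_mul_div, div_le_iff₀ hn0]
          nlinarith [pi_pos]
      _ = 50 * m := by simp [mul_comm]
  have hfar0 : ∀ k, 0 ≤ t k := fun k =>
    div_nonneg (sq_nonneg _) (by linarith [(abs_le.1 (abs_cosAvg_le r (freq n k))).2])
  have hfar : ∑ k ∈ Finset.Ico (m + 1) (n - m), t k ≤ n / r := by
    calc _ ≤ ∑ k ∈ Finset.Ico (m + 1) (n - m), 2 * cosAvg r (freq n k) ^ 2 := by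
          refine Finset.sum_le_sum fun k hk => ?_
          rw [Finset.mem_Ico] at hk
          have h1 : m + 1 ≤ n - k := by omega
          have h2 := cosAvg_freq_le_half (n := n) (r := r) (k := k) hrpos
            (hm2.le.trans (Nat.mul_le_mul_left _ hk.1))
            (hm2.le.trans (Nat.mul_le_mul_left _ h1)) (by omega) hn
          simp only [ht]
          rw [div_le_iff₀ (by linarith)]
          nlinarith [sq_nonneg (cosAvg r (freq n k))]
      _ ≤ ∑ k ∈ Finset.range n, 2 * cosAvg r (freq n k) ^ 2 := by
          refine Finset.sum_le_sum_of_subset_of_nonneg ?_ fun _ _ _ => by positivity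
          intro k hk
          simp only [Finset.mem_Ico, Finset.mem_range] at *
          omega
      _ = n / r := by
          rw [← Finset.mul_sum, sum_cosAvg_sq hrpos hrn]
          field_simp
  have hfar1 : 0 ≤ ∑ k ∈ Finset.Ico (m + 1) (n - m), t k := Finset.sum_nonneg fun k _ => hfar0 k
  have hmr : (100 * m : ℝ) ≤ 50 * (n / r) := by
    have : (2 * r * m : ℝ) ≤ n := by exact_mod_cast hm1
    rw [← mul_div_assoc, le_div_iff₀ hr0]
    nlinarith
  rw [hsplit, ht0]
  have hcpos : 0 ≤ 1 / c := by positivity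
  rw [abs_le] at hnear ⊢
  constructor <;> linarith [hnear.1, hnear.2]

theorem resolventSum_nonneg (n r : ℕ) {c : ℝ} (hc : 0 < c) : 0 ≤ resolventSum n r c :=
  Finset.sum_nonneg fun k _ => div_nonneg (sq_nonneg _)
    (by linarith [(abs_le.1 (abs_cosAvg_le r (freq n k))).2])

/-- Two-sided bound on the normalized resolvent sum at the critical shift. -/
theorem resolventSum_div_mem {n r : ℕ} (hr : 2 ≤ r) (hrn : 2 * r < n) {c : ℝ} (hc : 0 < c)
    (hcr : c ^ 3 * r ^ 2 = 3 / 2) :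
    2 / π * arctan (π / √(6 * c)) - 3 / (n * c ^ 2) - 51 / (r * c) ≤ resolventSum n r c / (n * c) ∧
      resolventSum n r c / (n * c) ≤ 1 + 1 / (n * c ^ 2) + 51 / (r * c) := by
  have hn : 0 < n := by omega
  have hr0 : (0 : ℝ) < r := by positivity
  have hr2 : (2 : ℝ) ≤ r := by exact_mod_cast hr
  have hn0 : (0 : ℝ) < n := by positivity
  have hrc : 1 ≤ r * c := by
    have : 1 ≤ (r * c) ^ 3 := by nlinarith
    by_contra! h
    exact absurd this (not_le.2 (pow_lt_one₀ (by positivity) h (by norm_num)))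
  have hmain := abs_resolventSum_sub_le hr hrn hc hrc
  set m := n / (2 * r) with hm
  have hm2 : n < 2 * r * (m + 1) := Nat.lt_mul_div_succ n (by omega)
  set w : ℝ := 2 * π * r / (n * √(6 * c)) with hw
  have hs : √(6 * c) ^ 2 = 6 * c := sq_sqrt (by positivity)
  have hs0 : 0 < √(6 * c) := sqrt_pos.2 (by positivity)
  have hw0 : 0 < w := by positivity
  have hterm : ∀ k : ℕ, 1 / (c + (r * freq n k) ^ 2 / 6) = 1 / c * (1 / (1 + (w * k) ^ 2)) := by
    intro k
    have h : (w * k) ^ 2 = (2 * π * r * k) ^ 2 / (n ^ 2 * (6 * c)) := by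
      rw [hw, div_mul_eq_mul_div, div_pow, mul_pow (n : ℝ), hs]
    have : (r * freq n k) ^ 2 / 6 = c * (w * k) ^ 2 := by
      rw [h, freq]
      field_simp
    rw [this, one_div_mul_one_div, mul_add, mul_one]
  simp_rw [hterm] at hmain
  rw [← Finset.mul_sum] at hmain
  set S := ∑ k ∈ Finset.Icc 1 m, 1 / (1 + (w * k) ^ 2) with hS
  have hup : w * S ≤ π / 2 := (mul_sum_le_arctan hw0.le m).trans (arctan_lt_pi_div_two _).le
  have hlo := arctan_le_mul_sum hw0.le m
  have hlo' : arctan (π / √(6 * c)) ≤ w + w * S := by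
    refine le_trans (arctan_mono ?_) hlo
    have : (n : ℝ) ≤ 2 * r * (m + 1) := by exact_mod_cast hm2.le
    rw [hw, div_mul_eq_mul_div, div_le_div_iff₀ hs0 (by positivity)]
    have := mul_le_mul_of_nonneg_left this (show 0 ≤ π * √(6 * c) by positivity)
    nlinarith
  have hcw : n * c ^ 2 * w = π := by
    have h3 : r * c * √(6 * c) = 3 := by
      have : (r * c * √(6 * c)) ^ 2 = 3 ^ 2 := by
        rw [mul_pow, hs]; nlinarith
      exact (pow_left_inj₀ (by positivity) (by norm_num) two_ne_zero).1 this
    have h : 2 * r * c ^ 2 = √(6 * c) := by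
      linear_combination (√(6 * c) / 3) * h3 - (r * c / 3) * hs
    rw [hw, mul_div_assoc', div_eq_iff (by positivity)]
    linear_combination (π * n) * h
  have hnc : 0 < n * c := by positivity
  have e1 : 2 * (1 / c * S) / (n * c) = 2 / π * (w * S) := by
    rw [← hcw]; field_simp
  have e2 : (1 / c + 51 * (n / r)) / (n * c) = 1 / (n * c ^ 2) + 51 / (r * c) := by
    field_simp
  have e3 : 2 / π * w = 2 / (n * c ^ 2) := by
    rw [← hcw]; field_simp
  rw [abs_le] at hmain
  have h1 := div_le_div_of_nonneg_right hmain.2 hnc.le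
  have h2 := div_le_div_of_nonneg_right hmain.1 hnc.le
  rw [neg_div, e2, sub_div, e1] at h2
  rw [e2, sub_div, e1] at h1
  have hpi : 0 < 2 / π := by positivity
  have h3 := mul_le_mul_of_nonneg_left hup hpi.le
  have h4 := mul_le_mul_of_nonneg_left hlo' hpi.le
  rw [mul_add, e3] at h4
  have e4 : 2 / π * (π / 2) = 1 := by field_simp
  have e5 : 3 / (n * c ^ 2) = 2 / (n * c ^ 2) + 1 / (n * c ^ 2) := by ring
  constructor <;> linarith

/-- The resolvent sum asymptotics at the critical shift `c ^ 3 = 3 / (2 r ^ 2)`. -/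
theorem tendsto_resolventSum {r : ℕ → ℕ} {c : ℕ → ℝ} (hr : Tendsto r atTop atTop)
    (hrn : ∀ᶠ n in atTop, 2 * r n < n) (hc : ∀ᶠ n in atTop, 0 < c n)
    (hcr : ∀ᶠ n in atTop, c n ^ 3 * (r n : ℝ) ^ 2 = 3 / 2)
    (hc0 : Tendsto c atTop (𝓝 0)) (hrc : Tendsto (fun n => r n * c n) atTop atTop)
    (hnc : Tendsto (fun n : ℕ => n * c n ^ 2) atTop atTop) :
    Tendsto (fun n => resolventSum n (r n) (c n) / (n * c n)) atTop (𝓝 1) := by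
  have hsq : Tendsto (fun n => π / √(6 * c n)) atTop atTop := by
    have h1 : Tendsto (fun n => √(6 * c n)) atTop (𝓝[>] 0) := by
      rw [tendsto_nhdsWithin_iff]
      constructor
      · have : Tendsto (fun n => √(6 * c n)) atTop (𝓝 √(6 * 0)) :=
          (continuous_sqrt.tendsto _).comp (hc0.const_mul 6)
        simpa using this
      · filter_upwards [hc] with n hn
        exact sqrt_pos.2 (by positivity)
    simp_rw [div_eq_mul_inv]
    exact (tendsto_inv_nhdsGT_zero.comp h1).const_mul_atTop pi_pos
  have hat : Tendsto (fun n => 2 / π * arctan (π / √(6 * c n))) atTop (𝓝 1) := by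
    have := ((tendsto_nhds_of_tendsto_nhdsWithin tendsto_arctan_atTop).comp hsq).const_mul (2 / π)
    have e : 2 / π * (π / 2) = 1 := by field_simp
    rw [e] at this
    exact this
  have hlow : Tendsto (fun n : ℕ => 2 / π * arctan (π / √(6 * c n)) - 3 / (n * c n ^ 2) -
      51 / (r n * c n)) atTop (𝓝 1) := by
    simpa using (hat.sub (hnc.const_div_atTop 3)).sub (hrc.const_div_atTop 51)
  have hupp : Tendsto (fun n : ℕ => 1 + 1 / (n * c n ^ 2) + 51 / (r n * c n)) atTop (𝓝 1) := by
    simpa only [add_zero] using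
      ((hnc.const_div_atTop 1).const_add 1).add (hrc.const_div_atTop 51)
  refine tendsto_of_tendsto_of_tendsto_of_le_of_le' hlow hupp ?_ ?_
  all_goals
    filter_upwards [hr.eventually_ge_atTop 2, hrn, hc, hcr] with n h1 h2 h3 h4
  exacts [(resolventSum_div_mem h1 h2 h3 h4).1, (resolventSum_div_mem h1 h2 h3 h4).2]

/-- Measurable functions on `ℝ^ι` of at most polynomial growth. -/
def PolyGrowth {ι : Type*} [Fintype ι] (g : (ι → ℝ) → ℝ) : Prop :=
  Measurable g ∧ ∃ (C : ℝ) (k : ℕ), ∀ x, |g x| ≤ C * (1 + x ⬝ᵥ x) ^ k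

/-- The density `exp ((|ι| / 2) ⟨x, A x⟩ / |x|² - |x|² / 2)`. -/
def gibbsWeight {ι : Type*} [Fintype ι] (A : Matrix ι ι ℝ) (x : ι → ℝ) : ℝ :=
  exp (Fintype.card ι / 2 * ((x ⬝ᵥ A.mulVec x) / (x ⬝ᵥ x)) - x ⬝ᵥ x / 2)

/-- The unnormalized measure with density `gibbsWeight`. -/
def gibbs {ι : Type*} [Fintype ι] (A : Matrix ι ι ℝ) : Measure (ι → ℝ) :=
  volume.withDensity fun x => ENNReal.ofReal (gibbsWeight A x)

section
variable {ι : Type*} [Fintype ι]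

theorem dotProduct_self_nonneg' (x : ι → ℝ) : 0 ≤ x ⬝ᵥ x :=
  Finset.sum_nonneg fun i _ => mul_self_nonneg (x i)

namespace PolyGrowth

theorem exists_pos_bound {g : (ι → ℝ) → ℝ} (hg : PolyGrowth g) :
    ∃ (C : ℝ) (k : ℕ), 0 ≤ C ∧ ∀ x, |g x| ≤ C * (1 + x ⬝ᵥ x) ^ k := by
  obtain ⟨-, C, k, h⟩ := hg
  refine ⟨C, k, ?_, h⟩
  simpa using (abs_nonneg _).trans (h 0)

theorem of_bounded {g : (ι → ℝ) → ℝ} (hg : Measurable g) {C : ℝ} (hC : ∀ x, |g x| ≤ C) :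
    PolyGrowth g := ⟨hg, C, 0, by simpa using hC⟩

theorem const (c : ℝ) : PolyGrowth fun _ : ι → ℝ => c :=
  of_bounded measurable_const fun _ => le_rfl

theorem add {f g : (ι → ℝ) → ℝ} (hf : PolyGrowth f) (hg : PolyGrowth g) :
    PolyGrowth fun x => f x + g x := by
  obtain ⟨C, k, hC, h⟩ := hf.exists_pos_bound
  obtain ⟨D, l, hD, h'⟩ := hg.exists_pos_bound
  refine ⟨hf.1.add hg.1, C + D, max k l, fun x => (abs_add_le _ _).trans ?_⟩
  have h1 : 1 ≤ 1 + x ⬝ᵥ x := by linarith [dotProduct_self_nonneg' x]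
  rw [add_mul]
  refine add_le_add ((h x).trans ?_) ((h' x).trans ?_)
  · exact mul_le_mul_of_nonneg_left (pow_le_pow_right₀ h1 (le_max_left _ _)) hC
  · exact mul_le_mul_of_nonneg_left (pow_le_pow_right₀ h1 (le_max_right _ _)) hD

theorem mul {f g : (ι → ℝ) → ℝ} (hf : PolyGrowth f) (hg : PolyGrowth g) :
    PolyGrowth fun x => f x * g x := by
  obtain ⟨C, k, hC, h⟩ := hf.exists_pos_bound
  obtain ⟨D, l, hD, h'⟩ := hg.exists_pos_bound
  refine ⟨hf.1.mul hg.1, C * D, k + l, fun x => ?_⟩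
  have h1 : 0 ≤ 1 + x ⬝ᵥ x := by linarith [dotProduct_self_nonneg' x]
  rw [abs_mul, pow_add, mul_mul_mul_comm]
  exact mul_le_mul (h x) (h' x) (abs_nonneg _) (by positivity)

theorem neg {f : (ι → ℝ) → ℝ} (hf : PolyGrowth f) : PolyGrowth fun x => -f x := by
  simpa using (const (-1)).mul hf

theorem sub {f g : (ι → ℝ) → ℝ} (hf : PolyGrowth f) (hg : PolyGrowth g) :
    PolyGrowth fun x => f x - g x := by
  simpa only [sub_eq_add_neg] using hf.add hg.neg

theorem abs {f : (ι → ℝ) → ℝ} (hf : PolyGrowth f) : PolyGrowth fun x => |f x| :=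
  ⟨hf.1.abs, by simpa only [abs_abs] using hf.2⟩

theorem pow {f : (ι → ℝ) → ℝ} (hf : PolyGrowth f) (k : ℕ) : PolyGrowth fun x => f x ^ k := by
  induction k with
  | zero => simpa using const 1
  | succ k ih => simpa only [pow_succ] using ih.mul hf

theorem sum {κ : Type*} {s : Finset κ} {f : κ → (ι → ℝ) → ℝ} (hf : ∀ i ∈ s, PolyGrowth (f i)) :
    PolyGrowth fun x => ∑ i ∈ s, f i x := by
  classical
  induction s using Finset.induction_on with
  | empty => simpa using const 0
  | insert a s ha ih =>
    simp only [Finset.sum_insert ha]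
    exact (hf a (by simp)).add (ih fun i hi => hf i (by simp [hi]))

theorem coord (i : ι) : PolyGrowth fun x : ι → ℝ => x i := by
  refine ⟨measurable_pi_apply i, 1, 1, fun x => ?_⟩
  have h : x i * x i ≤ x ⬝ᵥ x :=
    Finset.single_le_sum (f := fun i => x i * x i) (fun j _ => mul_self_nonneg (x j))
      (Finset.mem_univ i)
  rw [pow_one, one_mul]
  cases abs_cases (x i) <;> nlinarith

theorem mulVec_apply (M : Matrix ι ι ℝ) (i : ι) : PolyGrowth fun x : ι → ℝ => M.mulVec x i :=
  sum fun j _ => (const (M i j)).mul (coord j)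

theorem dotProduct {u v : (ι → ℝ) → ι → ℝ} (hu : ∀ i, PolyGrowth fun x => u x i)
    (hv : ∀ i, PolyGrowth fun x => v x i) : PolyGrowth fun x => u x ⬝ᵥ v x :=
  sum fun i _ => (hu i).mul (hv i)

theorem dotProduct_self : PolyGrowth fun x : ι → ℝ => x ⬝ᵥ x := dotProduct coord coord

theorem quadForm (M : Matrix ι ι ℝ) : PolyGrowth fun x : ι → ℝ => x ⬝ᵥ M.mulVec x :=
  dotProduct coord (mulVec_apply M)

theorem div_dotProduct_self {f : (ι → ℝ) → ℝ} (hf : Measurable f) {C : ℝ}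
    (h : ∀ x, |f x| ≤ C * (x ⬝ᵥ x)) : PolyGrowth fun x => f x / (x ⬝ᵥ x) := by
  refine of_bounded (C := |C|) (hf.div dotProduct_self.1) fun x => ?_
  rw [abs_div, abs_of_nonneg (dotProduct_self_nonneg' x)]
  refine div_le_of_le_mul₀ (dotProduct_self_nonneg' x) (abs_nonneg _) ((h x).trans ?_)
  exact mul_le_mul_of_nonneg_right (le_abs_self C) (dotProduct_self_nonneg' x)

end PolyGrowth

theorem exists_one_add_pow_le_exp (k : ℕ) :
    ∃ C : ℝ, 0 ≤ C ∧ ∀ t : ℝ, 0 ≤ t → (1 + t) ^ k ≤ C * exp (t / 4) := by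
  refine ⟨4 ^ k * k.factorial * exp (1 / 4), by positivity, fun t ht => ?_⟩
  have h := pow_div_factorial_le_exp ((1 + t) / 4) (by positivity) k
  rw [div_le_iff₀ (by positivity), div_pow, div_le_iff₀ (by positivity)] at h
  refine h.trans (le_of_eq ?_)
  rw [add_div, exp_add]
  ring

theorem integrable_exp_neg_dotProduct_self_div_four :
    Integrable (fun x : ι → ℝ => exp (-(x ⬝ᵥ x) / 4)) := by
  have h : Integrable (fun t : ℝ => exp (-(1 / 4) * t ^ 2)) :=
    integrable_exp_neg_mul_sq (by norm_num)
  have := Integrable.fintype_prod (ι := ι) (μ := fun _ => (volume : Measure ℝ))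
    (f := fun _ => fun t : ℝ => exp (-(1 / 4) * t ^ 2)) fun _ => h
  refine this.congr (Eventually.of_forall fun x => ?_)
  simp only [dotProduct, ← exp_sum]
  congr 1
  rw [neg_div, Finset.sum_div, ← Finset.sum_neg_distrib]
  exact Finset.sum_congr rfl fun i _ => by ring

theorem measurable_gibbsWeight (A : Matrix ι ι ℝ) : Measurable (gibbsWeight A) :=
  measurable_exp.comp (((((PolyGrowth.quadForm A).1.div PolyGrowth.dotProduct_self.1)).const_mul
    _).sub (PolyGrowth.dotProduct_self.1.div_const 2))

theorem gibbsWeight_pos (A : Matrix ι ι ℝ) (x : ι → ℝ) : 0 < gibbsWeight A x := exp_pos _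

theorem gibbsWeight_le {A : Matrix ι ι ℝ} (hA : ∀ x, |x ⬝ᵥ A.mulVec x| ≤ x ⬝ᵥ x) (x : ι → ℝ) :
    gibbsWeight A x ≤ exp (Fintype.card ι / 2) * exp (-(x ⬝ᵥ x) / 2) := by
  rw [gibbsWeight, ← exp_add, exp_le_exp]
  have : (x ⬝ᵥ A.mulVec x) / (x ⬝ᵥ x) ≤ 1 :=
    div_le_one_of_le₀ ((le_abs_self _).trans (hA x)) (dotProduct_self_nonneg' x)
  have := mul_le_mul_of_nonneg_left this (show (0 : ℝ) ≤ Fintype.card ι / 2 by positivity)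
  linarith

theorem PolyGrowth.integrable_mul_gibbsWeight {A : Matrix ι ι ℝ}
    (hA : ∀ x, |x ⬝ᵥ A.mulVec x| ≤ x ⬝ᵥ x) {g : (ι → ℝ) → ℝ} (hg : PolyGrowth g) :
    Integrable fun x => g x * gibbsWeight A x := by
  obtain ⟨C, k, hC, h⟩ := hg.exists_pos_bound
  obtain ⟨D, hD, h'⟩ := exists_one_add_pow_le_exp k
  refine (integrable_exp_neg_dotProduct_self_div_four.const_mul
    (C * D * exp (Fintype.card ι / 2))).mono'
    (hg.1.mul (measurable_gibbsWeight A)).aestronglyMeasurable (Eventually.of_forall fun x => ?_)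
  rw [norm_eq_abs, abs_mul, abs_of_pos (gibbsWeight_pos A x)]
  calc _ ≤ (C * (D * exp (x ⬝ᵥ x / 4))) *
        (exp (Fintype.card ι / 2) * exp (-(x ⬝ᵥ x) / 2)) := by
        refine mul_le_mul ((h x).trans ?_) (gibbsWeight_le hA x) (gibbsWeight_pos A x).le
          (by positivity)
        exact mul_le_mul_of_nonneg_left (h' _ (dotProduct_self_nonneg' x)) hC
    _ = _ := by
        have : exp (-(x ⬝ᵥ x) / 4) = exp (x ⬝ᵥ x / 4) * exp (-(x ⬝ᵥ x) / 2) := by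
          rw [← exp_add]; ring_nf
        rw [this]; ring

theorem integral_gibbs (A : Matrix ι ι ℝ) (g : (ι → ℝ) → ℝ) :
    ∫ x, g x ∂gibbs A = ∫ x, g x * gibbsWeight A x := by
  rw [gibbs, integral_withDensity_eq_integral_toReal_smul
    (measurable_gibbsWeight A).ennreal_ofReal (by simp)]
  refine integral_congr_ae (Eventually.of_forall fun x => ?_)
  simp [(gibbsWeight_pos A x).le, mul_comm]

theorem PolyGrowth.integrable {A : Matrix ι ι ℝ} (hA : ∀ x, |x ⬝ᵥ A.mulVec x| ≤ x ⬝ᵥ x)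
    {g : (ι → ℝ) → ℝ} (hg : PolyGrowth g) : Integrable g (gibbs A) := by
  rw [gibbs, integrable_withDensity_iff (measurable_gibbsWeight A).ennreal_ofReal (by simp)]
  refine (hg.integrable_mul_gibbsWeight hA).congr (Eventually.of_forall fun x => ?_)
  simp [(gibbsWeight_pos A x).le]

theorem hasLineDerivAt_quadForm (M : Matrix ι ι ℝ) (x v : ι → ℝ) :
    HasLineDerivAt ℝ (fun x : ι → ℝ => x ⬝ᵥ M.mulVec x)
      (v ⬝ᵥ M.mulVec x + x ⬝ᵥ M.mulVec v) x v := by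
  have h := (((hasDerivAt_id (0 : ℝ)).mul_const (v ⬝ᵥ M.mulVec x + x ⬝ᵥ M.mulVec v)).const_add
    (x ⬝ᵥ M.mulVec x)).add (((hasDerivAt_id (0 : ℝ)).pow 2).mul_const (v ⬝ᵥ M.mulVec v))
  rw [HasLineDerivAt]
  refine (h.congr_of_eventuallyEq (Eventually.of_forall fun t => ?_)).congr_deriv (by simp)
  · simp only [Matrix.mulVec_add, Matrix.mulVec_smul, add_dotProduct, dotProduct_add,
      smul_dotProduct, dotProduct_smul, smul_eq_mul, Pi.add_apply, id_eq, Pi.pow_apply]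
    ring

theorem hasLineDerivAt_dotProduct_self (x v : ι → ℝ) :
    HasLineDerivAt ℝ (fun x : ι → ℝ => x ⬝ᵥ x) (2 * (x ⬝ᵥ v)) x v := by
  classical
  have := hasLineDerivAt_quadForm (1 : Matrix ι ι ℝ) x v
  simp only [Matrix.one_mulVec] at this
  rwa [dotProduct_comm v x, ← two_mul] at this

theorem dotProduct_mulVec_of_isSymm {M : Matrix ι ι ℝ} (hM : M.IsSymm) (x y : ι → ℝ) :
    x ⬝ᵥ M.mulVec y = M.mulVec x ⬝ᵥ y := by
  rw [Matrix.dotProduct_mulVec, ← Matrix.mulVec_transpose, hM]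

theorem hasLineDerivAt_gibbsWeight {A : Matrix ι ι ℝ} (hsymm : A.IsSymm) {x : ι → ℝ} (hx : x ≠ 0)
    (v : ι → ℝ) :
    HasLineDerivAt ℝ (gibbsWeight A) (gibbsWeight A x *
      ((Fintype.card ι * (A.mulVec x ⬝ᵥ v) - Fintype.card ι * ((x ⬝ᵥ A.mulVec x) / (x ⬝ᵥ x)) *
        (x ⬝ᵥ v) - (x ⬝ᵥ x) * (x ⬝ᵥ v)) / (x ⬝ᵥ x))) x v := by
  have hx0 : x ⬝ᵥ x ≠ 0 := by rwa [Ne, dotProduct_self_eq_zero]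
  have ha : HasDerivAt (fun t : ℝ => (x + t • v) ⬝ᵥ A.mulVec (x + t • v)) _ 0 :=
    hasLineDerivAt_quadForm A x v
  have hb : HasDerivAt (fun t : ℝ => (x + t • v) ⬝ᵥ (x + t • v)) _ 0 :=
    hasLineDerivAt_dotProduct_self x v
  have h := (((ha.div hb (by simpa using hx0)).const_mul (Fintype.card ι / 2 : ℝ)).sub
    (hb.div_const 2)).exp
  refine HasDerivAt.congr_deriv h ?_
  have h1 : v ⬝ᵥ A.mulVec x = A.mulVec x ⬝ᵥ v := dotProduct_comm _ _
  have h2 : x ⬝ᵥ A.mulVec v = A.mulVec x ⬝ᵥ v := dotProduct_mulVec_of_isSymm hsymm x v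
  simp only [zero_smul, add_zero, Pi.div_apply, Pi.sub_apply, h1, h2]
  rw [gibbsWeight]
  congr 1
  field_simp
  ring

theorem hasLineDerivAt_zero_of_sq_bound {G : (ι → ℝ) → ℝ} {C : ℝ} {k : ℕ}
    (h : ∀ x, |G x| ≤ (x ⬝ᵥ x) * (C * (1 + x ⬝ᵥ x) ^ k)) (hC : 0 ≤ C) (v : ι → ℝ) :
    HasLineDerivAt ℝ G 0 0 v := by
  have hG0 : G 0 = 0 := by simpa using h 0
  rw [HasLineDerivAt, hasDerivAt_iff_isLittleO_nhds_zero]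
  simp only [zero_add, zero_smul, smul_zero, sub_zero, hG0]
  refine (Asymptotics.IsBigO.of_bound ((v ⬝ᵥ v) * (C * (1 + v ⬝ᵥ v) ^ k)) ?_).trans_isLittleO
    (Asymptotics.isLittleO_pow_id (𝕜 := ℝ) one_lt_two)
  filter_upwards [Metric.ball_mem_nhds (0 : ℝ) one_pos] with t ht
  rw [mem_ball_zero_iff, norm_eq_abs] at ht
  have ht2 : t ^ 2 ≤ 1 := by rw [← sq_abs]; exact pow_le_one₀ (abs_nonneg t) ht.le
  have e : (t • v) ⬝ᵥ (t • v) = t ^ 2 * (v ⬝ᵥ v) := by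
    simp only [smul_dotProduct, dotProduct_smul, smul_eq_mul]; ring
  have hv := dotProduct_self_nonneg' v
  have h1 := h (t • v)
  rw [e] at h1
  rw [norm_eq_abs, norm_eq_abs, abs_of_nonneg (sq_nonneg t)]
  calc _ ≤ t ^ 2 * (v ⬝ᵥ v) * (C * (1 + t ^ 2 * (v ⬝ᵥ v)) ^ k) := h1
    _ ≤ t ^ 2 * (v ⬝ᵥ v) * (C * (1 + v ⬝ᵥ v) ^ k) := by
        gcongr
        nlinarith
    _ = _ := by ring

/-- Integration by parts along a fixed direction. -/
theorem integral_gibbs_line {A : Matrix ι ι ℝ} (hA : ∀ x, |x ⬝ᵥ A.mulVec x| ≤ x ⬝ᵥ x)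
    (hsymm : A.IsSymm) {g P' : (ι → ℝ) → ℝ} (hg : PolyGrowth g) (hP' : PolyGrowth P')
    {v : ι → ℝ} (hP : ∀ x, HasLineDerivAt ℝ (fun x => (x ⬝ᵥ x) * g x) (P' x) x v) (h0 : P' 0 = 0) :
    ∫ x, (P' x + g x * (Fintype.card ι * (A.mulVec x ⬝ᵥ v) -
      Fintype.card ι * ((x ⬝ᵥ A.mulVec x) / (x ⬝ᵥ x)) * (x ⬝ᵥ v) -
        (x ⬝ᵥ x) * (x ⬝ᵥ v))) ∂gibbs A = 0 := by
  set F : (ι → ℝ) → ℝ := fun x => P' x + g x * (Fintype.card ι * (A.mulVec x ⬝ᵥ v) -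
      Fintype.card ι * ((x ⬝ᵥ A.mulVec x) / (x ⬝ᵥ x)) * (x ⬝ᵥ v) -
        (x ⬝ᵥ x) * (x ⬝ᵥ v)) with hF
  have hxv : PolyGrowth fun x : ι → ℝ => x ⬝ᵥ v :=
    PolyGrowth.dotProduct PolyGrowth.coord fun i => PolyGrowth.const (v i)
  have hAxv : PolyGrowth fun x : ι → ℝ => A.mulVec x ⬝ᵥ v :=
    PolyGrowth.dotProduct (PolyGrowth.mulVec_apply A) fun i => PolyGrowth.const (v i)
  have hq : PolyGrowth fun x : ι → ℝ => (x ⬝ᵥ A.mulVec x) / (x ⬝ᵥ x) :=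
    PolyGrowth.div_dotProduct_self (PolyGrowth.quadForm A).1 (C := 1) (by simpa using hA)
  have hFg : PolyGrowth F := hP'.add (hg.mul ((((PolyGrowth.const _).mul hAxv).sub
    (((PolyGrowth.const _).mul hq).mul hxv)).sub (PolyGrowth.dotProduct_self.mul hxv)))
  rw [integral_gibbs]
  have key := integral_bilinear_hasLineDerivAt_right_eq_neg_left_of_integrable
    (μ := (volume : Measure (ι → ℝ))) (f := fun _ => (1 : ℝ)) (f' := fun _ => (0 : ℝ))
    (g := fun x => (x ⬝ᵥ x) * g x * gibbsWeight A x) (g' := fun x => F x * gibbsWeight A x)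
    (v := v) (B := ContinuousLinearMap.mul ℝ ℝ) (by simp)
    (by simpa using hFg.integrable_mul_gibbsWeight hA)
    (by simpa using (PolyGrowth.dotProduct_self.mul hg).integrable_mul_gibbsWeight hA)
    (fun x _ => by simpa [HasLineDerivAt] using hasDerivAt_const (0 : ℝ) (1 : ℝ))
    (fun x _ => ?_)
  · simpa using key
  by_cases hx : x = 0
  · subst hx
    have e : F 0 * gibbsWeight A 0 = 0 := by simp [hF, h0]
    obtain ⟨C, k, hC, h⟩ := hg.exists_pos_bound
    rw [e]
    refine hasLineDerivAt_zero_of_sq_bound (C := C * exp (Fintype.card ι / 2)) (k := k)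
      (fun x => ?_) (by positivity) v
    rw [abs_mul, abs_mul, abs_of_nonneg (dotProduct_self_nonneg' x),
      abs_of_pos (gibbsWeight_pos A x), mul_assoc]
    refine mul_le_mul_of_nonneg_left ?_ (dotProduct_self_nonneg' x)
    have h1 : gibbsWeight A x ≤ exp (Fintype.card ι / 2) := by
      refine (gibbsWeight_le hA x).trans (mul_le_of_le_one_right (exp_pos _).le ?_)
      rw [exp_le_one_iff]
      linarith [dotProduct_self_nonneg' x]
    calc _ ≤ C * (1 + x ⬝ᵥ x) ^ k * exp (Fintype.card ι / 2) :=
          mul_le_mul (h x) h1 (gibbsWeight_pos A x).le ((abs_nonneg _).trans (h x))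
      _ = _ := by ring
  · have hx0 : x ⬝ᵥ x ≠ 0 := by rwa [Ne, dotProduct_self_eq_zero]
    have h1 : HasDerivAt (fun t : ℝ => ((x + t • v) ⬝ᵥ (x + t • v)) * g (x + t • v)) _ 0 := hP x
    have h2 : HasDerivAt (fun t : ℝ => gibbsWeight A (x + t • v)) _ 0 :=
      hasLineDerivAt_gibbsWeight hsymm hx v
    refine HasDerivAt.congr_deriv (h1.mul h2) ?_
    simp only [zero_smul, add_zero, hF]
    field_simp

/-- Integration by parts against the affine vector field `x ↦ b + M x`. -/
theorem integral_gibbs_affine [DecidableEq ι] {A : Matrix ι ι ℝ}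
    (hA : ∀ x, |x ⬝ᵥ A.mulVec x| ≤ x ⬝ᵥ x)
    (hsymm : A.IsSymm) {g : (ι → ℝ) → ℝ} {D : (ι → ℝ) → ι → ℝ} (hg : PolyGrowth g)
    (hD : ∀ i, PolyGrowth fun x => D x i)
    (hP : ∀ x v, HasLineDerivAt ℝ (fun x => (x ⬝ᵥ x) * g x) (D x ⬝ᵥ v) x v) (h0 : D 0 = 0)
    (b : ι → ℝ) (M : Matrix ι ι ℝ) :
    ∫ x, (M.trace * ((x ⬝ᵥ x) * g x) + D x ⬝ᵥ (b + M.mulVec x) +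
      g x * (Fintype.card ι * (A.mulVec x ⬝ᵥ (b + M.mulVec x)) -
      Fintype.card ι * ((x ⬝ᵥ A.mulVec x) / (x ⬝ᵥ x)) * (x ⬝ᵥ (b + M.mulVec x)) -
        (x ⬝ᵥ x) * (x ⬝ᵥ (b + M.mulVec x)))) ∂gibbs A = 0 := by
  have hV : ∀ i, PolyGrowth fun x => (b + M.mulVec x) i := fun i =>
    (PolyGrowth.const (b i)).add (PolyGrowth.mulVec_apply M i)
  have hq : PolyGrowth fun x : ι → ℝ => (x ⬝ᵥ A.mulVec x) / (x ⬝ᵥ x) :=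
    PolyGrowth.div_dotProduct_self (PolyGrowth.quadForm A).1 (C := 1) (by simpa using hA)
  have hP'g : ∀ i, PolyGrowth fun x => M i i * ((x ⬝ᵥ x) * g x) + D x i * (b + M.mulVec x) i :=
    fun i => ((PolyGrowth.const _).mul (PolyGrowth.dotProduct_self.mul hg)).add ((hD i).mul (hV i))
  have hone : ∀ i, ∫ x, (M i i * ((x ⬝ᵥ x) * g x) + D x i * (b + M.mulVec x) i +
      (b + M.mulVec x) i * g x * (Fintype.card ι * (A.mulVec x i) -
      Fintype.card ι * ((x ⬝ᵥ A.mulVec x) / (x ⬝ᵥ x)) * x i - (x ⬝ᵥ x) * x i)) ∂gibbs A = 0 := by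
    intro i
    have := integral_gibbs_line hA hsymm ((hV i).mul hg) (hP'g i) (v := Pi.single i 1) (fun x => ?_)
      (by simp [h0])
    · simpa only [dotProduct_single, mul_one] using this
    · have h1 : HasDerivAt (fun t : ℝ => ((x + t • Pi.single i (1 : ℝ)) ⬝ᵥ
          (x + t • Pi.single i (1 : ℝ))) * g (x + t • Pi.single i (1 : ℝ))) _ 0 :=
        hP x (Pi.single i 1)
      have h2 : HasDerivAt (fun t : ℝ => (b + M.mulVec (x + t • Pi.single i (1 : ℝ))) i)
          (M i i) 0 := by
        have := ((hasDerivAt_id (0 : ℝ)).mul_const (M i i)).const_add ((b + M.mulVec x) i)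
        rw [one_mul] at this
        refine this.congr_of_eventuallyEq (Eventually.of_forall fun t => ?_)
        simp [Matrix.mulVec_add, Matrix.mulVec_smul, add_assoc]
      have h3 := h1.mul h2
      simp only [zero_smul, add_zero, dotProduct_single, mul_one] at h3
      rw [HasLineDerivAt]
      refine (h3.congr_of_eventuallyEq (Eventually.of_forall fun t => ?_)).congr_deriv ?_
      · simp only [Pi.mul_apply]; ring
      · ring
  have hint : ∀ i ∈ Finset.univ, Integrable (fun x => M i i * ((x ⬝ᵥ x) * g x) +
      D x i * (b + M.mulVec x) i +
      (b + M.mulVec x) i * g x * (Fintype.card ι * (A.mulVec x i) -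
      Fintype.card ι * ((x ⬝ᵥ A.mulVec x) / (x ⬝ᵥ x)) * x i - (x ⬝ᵥ x) * x i)) (gibbs A) :=
    fun i _ => ((hP'g i).add (((hV i).mul hg).mul ((((PolyGrowth.const _).mul
      (PolyGrowth.mulVec_apply A i)).sub (((PolyGrowth.const _).mul hq).mul
      (PolyGrowth.coord i))).sub (PolyGrowth.dotProduct_self.mul (PolyGrowth.coord i))))).integrable
      hA
  have hsum := integral_finsetSum Finset.univ hint
  rw [Finset.sum_eq_zero fun i _ => hone i] at hsum
  rw [← hsum]
  refine integral_congr_ae (Eventually.of_forall fun x => ?_)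
  beta_reduce
  generalize (x ⬝ᵥ A.mulVec x) / (x ⬝ᵥ x) = q
  generalize x ⬝ᵥ x = ρ
  generalize b + M.mulVec x = V
  simp only [Matrix.trace, Matrix.diag, dotProduct, Finset.sum_mul, Finset.mul_sum,
    ← Finset.sum_sub_distrib, ← Finset.sum_add_distrib]
  exact Finset.sum_congr rfl fun i _ => by ring

end

section
variable {ι : Type*} [Fintype ι]

/-- The centred function `|ι| (1 + c - ⟨x, A x⟩ / |x|²) + 2 - |x|²`. -/
def deviation (A : Matrix ι ι ℝ) (c : ℝ) (x : ι → ℝ) : ℝ :=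
  Fintype.card ι * (1 + c) + 2 - Fintype.card ι * ((x ⬝ᵥ A.mulVec x) / (x ⬝ᵥ x)) - x ⬝ᵥ x

theorem quadForm_div_mul {A : Matrix ι ι ℝ} (hA : ∀ x, |x ⬝ᵥ A.mulVec x| ≤ x ⬝ᵥ x) (x : ι → ℝ) :
    (x ⬝ᵥ A.mulVec x) / (x ⬝ᵥ x) * (x ⬝ᵥ x) = x ⬝ᵥ A.mulVec x := by
  refine div_mul_cancel_of_imp fun h => ?_
  have := hA x
  rw [h] at this
  exact abs_nonpos_iff.1 this

theorem polyGrowth_deviation {A : Matrix ι ι ℝ} (hA : ∀ x, |x ⬝ᵥ A.mulVec x| ≤ x ⬝ᵥ x) (c : ℝ) :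
    PolyGrowth (deviation A c) :=
  ((PolyGrowth.const _).sub ((PolyGrowth.const _).mul
    (PolyGrowth.div_dotProduct_self (PolyGrowth.quadForm A).1 (C := 1) (by simpa using hA)))).sub
    PolyGrowth.dotProduct_self

theorem hasLineDerivAt_quadForm_of_isSymm {M : Matrix ι ι ℝ} (hM : M.IsSymm) (x v : ι → ℝ) :
    HasLineDerivAt ℝ (fun x : ι → ℝ => x ⬝ᵥ M.mulVec x) (2 * (M.mulVec x ⬝ᵥ v)) x v := by
  have h := hasLineDerivAt_quadForm M x v
  rwa [dotProduct_mulVec_of_isSymm hM x v, dotProduct_comm v, ← two_mul] at h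

variable [DecidableEq ι]

/-- `R` is the resolvent `(1 + c - A)⁻¹` of the symmetric matrix `A` with `-1 ≤ A ≤ 1`. -/
structure IsResolvent (A R : Matrix ι ι ℝ) (c : ℝ) : Prop where
  pos : 0 < c
  le_one : c ≤ 1
  abs_le : ∀ x, |x ⬝ᵥ A.mulVec x| ≤ x ⬝ᵥ x
  symm : A.IsSymm
  symm' : R.IsSymm
  mul_eq : R * A = (1 + c) • R - 1

theorem HasLineDerivAt.mul' {E : Type*} [AddCommGroup E] [Module ℝ E] {f g : E → ℝ} {f' g' : ℝ}
    {x v : E} (hf : HasLineDerivAt ℝ f f' x v) (hg : HasLineDerivAt ℝ g g' x v) :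
    HasLineDerivAt ℝ (fun x => f x * g x) (f' * g x + f x * g') x v := by
  have h : HasDerivAt (fun t : ℝ => f (x + t • v) * g (x + t • v)) _ 0 := HasDerivAt.mul hf hg
  simpa [HasLineDerivAt] using h

theorem integral_gibbs_pow {A : Matrix ι ι ℝ} (hA : ∀ x, |x ⬝ᵥ A.mulVec x| ≤ x ⬝ᵥ x)
    (hsymm : A.IsSymm) (k : ℕ) :
    ∫ x, (x ⬝ᵥ x) ^ (k + 2) ∂gibbs A =
      (Fintype.card ι + 2 * k + 2) * ∫ x, (x ⬝ᵥ x) ^ (k + 1) ∂gibbs A := by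
  have hpow : ∀ k, PolyGrowth fun x : ι → ℝ => (x ⬝ᵥ x) ^ k := PolyGrowth.dotProduct_self.pow
  have key := integral_gibbs_affine hA hsymm (hpow k)
    (D := fun x => (2 * (k + 1) * (x ⬝ᵥ x) ^ k) • x)
    (fun i => ((PolyGrowth.const _).mul (hpow k)).mul (PolyGrowth.coord i)) (fun x v => ?_)
    (by simp) 0 1
  · rw [← integral_const_mul, ← sub_eq_zero, ← integral_sub ((hpow _).integrable hA)
      (((hpow _).integrable hA).const_mul _), ← neg_eq_zero, ← integral_neg, ← key]
    refine integral_congr_ae (Eventually.of_forall fun x => ?_)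
    have hq := quadForm_div_mul hA x
    simp only [Matrix.trace_one, Matrix.one_mulVec, zero_add, smul_dotProduct,
      smul_eq_mul, mul_assoc,
      hq]
    rw [dotProduct_comm (A.mulVec x) x]
    ring
  · have h : HasDerivAt (fun t : ℝ => ((x + t • v) ⬝ᵥ (x + t • v)) ^ (k + 1)) _ 0 :=
      HasDerivAt.pow (hasLineDerivAt_dotProduct_self x v) (k + 1)
    rw [HasLineDerivAt]
    refine (h.congr_of_eventuallyEq (Eventually.of_forall fun t => ?_)).congr_deriv ?_
    · simp only [pow_succ]; ring
    · simp; ring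

theorem IsResolvent.mulVec_dotProduct {A R : Matrix ι ι ℝ} {c : ℝ} (h : IsResolvent A R c)
    (x : ι → ℝ) : A.mulVec x ⬝ᵥ R.mulVec x = (1 + c) * (x ⬝ᵥ R.mulVec x) - x ⬝ᵥ x := by
  rw [dotProduct_comm, ← dotProduct_mulVec_of_isSymm h.symm', Matrix.mulVec_mulVec, h.mul_eq,
    Matrix.sub_mulVec, Matrix.smul_mulVec, Matrix.one_mulVec,
    dotProduct_sub, dotProduct_smul, smul_eq_mul]

theorem IsResolvent.quad_sq {A R : Matrix ι ι ℝ} {c : ℝ} (h : IsResolvent A R c) (x : ι → ℝ) :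
    x ⬝ᵥ (R * R).mulVec x = R.mulVec x ⬝ᵥ R.mulVec x := by
  rw [← Matrix.mulVec_mulVec, dotProduct_mulVec_of_isSymm h.symm']

theorem IsResolvent.mulVec_mulVec {A R : Matrix ι ι ℝ} {c : ℝ} (h : IsResolvent A R c)
    (x : ι → ℝ) : A.mulVec (R.mulVec x) = (1 + c) • R.mulVec x - x := by
  have e : A * R = (1 + c) • R - 1 := by
    have := congrArg Matrix.transpose h.mul_eq
    simpa [Matrix.transpose_mul, h.symm.eq, h.symm'.eq] using this
  rw [Matrix.mulVec_mulVec, e, Matrix.sub_mulVec, Matrix.smul_mulVec, Matrix.one_mulVec]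

theorem IsResolvent.sq_nonneg {A R : Matrix ι ι ℝ} {c : ℝ} (h : IsResolvent A R c) (x : ι → ℝ) :
    0 ≤ x ⬝ᵥ (R * R).mulVec x := by
  rw [h.quad_sq]
  exact dotProduct_self_nonneg' _

theorem IsResolvent.mul_sq_le {A R : Matrix ι ι ℝ} {c : ℝ} (h : IsResolvent A R c) (x : ι → ℝ) :
    c * (x ⬝ᵥ (R * R).mulVec x) ≤ x ⬝ᵥ R.mulVec x := by
  have h1 := (le_abs_self _).trans (h.abs_le (R.mulVec x))
  rw [h.mulVec_mulVec, dotProduct_sub, dotProduct_smul, smul_eq_mul, dotProduct_comm _ x] at h1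
  rw [h.quad_sq]
  linarith

theorem IsResolvent.mul_quad_le {A R : Matrix ι ι ℝ} {c : ℝ} (h : IsResolvent A R c) (x : ι → ℝ) :
    c * (x ⬝ᵥ R.mulVec x) ≤ x ⬝ᵥ x := by
  have h1 := dotProduct_self_nonneg' (x - c • R.mulVec x)
  have h2 := mul_le_mul_of_nonneg_left (h.mul_sq_le x) h.pos.le
  rw [h.quad_sq] at h2
  simp only [sub_dotProduct, dotProduct_sub, smul_dotProduct, dotProduct_smul, smul_eq_mul,
    dotProduct_comm (R.mulVec x) x] at h1
  linarith

theorem IsResolvent.le_quad {A R : Matrix ι ι ℝ} {c : ℝ} (h : IsResolvent A R c) (x : ι → ℝ) :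
    x ⬝ᵥ x ≤ 3 * (x ⬝ᵥ R.mulVec x) := by
  have h1 := (le_abs_self _).trans (h.abs_le (R.mulVec x - (1 / 3 : ℝ) • x))
  have h2 := (neg_abs_le _).trans' (neg_le_neg (h.abs_le x))
  have h3 := dotProduct_self_nonneg' (R.mulVec x - (1 / 3 : ℝ) • x)
  have h4 : x ⬝ᵥ A.mulVec (R.mulVec x) = R.mulVec x ⬝ᵥ A.mulVec x := by
    rw [dotProduct_mulVec_of_isSymm h.symm, dotProduct_comm]
  have h5 : x ⬝ᵥ A.mulVec (R.mulVec x) = (1 + c) * (x ⬝ᵥ R.mulVec x) - x ⬝ᵥ x := by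
    rw [h.mulVec_mulVec, dotProduct_sub, dotProduct_smul, smul_eq_mul]
  have h6 : R.mulVec x ⬝ᵥ A.mulVec (R.mulVec x) =
      (1 + c) * (R.mulVec x ⬝ᵥ R.mulVec x) - x ⬝ᵥ R.mulVec x := by
    rw [h.mulVec_mulVec, dotProduct_sub, dotProduct_smul, smul_eq_mul, dotProduct_comm _ x]
  simp only [Matrix.mulVec_sub, Matrix.mulVec_smul, sub_dotProduct, dotProduct_sub, smul_dotProduct,
    dotProduct_smul, smul_eq_mul, dotProduct_comm (R.mulVec x) x] at h1 h3
  rw [← h4, h5, h6] at h1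
  have h7 := mul_nonneg h.pos.le h3
  have h8 := mul_le_mul_of_nonneg_right h.le_one (dotProduct_self_nonneg' x)
  linarith

theorem IsResolvent.mulVec_dotProduct_sq {A R : Matrix ι ι ℝ} {c : ℝ} (h : IsResolvent A R c)
    (x : ι → ℝ) : A.mulVec x ⬝ᵥ (R * R).mulVec x =
      (1 + c) * (x ⬝ᵥ (R * R).mulVec x) - x ⬝ᵥ R.mulVec x := by
  have hRR : (R * R).IsSymm := by rw [Matrix.IsSymm, Matrix.transpose_mul, h.symm'.eq]
  rw [dotProduct_comm, ← dotProduct_mulVec_of_isSymm hRR, Matrix.mulVec_mulVec, mul_assoc,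
    h.mul_eq, mul_sub, mul_smul_comm, mul_one,
    Matrix.sub_mulVec, Matrix.smul_mulVec, dotProduct_sub, dotProduct_smul, smul_eq_mul]

namespace IsResolvent
variable {A R : Matrix ι ι ℝ} {c : ℝ}

theorem integral_quad_mul_deviation (h : IsResolvent A R c) :
    ∫ x, (x ⬝ᵥ R.mulVec x) * deviation A c x ∂gibbs A =
      -(R.trace - Fintype.card ι) * ∫ x, x ⬝ᵥ x ∂gibbs A := by
  have hK := polyGrowth_deviation h.abs_le c
  have hQ := PolyGrowth.quadForm R
  have hρ := PolyGrowth.dotProduct_self (ι := ι)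
  have key := integral_gibbs_affine h.abs_le h.symm (PolyGrowth.const 1)
    (D := fun x => (2 : ℝ) • x) (fun i => (PolyGrowth.const _).mul (PolyGrowth.coord i))
    (fun x v => by simpa using hasLineDerivAt_dotProduct_self x v) (by simp) 0 R
  rw [← integral_const_mul, ← sub_eq_zero, ← integral_sub ((hQ.mul hK).integrable h.abs_le)
    ((hρ.integrable h.abs_le).const_mul _), ← key]
  refine integral_congr_ae (Eventually.of_forall fun x => ?_)
  have e1 := h.mulVec_dotProduct x
  simp only [zero_add, smul_dotProduct, smul_eq_mul, e1, deviation]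
  ring

theorem integral_dotProduct_mul_quad (h : IsResolvent A R c) :
    ∫ x, (x ⬝ᵥ x) * (x ⬝ᵥ R.mulVec x) ∂gibbs A =
      (Fintype.card ι + 2) * ∫ x, x ⬝ᵥ R.mulVec x ∂gibbs A := by
  have hQ := PolyGrowth.quadForm R
  have hρ := PolyGrowth.dotProduct_self (ι := ι)
  have hC : ∀ x, |x ⬝ᵥ R.mulVec x| ≤ 1 / c * (x ⬝ᵥ x) := fun x => by
    have h1 := h.le_quad x
    have h2 := dotProduct_self_nonneg' x
    rw [abs_of_nonneg (by linarith), one_div_mul_eq_div, le_div_iff₀ h.pos, mul_comm]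
    exact h.mul_quad_le x
  have e : ∀ x, (x ⬝ᵥ x) * ((x ⬝ᵥ R.mulVec x) / (x ⬝ᵥ x)) = x ⬝ᵥ R.mulVec x := fun x => by
    refine mul_div_cancel_of_imp' fun h0 => ?_
    have := hC x
    rw [h0, mul_zero] at this
    exact abs_nonpos_iff.1 this
  have key := integral_gibbs_affine h.abs_le h.symm (PolyGrowth.div_dotProduct_self hQ.1 hC)
    (D := fun x => (2 : ℝ) • R.mulVec x)
    (fun i => (PolyGrowth.const _).mul (PolyGrowth.mulVec_apply R i))
    (fun x v => by
      simpa only [e, smul_dotProduct, smul_eq_mul] using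
        hasLineDerivAt_quadForm_of_isSymm h.symm' x v) (by simp) 0 1
  rw [← integral_const_mul, ← sub_eq_zero, ← integral_sub ((hρ.mul hQ).integrable h.abs_le)
    ((hQ.integrable h.abs_le).const_mul _), ← neg_eq_zero, ← integral_neg, ← key]
  refine integral_congr_ae (Eventually.of_forall fun x => ?_)
  have hq := quadForm_div_mul h.abs_le x
  have hx := e x
  simp only [Matrix.trace_one, Matrix.one_mulVec, zero_add, smul_dotProduct, smul_eq_mul]
  rw [dotProduct_comm (A.mulVec x) x, dotProduct_comm (R.mulVec x) x, hx]
  linear_combination (x ⬝ᵥ x) * hx + (x ⬝ᵥ R.mulVec x) / (x ⬝ᵥ x) * Fintype.card ι * hq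

theorem integral_quad_mul_deviation_sq (h : IsResolvent A R c) :
    ∫ x, (x ⬝ᵥ R.mulVec x) * deviation A c x ^ 2 ∂gibbs A =
      -(R.trace - Fintype.card ι) * ∫ x, (x ⬝ᵥ x) * deviation A c x ∂gibbs A
      + 2 * ∫ x, (x ⬝ᵥ R.mulVec x) * deviation A c x ∂gibbs A
      - 4 * ∫ x, x ⬝ᵥ R.mulVec x ∂gibbs A
      - 2 * Fintype.card ι * ∫ x, x ⬝ᵥ x ∂gibbs A
      + 4 * ∫ x, (x ⬝ᵥ x) * (x ⬝ᵥ R.mulVec x) ∂gibbs A := by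
  have hK := polyGrowth_deviation h.abs_le c
  have hQ := PolyGrowth.quadForm R
  have hρ := PolyGrowth.dotProduct_self (ι := ι)
  have hA' := h.abs_le
  set s : ℝ := Fintype.card ι * (1 + c) + 2 with hs
  have e : ∀ x : ι → ℝ, (x ⬝ᵥ x) * deviation A c x =
      s * (x ⬝ᵥ x) - Fintype.card ι * (x ⬝ᵥ A.mulVec x) - (x ⬝ᵥ x) * (x ⬝ᵥ x) := fun x => by
    rw [deviation]
    linear_combination -(Fintype.card ι : ℝ) * quadForm_div_mul h.abs_le x
  have key := integral_gibbs_affine h.abs_le h.symm hK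
    (D := fun x => (2 * s) • x - (2 * Fintype.card ι : ℝ) • A.mulVec x - (4 * (x ⬝ᵥ x)) • x)
    (fun i => (((PolyGrowth.const _).mul (PolyGrowth.coord i)).sub
      ((PolyGrowth.const _).mul (PolyGrowth.mulVec_apply A i))).sub
      (((PolyGrowth.const _).mul hρ).mul (PolyGrowth.coord i)))
    (fun x v => by
      simp only [e]
      have h1 := hasLineDerivAt_dotProduct_self x v
      have h2 := hasLineDerivAt_quadForm_of_isSymm h.symm x v
      have h3 : HasDerivAt (fun t : ℝ => s * ((x + t • v) ⬝ᵥ (x + t • v)) -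
          Fintype.card ι * ((x + t • v) ⬝ᵥ A.mulVec (x + t • v)) -
          ((x + t • v) ⬝ᵥ (x + t • v)) * ((x + t • v) ⬝ᵥ (x + t • v))) _ 0 :=
        ((HasDerivAt.const_mul s h1).sub (HasDerivAt.const_mul (Fintype.card ι : ℝ) h2)).sub
          (h1.mul' h1)
      refine HasDerivAt.congr_deriv h3 ?_
      simp only [sub_dotProduct, smul_dotProduct, smul_eq_mul]
      ring) (by simp) 0 R
  rw [← integral_const_mul, ← integral_const_mul, ← integral_const_mul, ← integral_const_mul,
    ← integral_const_mul, ← integral_add, ← integral_sub, ← integral_sub, ← integral_add,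
    ← sub_eq_zero, ← integral_sub, ← key]
  · refine integral_congr_ae (Eventually.of_forall fun x => ?_)
    have e1 := h.mulVec_dotProduct x
    simp only [zero_add, sub_dotProduct, smul_dotProduct, smul_eq_mul, e1]
    rw [deviation]
    ring
  all_goals
    refine PolyGrowth.integrable hA' ?_
    repeat' first
      | exact hK | exact hQ | exact hρ | exact PolyGrowth.const _ | apply PolyGrowth.neg
      | apply PolyGrowth.add
      | apply PolyGrowth.sub | apply PolyGrowth.mul

theorem integral_quad (h : IsResolvent A R c) :
    Fintype.card ι * ∫ x, x ⬝ᵥ R.mulVec x ∂gibbs A =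
      (R * R).trace * ∫ x, x ⬝ᵥ x ∂gibbs A +
        ∫ x, (x ⬝ᵥ (R * R).mulVec x) * deviation A c x ∂gibbs A := by
  have hK := polyGrowth_deviation h.abs_le c
  have hQ := PolyGrowth.quadForm R
  have hQ' := PolyGrowth.quadForm (R * R)
  have hρ := PolyGrowth.dotProduct_self (ι := ι)
  have key := integral_gibbs_affine h.abs_le h.symm (PolyGrowth.const 1)
    (D := fun x => (2 : ℝ) • x) (fun i => (PolyGrowth.const _).mul (PolyGrowth.coord i))
    (fun x v => by simpa using hasLineDerivAt_dotProduct_self x v) (by simp) 0 (R * R)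
  rw [← integral_const_mul, ← integral_const_mul, ← integral_add, eq_comm,
    ← sub_eq_zero, ← integral_sub, ← key]
  · refine integral_congr_ae (Eventually.of_forall fun x => ?_)
    have e1 := h.mulVec_dotProduct_sq x
    simp only [zero_add, smul_dotProduct, smul_eq_mul, e1, deviation]
    ring
  · exact ((hρ.integrable h.abs_le).const_mul _).add ((hQ'.mul hK).integrable h.abs_le)
  · exact (hQ.integrable h.abs_le).const_mul _
  · exact (hρ.integrable h.abs_le).const_mul _
  · exact (hQ'.mul hK).integrable h.abs_le

end IsResolvent
end

theorem integral_mul_abs_le {Ω : Type*} [MeasurableSpace Ω] {m : Measure Ω} {h X : Ω → ℝ}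
    (h0 : ∀ x, 0 ≤ h x) (hi : Integrable h m) (hi1 : Integrable (fun x => h x * |X x|) m)
    (hi2 : Integrable (fun x => h x * X x ^ 2) m) {e B : ℝ} (he : 0 < e) (hB : ∫ x, h x ∂m ≤ B)
    (hX : ∫ x, h x * X x ^ 2 ∂m ≤ e ^ 2 * B) : ∫ x, h x * |X x| ∂m ≤ e * B := by
  have hle : ∫ x, h x * |X x| ∂m ≤ ∫ x, (e / 2 * h x + 1 / (2 * e) * (h x * X x ^ 2)) ∂m := by
    refine integral_mono hi1 ((hi.const_mul _).add (hi2.const_mul _)) fun x => ?_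
    have h1 : |X x| ≤ e / 2 + 1 / (2 * e) * X x ^ 2 := by
      have h2 : e / 2 + 1 / (2 * e) * X x ^ 2 - |X x| = (e - |X x|) ^ 2 / (2 * e) := by
        rw [← sq_abs (X x)]; field_simp; ring
      have h3 : 0 ≤ (e - |X x|) ^ 2 / (2 * e) := by positivity
      linarith
    have := mul_le_mul_of_nonneg_left h1 (h0 x)
    simp only
    linarith
  rw [integral_add (hi.const_mul _) (hi2.const_mul _), integral_const_mul, integral_const_mul]
    at hle
  have h1 := mul_le_mul_of_nonneg_left hB (show 0 ≤ e / 2 by positivity)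
  have h2 := mul_le_mul_of_nonneg_left hX (show 0 ≤ 1 / (2 * e) by positivity)
  have h3 : 1 / (2 * e) * (e ^ 2 * B) = e / 2 * B := by field_simp
  linarith

section
variable {ι : Type*} [Fintype ι]

theorem integral_dotProduct_self_nonneg (A : Matrix ι ι ℝ) : 0 ≤ ∫ x, x ⬝ᵥ x ∂gibbs A :=
  integral_nonneg dotProduct_self_nonneg'

theorem integral_one_gibbs_pos {A : Matrix ι ι ℝ} (hA : ∀ x, |x ⬝ᵥ A.mulVec x| ≤ x ⬝ᵥ x) :
    0 < ∫ _, (1 : ℝ) ∂gibbs A := by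
  rw [integral_gibbs, integral_pos_iff_support_of_nonneg]
  · have : (Function.support fun x => 1 * gibbsWeight A x) = Set.univ := by
      ext x; simpa using (gibbsWeight_pos A x).ne'
    rw [this]
    exact NeZero.pos _
  · exact fun x => by simpa using (gibbsWeight_pos A x).le
  · exact (PolyGrowth.const 1).integrable_mul_gibbsWeight hA

variable [DecidableEq ι]

theorem integral_gibbs_sq {A : Matrix ι ι ℝ} (hA : ∀ x, |x ⬝ᵥ A.mulVec x| ≤ x ⬝ᵥ x)
    (hsymm : A.IsSymm) :
    ∫ x, (x ⬝ᵥ x) ^ 2 ∂gibbs A = (Fintype.card ι + 2) * ∫ x, x ⬝ᵥ x ∂gibbs A := by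
  simpa using integral_gibbs_pow hA hsymm 0

theorem integral_gibbs_cube {A : Matrix ι ι ℝ} (hA : ∀ x, |x ⬝ᵥ A.mulVec x| ≤ x ⬝ᵥ x)
    (hsymm : A.IsSymm) :
    ∫ x, (x ⬝ᵥ x) ^ 3 ∂gibbs A =
      (Fintype.card ι + 4) * ((Fintype.card ι + 2) * ∫ x, x ⬝ᵥ x ∂gibbs A) := by
  have h := integral_gibbs_pow hA hsymm 1
  rw [← integral_gibbs_sq hA hsymm]
  norm_num at h ⊢
  rw [h]
  ring

theorem integral_dotProduct_self_le_mul {A : Matrix ι ι ℝ}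
    (hA : ∀ x, |x ⬝ᵥ A.mulVec x| ≤ x ⬝ᵥ x) (hsymm : A.IsSymm) :
    ∫ x, x ⬝ᵥ x ∂gibbs A ≤ (Fintype.card ι + 2) * ∫ _, (1 : ℝ) ∂gibbs A := by
  have hρ := PolyGrowth.dotProduct_self (ι := ι)
  set N : ℝ := (Fintype.card ι : ℝ) with hN
  have hN0 : 0 ≤ N := by positivity
  have h : ∫ x : ι → ℝ, (2 / (N + 2) * (x ⬝ᵥ x) - 1 / (N + 2) ^ 2 * (x ⬝ᵥ x) ^ 2) ∂gibbs A ≤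
      ∫ _, (1 : ℝ) ∂gibbs A := by
    refine integral_mono (((PolyGrowth.const _).mul hρ).sub ((PolyGrowth.const _).mul
      (hρ.pow 2)) |>.integrable hA) ((PolyGrowth.const 1).integrable hA) fun x => ?_
    have : 1 - (2 / (N + 2) * (x ⬝ᵥ x) - 1 / (N + 2) ^ 2 * (x ⬝ᵥ x) ^ 2) =
        (1 - (x ⬝ᵥ x) / (N + 2)) ^ 2 := by field_simp; ring
    have := sq_nonneg (1 - (x ⬝ᵥ x) / (N + 2))
    simp only
    linarith
  rw [integral_sub ((hρ.integrable hA).const_mul _) (((hρ.pow 2).integrable hA).const_mul _),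
    integral_const_mul, integral_const_mul, integral_gibbs_sq hA hsymm] at h
  have e : 2 / (N + 2) * ∫ x, x ⬝ᵥ x ∂gibbs A - 1 / (N + 2) ^ 2 *
      ((N + 2) * ∫ x, x ⬝ᵥ x ∂gibbs A) = (∫ x, x ⬝ᵥ x ∂gibbs A) / (N + 2) := by
    field_simp; ring
  rw [e, div_le_iff₀ (by positivity)] at h
  linarith

theorem mul_integral_one_le [Nonempty ι] {A : Matrix ι ι ℝ}
    (hA : ∀ x, |x ⬝ᵥ A.mulVec x| ≤ x ⬝ᵥ x) (hsymm : A.IsSymm) :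
    Fintype.card ι * ∫ _, (1 : ℝ) ∂gibbs A ≤ ∫ x, x ⬝ᵥ x ∂gibbs A := by
  have hρ := PolyGrowth.dotProduct_self (ι := ι)
  set N : ℝ := (Fintype.card ι : ℝ) with hN
  have hmeas : ∀ ε : ℝ, Measurable fun x : ι → ℝ => 1 / (ε + x ⬝ᵥ x) := fun ε =>
    measurable_const.div (measurable_const.add hρ.1)
  have hstep : ∀ ε : ℝ, 0 < ε →
      N * ∫ x, (x ⬝ᵥ x) * (1 / (ε + x ⬝ᵥ x)) ∂gibbs A ≤ ∫ x, x ⬝ᵥ x ∂gibbs A := by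
    intro ε hε
    have hpos : ∀ x : ι → ℝ, 0 < ε + x ⬝ᵥ x := fun x => by linarith [dotProduct_self_nonneg' x]
    have hg : PolyGrowth fun x : ι → ℝ => 1 / (ε + x ⬝ᵥ x) := by
      refine PolyGrowth.of_bounded (hmeas ε) (C := 1 / ε) fun x => ?_
      rw [abs_of_pos (one_div_pos.2 (hpos x))]
      exact one_div_le_one_div_of_le hε (by linarith [dotProduct_self_nonneg' x])
    have key := integral_gibbs_affine hA hsymm hg
      (D := fun x => (2 * ε * (1 / (ε + x ⬝ᵥ x)) ^ 2) • x)
      (fun i => ((PolyGrowth.const _).mul (hg.pow 2)).mul (PolyGrowth.coord i)) (fun x v => ?_)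
      (by simp) 0 1
    · have key' : ∫ x, (N * ((x ⬝ᵥ x) * (1 / (ε + x ⬝ᵥ x))) +
          2 * ε * (1 / (ε + x ⬝ᵥ x)) ^ 2 * (x ⬝ᵥ x) -
          (x ⬝ᵥ x) * (x ⬝ᵥ x) * (1 / (ε + x ⬝ᵥ x))) ∂gibbs A = 0 := by
        rw [← key]
        refine integral_congr_ae (Eventually.of_forall fun x => ?_)
        have hq := quadForm_div_mul hA x
        simp only [Matrix.trace_one, Matrix.one_mulVec, zero_add, smul_dotProduct, smul_eq_mul]
        rw [dotProduct_comm (A.mulVec x) x]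
        linear_combination (1 / (ε + x ⬝ᵥ x)) * N * hq
      rw [← integral_const_mul, ← sub_zero (∫ _, _ * _ ∂_), ← key', ← integral_sub]
      · refine integral_mono (((PolyGrowth.const _).mul (hρ.mul hg)).sub
          ((((PolyGrowth.const _).mul (hρ.mul hg)).add (((PolyGrowth.const _).mul (hg.pow 2)).mul
          hρ)).sub ((hρ.mul hρ).mul hg)) |>.integrable hA) (hρ.integrable hA) fun x => ?_
        have h1 := dotProduct_self_nonneg' x
        have h2 : (x ⬝ᵥ x) * (x ⬝ᵥ x) * (1 / (ε + x ⬝ᵥ x)) =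
            x ⬝ᵥ x - (x ⬝ᵥ x) * (ε / (ε + x ⬝ᵥ x)) := by
          have := (hpos x).ne'
          field_simp
          ring
        have h3 : 0 ≤ (x ⬝ᵥ x) * (ε / (ε + x ⬝ᵥ x)) := by
          have := hpos x
          positivity
        have h4 : 0 ≤ 2 * ε * (1 / (ε + x ⬝ᵥ x)) ^ 2 * (x ⬝ᵥ x) := by positivity
        simp only
        linarith
      · exact ((PolyGrowth.const _).mul (hρ.mul hg)).integrable hA
      · exact ((((PolyGrowth.const _).mul (hρ.mul hg)).add (((PolyGrowth.const _).mul
          (hg.pow 2)).mul hρ)).sub ((hρ.mul hρ).mul hg)).integrable hA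
    · have h1 : HasDerivAt (fun t : ℝ => (x + t • v) ⬝ᵥ (x + t • v)) _ 0 :=
        hasLineDerivAt_dotProduct_self x v
      have h2 := h1.mul ((hasDerivAt_const (0 : ℝ) (1 : ℝ)).div (h1.const_add ε)
        (by simpa using (hpos x).ne'))
      refine HasDerivAt.congr_deriv h2 ?_
      simp only [zero_smul, add_zero, smul_dotProduct, smul_eq_mul, Pi.div_apply]
      have := (hpos x).ne'
      field_simp
      ring
  have hlim : Tendsto (fun k : ℕ => N * ∫ x, (x ⬝ᵥ x) * (1 / (1 / ((k : ℝ) + 1) + x ⬝ᵥ x)) ∂gibbs A)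
      atTop (𝓝 (N * ∫ _, (1 : ℝ) ∂gibbs A)) := by
    refine Tendsto.const_mul _ (tendsto_integral_of_dominated_convergence (fun _ => 1)
      (fun k => (hρ.1.mul (hmeas _)).aestronglyMeasurable) ((PolyGrowth.const 1).integrable hA)
      (fun k => Eventually.of_forall fun x => ?_) ?_)
    · have h1 := dotProduct_self_nonneg' x
      have h2 : (0 : ℝ) < 1 / ((k : ℝ) + 1) := by positivity
      rw [norm_eq_abs, abs_of_nonneg (by positivity), mul_one_div]
      exact div_le_one_of_le₀ (by linarith) (by positivity)
    · have hne : ∀ᵐ x ∂gibbs A, x ≠ 0 :=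
        (withDensity_absolutelyContinuous _ _).ae_le (Measure.ae_ne _ _)
      filter_upwards [hne] with x hx
      have hx0 : x ⬝ᵥ x ≠ 0 := by rwa [Ne, dotProduct_self_eq_zero]
      have := ((tendsto_one_div_add_atTop_nhds_zero_nat (𝕜 := ℝ)).add_const (x ⬝ᵥ x))
      rw [zero_add] at this
      have := (tendsto_const_nhds (x := (1 : ℝ))).div this hx0
      have := this.const_mul (x ⬝ᵥ x)
      rwa [mul_one_div_cancel hx0] at this
  exact le_of_tendsto' hlim fun k => hstep _ (by positivity)

end

namespace IsResolvent
variable {ι : Type*} [Fintype ι] [DecidableEq ι] {A R : Matrix ι ι ℝ} {c : ℝ}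

theorem quad_nonneg (h : IsResolvent A R c) (x : ι → ℝ) : 0 ≤ x ⬝ᵥ R.mulVec x := by
  linarith [h.le_quad x, dotProduct_self_nonneg' x]

theorem integral_quad_le (h : IsResolvent A R c) (hc : 32 ≤ Fintype.card ι * c ^ 2) :
    Fintype.card ι * ∫ x, x ⬝ᵥ R.mulVec x ∂gibbs A ≤
      2 * (R * R).trace * ∫ x, x ⬝ᵥ x ∂gibbs A +
        1 / 32 * ∫ x, (x ⬝ᵥ R.mulVec x) * deviation A c x ^ 2 ∂gibbs A := by
  have hK := polyGrowth_deviation h.abs_le c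
  have hQ := PolyGrowth.quadForm R
  have hQ' := PolyGrowth.quadForm (R * R)
  set N : ℝ := (Fintype.card ι : ℝ) with hN
  have hc0 := h.pos
  have hN0 : 0 < N := by
    by_contra hn
    have := mul_nonneg (neg_nonneg.2 (not_lt.1 hn)) (_root_.sq_nonneg c)
    linarith
  have hle : ∫ x, (x ⬝ᵥ (R * R).mulVec x) * deviation A c x ∂gibbs A ≤
      ∫ x, (N / 2 * (x ⬝ᵥ R.mulVec x) +
        1 / 64 * ((x ⬝ᵥ R.mulVec x) * deviation A c x ^ 2)) ∂gibbs A := by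
    refine integral_mono ((hQ'.mul hK).integrable h.abs_le) (((PolyGrowth.const _).mul hQ).add
      ((PolyGrowth.const _).mul (hQ.mul (hK.pow 2))) |>.integrable h.abs_le) fun x => ?_
    have h1 := h.mul_sq_le x
    have h2 := h.sq_nonneg x
    have h3 := h.quad_nonneg x
    simp only
    set Q := x ⬝ᵥ R.mulVec x
    set Q2 := x ⬝ᵥ (R * R).mulVec x
    set X := deviation A c x
    have e1 : X ≤ N * c / 2 + 1 / (2 * N * c) * X ^ 2 := by
      have : N * c / 2 + 1 / (2 * N * c) * X ^ 2 - X = (N * c - X) ^ 2 / (2 * N * c) := by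
        field_simp; ring
      have : 0 ≤ (N * c - X) ^ 2 / (2 * N * c) := by positivity
      linarith
    have e2 := mul_le_mul_of_nonneg_left e1 h2
    have e3 : 1 / (2 * N * c) * X ^ 2 * Q2 ≤ 1 / 64 * (Q * X ^ 2) := by
      have e4 : 1 / (2 * N * c) * X ^ 2 * Q2 = 1 / (2 * (N * c ^ 2)) * X ^ 2 * (c * Q2) := by
        field_simp
      have e5 : 1 / (2 * (N * c ^ 2)) ≤ 1 / 64 :=
        one_div_le_one_div_of_le (by norm_num) (by linarith)
      rw [e4]
      calc _ ≤ 1 / 64 * X ^ 2 * Q := by gcongr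
        _ = _ := by ring
    have e6 := mul_le_mul_of_nonneg_left h1 (show 0 ≤ N / 2 by positivity)
    linarith
  rw [integral_add ((hQ.integrable h.abs_le).const_mul _)
    (((hQ.mul (hK.pow 2)).integrable h.abs_le).const_mul _), integral_const_mul,
    integral_const_mul] at hle
  have := h.integral_quad
  linarith

theorem integral_quad_mul_deviation_sq_le [Nonempty ι] (h : IsResolvent A R c)
    (hc : 32 ≤ Fintype.card ι * c ^ 2) :
    ∫ x, (x ⬝ᵥ R.mulVec x) * deviation A c x ^ 2 ∂gibbs A ≤
      (6 * (R.trace - Fintype.card ι) ^ 2 + 4 * |R.trace - Fintype.card ι| +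
        32 * (R * R).trace) * ∫ x, x ⬝ᵥ x ∂gibbs A := by
  have hK := polyGrowth_deviation h.abs_le c
  have hQ := PolyGrowth.quadForm R
  have hρ := PolyGrowth.dotProduct_self (ι := ι)
  have hN1 : (1 : ℝ) ≤ Fintype.card ι := by exact_mod_cast Fintype.card_pos (α := ι)
  have h1 := h.integral_quad_mul_deviation_sq
  have h2 := h.integral_quad_mul_deviation
  have h3 := h.integral_dotProduct_mul_quad
  have h4 := h.integral_quad_le hc
  set N : ℝ := (Fintype.card ι : ℝ) with hN
  set τ := R.trace - N
  have hZ := integral_dotProduct_self_nonneg A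
  have hQi : 0 ≤ ∫ x, x ⬝ᵥ R.mulVec x ∂gibbs A := integral_nonneg h.quad_nonneg
  have hle : -τ * ∫ x, (x ⬝ᵥ x) * deviation A c x ∂gibbs A ≤
      3 * τ ^ 2 * ∫ x, x ⬝ᵥ x ∂gibbs A +
        1 / 4 * ∫ x, (x ⬝ᵥ R.mulVec x) * deviation A c x ^ 2 ∂gibbs A := by
    rw [← integral_const_mul, ← integral_const_mul, ← integral_const_mul, ← integral_add]
    · refine integral_mono ((PolyGrowth.const _).mul (hρ.mul hK) |>.integrable h.abs_le)
        (((PolyGrowth.const _).mul hρ).add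
        ((PolyGrowth.const _).mul (hQ.mul (hK.pow 2))) |>.integrable h.abs_le) fun x => ?_
      have e1 := mul_le_mul_of_nonneg_right (h.le_quad x) (_root_.sq_nonneg (deviation A c x))
      have e2 := mul_nonneg (dotProduct_self_nonneg' x)
        (_root_.sq_nonneg (6 * τ + deviation A c x))
      simp only
      linarith
    · exact (hρ.integrable h.abs_le).const_mul _
    · exact ((hQ.mul (hK.pow 2)).integrable h.abs_le).const_mul _
  have h5 : -τ * ∫ x, x ⬝ᵥ x ∂gibbs A ≤ |τ| * ∫ x, x ⬝ᵥ x ∂gibbs A :=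
    mul_le_mul_of_nonneg_right (neg_le_abs τ) hZ
  have h6 : 4 * (N + 1) * ∫ x, x ⬝ᵥ R.mulVec x ∂gibbs A ≤
      8 * N * ∫ x, x ⬝ᵥ R.mulVec x ∂gibbs A := mul_le_mul_of_nonneg_right (by linarith) hQi
  have h7 : 0 ≤ N * ∫ x, x ⬝ᵥ x ∂gibbs A := by positivity
  rw [h2, h3] at h1
  linarith

theorem integral_dotProduct_mul_deviation_sq_le [Nonempty ι] (h : IsResolvent A R c)
    (hc : 32 ≤ Fintype.card ι * c ^ 2) :
    ∫ x, (x ⬝ᵥ x) * deviation A c x ^ 2 ∂gibbs A ≤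
      3 * (6 * (R.trace - Fintype.card ι) ^ 2 + 4 * |R.trace - Fintype.card ι| +
        32 * (R * R).trace) * ∫ x, x ⬝ᵥ x ∂gibbs A := by
  have hK := polyGrowth_deviation h.abs_le c
  have hle : ∫ x, (x ⬝ᵥ x) * deviation A c x ^ 2 ∂gibbs A ≤
      ∫ x, 3 * ((x ⬝ᵥ R.mulVec x) * deviation A c x ^ 2) ∂gibbs A := by
    refine integral_mono ((PolyGrowth.dotProduct_self.mul (hK.pow 2)).integrable h.abs_le)
      (((PolyGrowth.const _).mul ((PolyGrowth.quadForm R).mul (hK.pow 2))).integrable h.abs_le)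
      fun x => ?_
    have := mul_le_mul_of_nonneg_right (h.le_quad x) (_root_.sq_nonneg (deviation A c x))
    simp only
    linarith
  rw [integral_const_mul] at hle
  have := h.integral_quad_mul_deviation_sq_le hc
  linarith

theorem integral_stein (h : IsResolvent A R c) [Nonempty ι] (hone : A.mulVec 1 = 1) {κ : ℝ}
    (hκ : κ ^ 2 * Fintype.card ι = c) {f f' : ℝ → ℝ} {K : ℝ} (hf : ∀ x, HasDerivAt f (f' x) x)
    (hf' : Continuous f') (hK : ∀ x, |f x| ≤ K) (hK' : ∀ x, |f' x| ≤ K) :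
    ∫ x, (x ⬝ᵥ x) * (f' (κ * (x ⬝ᵥ 1)) - κ * (x ⬝ᵥ 1) * f (κ * (x ⬝ᵥ 1))) ∂gibbs A =
      ∫ x, ((x ⬝ᵥ x) * (1 - (x ⬝ᵥ x) / Fintype.card ι) * f' (κ * (x ⬝ᵥ 1)) -
        (x ⬝ᵥ x) * (κ * (x ⬝ᵥ 1) * f (κ * (x ⬝ᵥ 1))) *
          ((deviation A c x + 2) / (Fintype.card ι * c))) ∂gibbs A := by
  have hD := polyGrowth_deviation h.abs_le c
  have hρ := PolyGrowth.dotProduct_self (ι := ι)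
  have hS : PolyGrowth fun x : ι → ℝ => x ⬝ᵥ 1 :=
    PolyGrowth.dotProduct PolyGrowth.coord fun _ => PolyGrowth.const _
  have hW : PolyGrowth fun x : ι → ℝ => κ * (x ⬝ᵥ 1) := (PolyGrowth.const _).mul hS
  have hfc : Continuous f := continuous_iff_continuousAt.2 fun x => (hf x).continuousAt
  have hfW : PolyGrowth fun x : ι → ℝ => f (κ * (x ⬝ᵥ 1)) :=
    PolyGrowth.of_bounded (hfc.measurable.comp hW.1) fun x => hK _
  have hfW' : PolyGrowth fun x : ι → ℝ => f' (κ * (x ⬝ᵥ 1)) :=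
    PolyGrowth.of_bounded (hf'.measurable.comp hW.1) fun x => hK' _
  have hN0 : (Fintype.card ι : ℝ) ≠ 0 := by exact_mod_cast Fintype.card_ne_zero (α := ι)
  have hc0 := h.pos.ne'
  have hA' := h.abs_le
  have key := integral_gibbs_affine h.abs_le h.symm (hρ.mul hfW)
    (D := fun x => (4 * (x ⬝ᵥ x) * f (κ * (x ⬝ᵥ 1))) • x +
      ((x ⬝ᵥ x) ^ 2 * f' (κ * (x ⬝ᵥ 1)) * κ) • (1 : ι → ℝ))
    (fun i => (((PolyGrowth.const _).mul hρ).mul hfW |>.mul (PolyGrowth.coord i)).add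
      ((((hρ.pow 2).mul hfW').mul (PolyGrowth.const _)).mul (PolyGrowth.const _)))
    (fun x v => ?_) (by simp) 1 0
  · rw [← sub_eq_zero, ← integral_sub, ← mul_zero (κ / (Fintype.card ι * c)), ← key,
      ← integral_const_mul]
    · refine integral_congr_ae (Eventually.of_forall fun x => ?_)
      simp only [Matrix.trace_zero, Matrix.zero_mulVec, add_zero, add_dotProduct, smul_dotProduct,
        smul_eq_mul, ← dotProduct_mulVec_of_isSymm h.symm, hone, zero_mul, zero_add]
      rw [one_dotProduct_one, deviation]
      rw [← hκ] at hc0 ⊢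
      have hκ0 : κ ≠ 0 := fun h0 => hc0 (by simp [h0])
      field_simp
      ring
    all_goals
      refine PolyGrowth.integrable hA' ?_
      try simp only [div_eq_mul_inv]
      repeat' first
        | exact hD | exact hρ | exact hfW | exact hfW' | exact hW | exact PolyGrowth.const _
        | apply PolyGrowth.neg | apply PolyGrowth.add | apply PolyGrowth.sub | apply PolyGrowth.mul
  · have h1 := hasLineDerivAt_dotProduct_self x v
    have h2 : HasDerivAt (fun t : ℝ => f (κ * ((x + t • v) ⬝ᵥ 1)))
        (f' (κ * (x ⬝ᵥ 1)) * (κ * (v ⬝ᵥ 1))) 0 := by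
      have h3 : HasDerivAt (fun t : ℝ => κ * ((x + t • v) ⬝ᵥ 1)) (κ * (v ⬝ᵥ 1)) 0 := by
        have h4 := (((hasDerivAt_id (0 : ℝ)).mul_const (v ⬝ᵥ 1)).const_add (x ⬝ᵥ 1)).const_mul κ
        simpa [add_dotProduct, smul_dotProduct] using h4
      have h5 : HasDerivAt f (f' (κ * (x ⬝ᵥ 1))) (κ * ((x + (0 : ℝ) • v) ⬝ᵥ 1)) := by
        simpa using hf (κ * (x ⬝ᵥ 1))
      exact h5.comp (0 : ℝ) h3
    have h3 : HasLineDerivAt ℝ (fun x : ι → ℝ => f (κ * (x ⬝ᵥ 1)))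
      (f' (κ * (x ⬝ᵥ 1)) * (κ * (v ⬝ᵥ 1))) x v := h2
    have h4 := h1.mul' (h1.mul' h3)
    convert h4 using 1
    simp only [add_dotProduct, smul_dotProduct, smul_eq_mul]
    rw [dotProduct_comm 1 v]
    ring

theorem abs_integral_le (h : IsResolvent A R c) [Nonempty ι] (hone : A.mulVec 1 = 1)
    (hc : 32 ≤ Fintype.card ι * c ^ 2) {κ : ℝ}
    (hκ : κ ^ 2 * Fintype.card ι = c) {f f' ψ : ℝ → ℝ} {K C E : ℝ}
    (hf : ∀ x, HasDerivAt f (f' x) x) (hf' : Continuous f') (hψ : ∀ x, f' x - x * f x = ψ x)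
    (hK : ∀ x, |f x| ≤ K) (hK1 : ∀ x, |x * f x| ≤ K) (hK' : ∀ x, |f' x| ≤ K)
    (hC : ∀ x, |ψ x| ≤ C) (hE0 : 0 < E)
    (hE : 3 * (6 * (R.trace - Fintype.card ι) ^ 2 + 4 * |R.trace - Fintype.card ι| +
        32 * (R * R).trace) ≤ E ^ 2) :
    |∫ x, ψ (κ * (x ⬝ᵥ 1)) ∂gibbs A| ≤ 3 * (K * √(10 / Fintype.card ι) +
      K * (E + 2) / (Fintype.card ι * c) + C * √(2 / Fintype.card ι)) *
        ∫ _, (1 : ℝ) ∂gibbs A := by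
  have hD := polyGrowth_deviation h.abs_le c
  have hρ := PolyGrowth.dotProduct_self (ι := ι)
  have hS : PolyGrowth fun x : ι → ℝ => x ⬝ᵥ 1 :=
    PolyGrowth.dotProduct PolyGrowth.coord fun _ => PolyGrowth.const _
  have hW : PolyGrowth fun x : ι → ℝ => κ * (x ⬝ᵥ 1) := (PolyGrowth.const _).mul hS
  have hfc : Continuous f := continuous_iff_continuousAt.2 fun x => (hf x).continuousAt
  have hψc : Continuous ψ := by
    rw [← funext hψ]; fun_prop
  have hψW : PolyGrowth fun x : ι → ℝ => ψ (κ * (x ⬝ᵥ 1)) :=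
    PolyGrowth.of_bounded (hψc.measurable.comp hW.1) fun x => hC _
  have hst := h.integral_stein hone hκ hf hf' hK hK'
  have hdev := h.integral_dotProduct_mul_deviation_sq_le hc
  have hsq := integral_gibbs_sq h.abs_le h.symm
  have hcube := integral_gibbs_cube h.abs_le h.symm
  have hZ1 := integral_dotProduct_self_le_mul h.abs_le h.symm
  have hZ2 := mul_integral_one_le h.abs_le h.symm
  have hZ := integral_dotProduct_self_nonneg A
  have hI := (integral_one_gibbs_pos h.abs_le).le
  have hK0 : 0 ≤ K := (abs_nonneg _).trans (hK 0)
  have hC0 : 0 ≤ C := (abs_nonneg _).trans (hC 0)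
  have hN1 : (1 : ℝ) ≤ Fintype.card ι := by exact_mod_cast Fintype.card_pos (α := ι)
  have hA' := h.abs_le
  have hc0 := h.pos
  set N : ℝ := (Fintype.card ι : ℝ) with hN
  have hN0 : 0 < N := by linarith
  set Z := ∫ x, x ⬝ᵥ x ∂gibbs A with hZdef
  have hint : ∀ {g : (ι → ℝ) → ℝ}, PolyGrowth g → Integrable g (gibbs A) :=
    fun hg => hg.integrable hA'
  have hη : PolyGrowth fun x : ι → ℝ => 1 - (x ⬝ᵥ x) / N := by
    simpa only [div_eq_mul_inv] using (PolyGrowth.const 1).sub (hρ.mul (PolyGrowth.const N⁻¹))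
  have b1 : ∫ x, (x ⬝ᵥ x) * |1 - (x ⬝ᵥ x) / N| ∂gibbs A ≤ √(10 / N) * Z := by
    refine integral_mul_abs_le dotProduct_self_nonneg' (hint hρ) (hint (hρ.mul hη.abs))
      (hint (hρ.mul (hη.pow 2))) (by positivity) le_rfl ?_
    have e : ∫ x, (x ⬝ᵥ x) * (1 - (x ⬝ᵥ x) / N) ^ 2 ∂gibbs A =
        Z - 2 / N * ((N + 2) * Z) + 1 / N ^ 2 * ((N + 4) * ((N + 2) * Z)) := by
      rw [← hcube, ← hsq, ← integral_const_mul, ← integral_const_mul, ← integral_sub,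
        ← integral_add]
      · refine integral_congr_ae (Eventually.of_forall fun x => ?_)
        simp only; field_simp; ring
      · exact (hint hρ).sub ((hint (hρ.pow 2)).const_mul _)
      · exact (hint (hρ.pow 3)).const_mul _
      · exact hint hρ
      · exact (hint (hρ.pow 2)).const_mul _
    rw [e, sq_sqrt (by positivity)]
    have : Z - 2 / N * ((N + 2) * Z) + 1 / N ^ 2 * ((N + 4) * ((N + 2) * Z)) =
      10 / N * Z - 8 * (N - 1) / N ^ 2 * Z := by field_simp; ring
    rw [this]
    have : 0 ≤ 8 * (N - 1) / N ^ 2 * Z := by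
      have : 0 ≤ N - 1 := by linarith
      positivity
    linarith
  have b2 : ∫ x, (x ⬝ᵥ x) * |deviation A c x| ∂gibbs A ≤ E * Z :=
    integral_mul_abs_le dotProduct_self_nonneg' (hint hρ) (hint (hρ.mul hD.abs))
      (hint (hρ.mul (hD.pow 2))) hE0 le_rfl
      (hdev.trans (mul_le_mul_of_nonneg_right hE hZ))
  have b3 : ∫ x : ι → ℝ, 1 * |1 - (x ⬝ᵥ x) / N| ∂gibbs A ≤ √(2 / N) * (Z / N) := by
    refine integral_mul_abs_le (fun _ => zero_le_one) (hint (PolyGrowth.const 1))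
      (hint ((PolyGrowth.const 1).mul hη.abs)) (hint ((PolyGrowth.const 1).mul (hη.pow 2)))
      (by positivity) ((le_div_iff₀' hN0).2 hZ2) ?_
    have e : ∫ x : ι → ℝ, 1 * (1 - (x ⬝ᵥ x) / N) ^ 2 ∂gibbs A =
        ∫ _, (1 : ℝ) ∂gibbs A - 2 / N * Z + 1 / N ^ 2 * ((N + 2) * Z) := by
      rw [← hsq, ← integral_const_mul, ← integral_const_mul, ← integral_sub,
        ← integral_add]
      · refine integral_congr_ae (Eventually.of_forall fun x => ?_)
        simp only; field_simp; ring
      · exact (hint (PolyGrowth.const 1)).sub ((hint hρ).const_mul _)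
      · exact (hint (hρ.pow 2)).const_mul _
      · exact hint (PolyGrowth.const 1)
      · exact (hint hρ).const_mul _
    rw [e, sq_sqrt (by positivity)]
    have e1 : ∫ _, (1 : ℝ) ∂gibbs A ≤ Z / N := (le_div_iff₀' hN0).2 hZ2
    have : 2 / N * (Z / N) = Z / N - 2 / N * Z + 1 / N ^ 2 * ((N + 2) * Z) := by field_simp; ring
    linarith
  have c1 : |∫ x, (x ⬝ᵥ x) * ψ (κ * (x ⬝ᵥ 1)) ∂gibbs A| ≤
      (K * √(10 / N) + K * (E + 2) / (N * c)) * Z := by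
    simp only [hψ] at hst
    rw [hst]
    have e1 : |∫ x, ((x ⬝ᵥ x) * (1 - (x ⬝ᵥ x) / N) * f' (κ * (x ⬝ᵥ 1)) -
        (x ⬝ᵥ x) * (κ * (x ⬝ᵥ 1) * f (κ * (x ⬝ᵥ 1))) *
          ((deviation A c x + 2) / (N * c))) ∂gibbs A| ≤
        ∫ x, (K * ((x ⬝ᵥ x) * |1 - (x ⬝ᵥ x) / N|) +
          (K / (N * c) * ((x ⬝ᵥ x) * |deviation A c x|) +
            2 * K / (N * c) * (x ⬝ᵥ x))) ∂gibbs A := by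
      rw [← norm_eq_abs]
      refine norm_integral_le_of_norm_le (((hint (hρ.mul hη.abs)).const_mul _).add
        (((hint (hρ.mul hD.abs)).const_mul _).add ((hint hρ).const_mul _)))
        (Eventually.of_forall fun x => ?_)
      have hx := dotProduct_self_nonneg' x
      have hNc : 0 < N * c := by positivity
      rw [norm_eq_abs]
      refine (abs_sub _ _).trans ?_
      rw [abs_mul, abs_mul, abs_mul ((x ⬝ᵥ x) * _), abs_mul (x ⬝ᵥ x) (_ * _), abs_of_nonneg hx,
        abs_div, abs_of_pos hNc]
      have t1 : (x ⬝ᵥ x) * |1 - (x ⬝ᵥ x) / N| * |f' (κ * (x ⬝ᵥ 1))| ≤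
        (x ⬝ᵥ x) * |1 - (x ⬝ᵥ x) / N| * K := by gcongr; exact hK' _
      have t2 : (x ⬝ᵥ x) * |κ * (x ⬝ᵥ 1) * f (κ * (x ⬝ᵥ 1))| * (|deviation A c x + 2| / (N * c)) ≤
        (x ⬝ᵥ x) * K * ((|deviation A c x| + 2) / (N * c)) := by
        gcongr
        · exact hK1 _
        · exact (abs_add_le _ _).trans (by norm_num)
      refine (add_le_add t1 t2).trans (le_of_eq ?_)
      field_simp
    refine e1.trans ?_
    rw [integral_add ((hint (hρ.mul hη.abs)).const_mul _)
        (hint (((PolyGrowth.const _).mul (hρ.mul hD.abs)).add ((PolyGrowth.const _).mul hρ))),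
      integral_add ((hint (hρ.mul hD.abs)).const_mul _) ((hint hρ).const_mul _),
      integral_const_mul, integral_const_mul, integral_const_mul]
    have t1 := mul_le_mul_of_nonneg_left b1 hK0
    have t2 := mul_le_mul_of_nonneg_left b2 (show 0 ≤ K / (N * c) by positivity)
    have t3 : (K * √(10 / N) + K * (E + 2) / (N * c)) * Z =
      K * (√(10 / N) * Z) + (K / (N * c) * (E * Z) + 2 * K / (N * c) * Z) := by ring
    rw [t3]
    linarith
  have c2 : |∫ x, (1 - (x ⬝ᵥ x) / N) * ψ (κ * (x ⬝ᵥ 1)) ∂gibbs A| ≤ C * (√(2 / N) * (Z / N)) := by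
    refine le_trans ?_ (mul_le_mul_of_nonneg_left b3 hC0)
    rw [← norm_eq_abs, ← integral_const_mul]
    refine norm_integral_le_of_norm_le ((hint ((PolyGrowth.const 1).mul hη.abs)).const_mul _)
      (Eventually.of_forall fun x => ?_)
    rw [norm_eq_abs, abs_mul, one_mul, mul_comm C]
    exact mul_le_mul_of_nonneg_left (hC _) (abs_nonneg _)
  have e : ∫ x, ψ (κ * (x ⬝ᵥ 1)) ∂gibbs A = 1 / N * ∫ x, (x ⬝ᵥ x) * ψ (κ * (x ⬝ᵥ 1)) ∂gibbs A +
      ∫ x, (1 - (x ⬝ᵥ x) / N) * ψ (κ * (x ⬝ᵥ 1)) ∂gibbs A := by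
    rw [← integral_const_mul, ← integral_add ((hint (hρ.mul hψW)).const_mul _)
      (hint (hη.mul hψW))]
    refine integral_congr_ae (Eventually.of_forall fun x => ?_)
    simp only; ring
  have hZN : Z / N ≤ 3 * ∫ _, (1 : ℝ) ∂gibbs A := by
    rw [div_le_iff₀ hN0]
    refine hZ1.trans ?_
    have := mul_le_mul_of_nonneg_right (show N + 2 ≤ 3 * N by linarith) hI
    linarith
  set B := K * √(10 / N) + K * (E + 2) / (N * c) + C * √(2 / N) with hB
  have hB0 : 0 ≤ B := by positivity
  calc _ ≤ 1 / N * ((K * √(10 / N) + K * (E + 2) / (N * c)) * Z) + C * (√(2 / N) * (Z / N)) := by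
        rw [e]
        refine (abs_add_le _ _).trans (add_le_add ?_ c2)
        rw [abs_mul, abs_of_pos (by positivity : 0 < 1 / N)]
        exact mul_le_mul_of_nonneg_left c1 (by positivity)
    _ = B * (Z / N) := by rw [hB]; ring
    _ ≤ B * (3 * ∫ _, (1 : ℝ) ∂gibbs A) := mul_le_mul_of_nonneg_left hZN hB0
    _ = _ := by ring

end IsResolvent

section
variable {ι : Type*} [Fintype ι] [DecidableEq ι] {A : Matrix ι ι ℝ} {c : ℝ}

theorem exists_isResolvent (hA : ∀ x, |x ⬝ᵥ A.mulVec x| ≤ x ⬝ᵥ x) (hsymm : A.IsSymm) (hc : 0 < c)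
    (hc1 : c ≤ 1) : ∃ R, IsResolvent A R c := by
  set B : Matrix ι ι ℝ := (1 + c) • 1 - A with hB
  have hBs : B.IsSymm := by
    rw [Matrix.IsSymm, hB, Matrix.transpose_sub, Matrix.transpose_smul, Matrix.transpose_one,
      hsymm.eq]
  have hinj : Function.Injective B.mulVec := by
    refine (injective_iff_map_eq_zero B.mulVecLin).2 fun x hx => ?_
    rw [Matrix.mulVecLin_apply, hB, Matrix.sub_mulVec, Matrix.smul_mulVec, Matrix.one_mulVec] at hx
    have h1 := congrArg (x ⬝ᵥ ·) hx
    simp only [dotProduct_sub, dotProduct_smul, smul_eq_mul, dotProduct_zero] at h1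
    have h2 := (le_abs_self _).trans (hA x)
    have h3 := dotProduct_self_nonneg' x
    have h4 : x ⬝ᵥ x = 0 := by nlinarith
    rwa [dotProduct_self_eq_zero] at h4
  have hu : IsUnit B := Matrix.mulVec_injective_iff_isUnit.1 hinj
  have hinv : B⁻¹ * B = 1 := Matrix.nonsing_inv_mul B ((Matrix.isUnit_iff_isUnit_det B).1 hu)
  refine ⟨B⁻¹, hc, hc1, hA, hsymm, ?_, ?_⟩
  · rw [Matrix.IsSymm, Matrix.transpose_nonsing_inv, hBs.eq]
  · rw [← hinv, hB, mul_sub, mul_smul_comm, mul_one, sub_sub_cancel]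

theorem IsResolvent.mulVec_eigenvector {R : Matrix ι ι ℝ} (h : IsResolvent A R c) {l : ℝ}
    {x : ι → ℝ}
    (hx : A.mulVec x = l • x) (hl : 1 + c - l ≠ 0) : R.mulVec x = (1 + c - l)⁻¹ • x := by
  have h1 : (R * A).mulVec x = l • R.mulVec x := by
    rw [← Matrix.mulVec_mulVec, hx, Matrix.mulVec_smul]
  rw [h.mul_eq, Matrix.sub_mulVec, Matrix.smul_mulVec, Matrix.one_mulVec] at h1
  have h2 : (1 + c - l) • R.mulVec x = x := by
    rw [sub_smul, ← h1, sub_sub_cancel]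
  rw [← h2, smul_smul, inv_mul_cancel₀ hl, one_smul, h2]

end

/-- Translation by `j` on the discrete circle. -/
def rotate {n : ℕ} (j : ℕ) (i : Fin n) : Fin n := ⟨((i : ℕ) + j) % n, Nat.mod_lt _ i.pos⟩

theorem rotate_injective {n : ℕ} (j : ℕ) : Function.Injective (rotate j : Fin n → Fin n) := by
  intro a b hab
  have h : (a : ℕ) + j ≡ b + j [MOD n] := congrArg Fin.val hab
  exact Fin.ext ((Nat.ModEq.add_right_cancel' j h).eq_of_lt_of_lt a.2 b.2)

/-- Translation by `j` as a permutation. -/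
def rotateEquiv {n : ℕ} (j : ℕ) : Fin n ≃ Fin n :=
  Equiv.ofBijective (rotate j) (Finite.injective_iff_bijective.1 (rotate_injective j))

theorem rotateEquiv_apply {n : ℕ} (j : ℕ) (i : Fin n) : rotateEquiv j i = rotate j i := rfl

theorem exists_rotate_eq_add {n : ℕ} (j : ℕ) (i : Fin n) :
    ∃ m : ℤ, ((rotate j i : Fin n) : ℝ) = i + j - m * n := by
  refine ⟨(((i : ℕ) + j) / n : ℕ), ?_⟩
  have h := Nat.mod_add_div ((i : ℕ) + j) n
  have h' : (((i : ℕ) + j) % n : ℕ) + (n : ℝ) * (((i : ℕ) + j) / n : ℕ) = (i : ℕ) + j := by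
    exact_mod_cast h
  rw [rotate, Int.cast_natCast]
  linarith

/-- The circulant coupling matrix of the model. -/
def coupling (n r : ℕ) : Matrix (Fin n) (Fin n) ℝ := Matrix.of fun i l =>
  1 / (2 * (r : ℝ)) * ∑ j ∈ Finset.Icc 1 r,
    ((if rotateEquiv j i = l then 1 else 0) + (if rotateEquiv j l = i then 1 else 0))

theorem coupling_isSymm (n r : ℕ) : (coupling n r).IsSymm := by
  ext i l
  simp only [coupling, Matrix.transpose_apply, Matrix.of_apply]
  simp only [add_comm]

theorem coupling_mulVec (n r : ℕ) (x : Fin n → ℝ) (i : Fin n) :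
    (coupling n r).mulVec x i = 1 / (2 * (r : ℝ)) * ∑ j ∈ Finset.Icc 1 r,
      (x (rotateEquiv j i) + x ((rotateEquiv j).symm i)) := by
  simp only [Matrix.mulVec, dotProduct, coupling, Matrix.of_apply, mul_assoc, Finset.sum_mul,
    ← Finset.mul_sum]
  rw [Finset.sum_comm]
  congr 1
  refine Finset.sum_congr rfl fun j _ => ?_
  simp only [add_mul, Finset.sum_add_distrib, ite_mul, one_mul, zero_mul]
  congr 1
  · simp
  · simp [← Equiv.eq_symm_apply]

theorem dotProduct_coupling (n r : ℕ) (x : Fin n → ℝ) :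
    x ⬝ᵥ (coupling n r).mulVec x =
      1 / (r : ℝ) * ∑ i, ∑ j ∈ Finset.Icc 1 r, x i * x (rotate j i) := by
  have h : ∀ j : ℕ, ∑ i, x i * x ((rotateEquiv j).symm i) = ∑ i, x i * x (rotate j i) := by
    intro j
    rw [← Equiv.sum_comp (rotateEquiv j)]
    simp only [Equiv.symm_apply_apply]
    simp only [rotateEquiv_apply, mul_comm]
  conv_rhs => rw [Finset.sum_comm]
  simp only [dotProduct, coupling_mulVec, mul_left_comm (x _), ← Finset.mul_sum]
  rw [Finset.sum_congr rfl fun i _ => Finset.mul_sum _ _ _, Finset.sum_comm]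
  simp only [mul_add, Finset.sum_add_distrib, h, rotateEquiv_apply]
  ring

theorem abs_dotProduct_coupling_le (n r : ℕ) (x : Fin n → ℝ) :
    |x ⬝ᵥ (coupling n r).mulVec x| ≤ x ⬝ᵥ x := by
  rw [dotProduct_coupling, Finset.sum_comm, abs_mul, abs_of_nonneg (by positivity)]
  have h : ∀ j : ℕ, |∑ i, x i * x (rotate j i)| ≤ x ⬝ᵥ x := by
    intro j
    have e : ∑ i, x (rotate j i) * x (rotate j i) = x ⬝ᵥ x :=
      Equiv.sum_comp (rotateEquiv j) fun i => x i * x i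
    calc |∑ i, x i * x (rotate j i)| ≤ ∑ i, |x i * x (rotate j i)| := Finset.abs_sum_le_sum_abs _ _
      _ ≤ ∑ i, (x i * x i + x (rotate j i) * x (rotate j i)) / 2 := by
        refine Finset.sum_le_sum fun i _ => abs_le.2 ⟨?_, ?_⟩
        · nlinarith [sq_nonneg (x i + x (rotate j i))]
        · nlinarith [sq_nonneg (x i - x (rotate j i))]
      _ = x ⬝ᵥ x := by
        rw [← Finset.sum_div, Finset.sum_add_distrib, e, dotProduct]; ring
  have h2 : |∑ j ∈ Finset.Icc 1 r, ∑ i, x i * x (rotate j i)| ≤ r * (x ⬝ᵥ x) := by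
    refine (Finset.abs_sum_le_sum_abs _ _).trans
      ((Finset.sum_le_card_nsmul _ _ _ fun j _ => h j).trans ?_)
    simp
  rcases Nat.eq_zero_or_pos r with rfl | hr
  · simpa using dotProduct_self_nonneg' x
  · rw [one_div_mul_eq_div, div_le_iff₀' (by positivity)]
    exact h2

/-- The cosine wave of frequency `k` with its crest at `l`. -/
def wave (n k : ℕ) (l : Fin n) (i : Fin n) : ℝ := cos (freq n k * ((i : ℝ) - l))

theorem cos_freq_add_mul (n k : ℕ) (hn : 0 < n) (t : ℝ) (m : ℤ) :
    cos (freq n k * (t - m * n)) = cos (freq n k * t) := by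
  have : freq n k * (t - m * n) = freq n k * t - ((m * k : ℤ) : ℝ) * (2 * π) := by
    rw [freq]; push_cast; field_simp
  rw [this, cos_sub_int_mul_two_pi]

theorem coupling_mulVec_wave (n r k : ℕ) (l : Fin n) :
    (coupling n r).mulVec (wave n k l) = cosAvg r (freq n k) • wave n k l := by
  ext i
  rw [coupling_mulVec, Pi.smul_apply, smul_eq_mul, cosAvg, Finset.sum_div, Finset.sum_mul,
    Finset.mul_sum]
  refine Finset.sum_congr rfl fun j hj => ?_
  have h1 : wave n k l (rotateEquiv j i) = cos (freq n k * (i - l) + j * freq n k) := by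
    obtain ⟨m, hm⟩ := exists_rotate_eq_add j i
    rw [wave, rotateEquiv_apply, hm, ← cos_freq_add_mul n k i.pos _ (-m)]
    congr 1; push_cast; ring
  have h2 : wave n k l ((rotateEquiv j).symm i) = cos (freq n k * (i - l) - j * freq n k) := by
    obtain ⟨m, hm⟩ := exists_rotate_eq_add j ((rotateEquiv j).symm i)
    rw [← rotateEquiv_apply, Equiv.apply_symm_apply] at hm
    rw [wave, ← cos_freq_add_mul n k i.pos _ m]
    congr 1; rw [hm]; ring
  have hr : (r : ℝ) ≠ 0 := by
    have := Finset.mem_Icc.1 hj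
    exact_mod_cast (show r ≠ 0 by omega)
  rw [h1, h2, cos_add, cos_sub, wave]
  field_simp
  ring

theorem coupling_mulVec_one (n r : ℕ) (hr : 0 < r) : (coupling n r).mulVec 1 = 1 := by
  ext i
  rw [coupling_mulVec]
  simp
  field_simp
  ring

theorem trace_eq_sum_of_wave {n : ℕ} {M : Matrix (Fin n) (Fin n) ℝ} {f : ℕ → ℝ}
    (hM : ∀ k l, M.mulVec (wave n k l) = f k • wave n k l) :
    M.trace = ∑ k ∈ Finset.range n, f k := by
  rcases Nat.eq_zero_or_pos n with rfl | hn
  · simp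
  have hn' : (n : ℝ) ≠ 0 := by positivity
  have hδ : ∀ l : Fin n, (Pi.single l 1 : Fin n → ℝ) =
      ∑ k ∈ Finset.range n, (1 / (n : ℝ)) • wave n k l := by
    intro l
    ext i
    have h := sum_range_cos_freq hn ((i : ℤ) - l)
    have hdvd : (n : ℤ) ∣ (i : ℤ) - l ↔ i = l := by
      constructor
      · intro hd
        have h1 := Int.eq_zero_of_abs_lt_dvd hd (by have := i.2; have := l.2; rw [abs_lt]; omega)
        exact Fin.ext (by omega)
      · rintro rfl; simp
    rw [Finset.sum_apply]
    simp only [Pi.smul_apply, smul_eq_mul, wave, ← Finset.mul_sum]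
    push_cast at h
    simp only [mul_comm (freq n _), h, hdvd]
    by_cases hil : i = l
    · subst hil; simp [hn']
    · simp [hil]
  have hdiag : ∀ l, M l l = ∑ k ∈ Finset.range n, 1 / (n : ℝ) * f k := by
    intro l
    have h1 : M l l = M.mulVec (Pi.single l 1) l := by simp
    rw [h1, hδ, Matrix.mulVec_sum, Finset.sum_apply]
    refine Finset.sum_congr rfl fun k _ => ?_
    rw [Matrix.mulVec_smul, hM]
    simp [wave]
  rw [Matrix.trace]
  simp only [Matrix.diag_apply, hdiag, ← Finset.mul_sum]
  simp [hn']

section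
variable {n r : ℕ} {c : ℝ} {R : Matrix (Fin n) (Fin n) ℝ}

theorem IsResolvent.mulVec_wave (h : IsResolvent (coupling n r) R c) (k : ℕ) (l : Fin n) :
    R.mulVec (wave n k l) = (1 + c - cosAvg r (freq n k))⁻¹ • wave n k l := by
  have := (le_abs_self _).trans (abs_cosAvg_le r (freq n k))
  exact h.mulVec_eigenvector (coupling_mulVec_wave n r k l) (by linarith [h.pos])

theorem IsResolvent.trace_coupling (h : IsResolvent (coupling n r) R c) (hr : r < n) :
    R.trace - n = -(n * c / (1 + c)) + resolventSum n r c / (1 + c) ^ 2 := by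
  have hc := h.pos
  have e : ∀ k, (1 + c - cosAvg r (freq n k))⁻¹ = 1 / (1 + c) + 1 / (1 + c) ^ 2 *
      cosAvg r (freq n k) +
        cosAvg r (freq n k) ^ 2 / (1 + c - cosAvg r (freq n k)) / (1 + c) ^ 2 := by
    intro k
    have := (le_abs_self _).trans (abs_cosAvg_le r (freq n k))
    have : 1 + c - cosAvg r (freq n k) ≠ 0 := by linarith
    field_simp
    ring
  rw [trace_eq_sum_of_wave h.mulVec_wave]
  simp only [e, Finset.sum_add_distrib, ← Finset.mul_sum, ← Finset.sum_div]
  rw [sum_cosAvg hr, resolventSum]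
  simp
  field_simp
  ring

theorem IsResolvent.trace_sq_coupling_le (h : IsResolvent (coupling n r) R c) :
    (R * R).trace ≤ 2 * n + 2 / c * resolventSum n r c := by
  have hc := h.pos
  rw [trace_eq_sum_of_wave (f := fun k => (1 + c - cosAvg r (freq n k))⁻¹ ^ 2), resolventSum,
    Finset.mul_sum]
  · calc _ ≤ ∑ k ∈ Finset.range n, (2 + 2 / c *
        (cosAvg r (freq n k) ^ 2 / (1 + c - cosAvg r (freq n k)))) := by
          refine Finset.sum_le_sum fun k _ => ?_
          have := (le_abs_self _).trans (abs_cosAvg_le r (freq n k))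
          set l := cosAvg r (freq n k)
          have hu : c ≤ 1 + c - l := by linarith
          have hu0 : 0 < 1 + c - l := by linarith
          have e1 : (1 + c - l)⁻¹ ^ 2 ≤ ((1 + c) * (1 + c - l)⁻¹) ^ 2 := by
            rw [mul_pow]
            exact le_mul_of_one_le_left (by positivity) (by nlinarith)
          have e2 : (1 + c) * (1 + c - l)⁻¹ = 1 + l / (1 + c - l) := by field_simp; ring
          have e3 : (l / (1 + c - l)) ^ 2 ≤ 1 / c * (l ^ 2 / (1 + c - l)) := by
            have : (l / (1 + c - l)) ^ 2 = 1 / (1 + c - l) * (l ^ 2 / (1 + c - l)) := by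
              field_simp
            rw [this]
            gcongr
          rw [e2] at e1
          have e4 : 2 / c * (l ^ 2 / (1 + c - l)) = 2 * (1 / c * (l ^ 2 / (1 + c - l))) := by ring
          rw [e4]
          nlinarith [_root_.sq_nonneg (1 - l / (1 + c - l))]
      _ = _ := by rw [Finset.sum_add_distrib]; simp [mul_comm]
  · intro k l
    rw [← Matrix.mulVec_mulVec, h.mulVec_wave, Matrix.mulVec_smul, h.mulVec_wave, smul_smul, sq]

end

theorem pi_gaussianReal_eq_withDensity (n : ℕ) :
    (Measure.pi fun _ : Fin n => (gaussianReal 0 1 : Measure ℝ)) =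
      volume.withDensity fun x => ENNReal.ofReal ((√(2 * π))⁻¹ ^ n * exp (-(x ⬝ᵥ x / 2))) := by
  refine Measure.pi_eq fun s hs => ?_
  rw [withDensity_apply _ (MeasurableSet.univ_pi hs),
    ← lintegral_indicator (MeasurableSet.univ_pi hs)]
  have h0 : ∀ i y, 0 ≤ (s i).indicator (gaussianPDFReal 0 1) y := fun i y =>
    Set.indicator_nonneg (fun y _ => gaussianPDFReal_nonneg 0 1 y) y
  have hint : ∀ i, Integrable ((s i).indicator (gaussianPDFReal 0 1)) := fun i =>
    (integrable_gaussianPDFReal 0 1).indicator (hs i)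
  have e : ∀ x : Fin n → ℝ, (Set.univ.pi s).indicator
      (fun x => ENNReal.ofReal ((√(2 * π))⁻¹ ^ n * exp (-(x ⬝ᵥ x / 2)))) x =
      ENNReal.ofReal (∏ i, (s i).indicator (gaussianPDFReal 0 1) (x i)) := by
    intro x
    by_cases hx : x ∈ Set.univ.pi s
    · rw [Set.indicator_of_mem hx]
      have h : ∀ i, (s i).indicator (gaussianPDFReal 0 1) (x i) = gaussianPDFReal 0 1 (x i) :=
        fun i => Set.indicator_of_mem (hx i trivial) _
      simp only [h, gaussianPDFReal]
      rw [Finset.prod_mul_distrib, ← exp_sum]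
      simp [dotProduct, Finset.sum_div, neg_div, sq]
    · rw [Set.indicator_of_notMem hx]
      obtain ⟨i, hi⟩ : ∃ i, x i ∉ s i := by simpa [Set.mem_pi] using hx
      rw [Finset.prod_eq_zero (Finset.mem_univ i) (Set.indicator_of_notMem hi _),
        ENNReal.ofReal_zero]
  simp only [e]
  rw [volume_pi, ← ofReal_integral_eq_lintegral_ofReal (Integrable.fintype_prod hint)
      (Eventually.of_forall fun x => Finset.prod_nonneg fun i _ => h0 i _),
    integral_fintype_prod_eq_prod,
    ENNReal.ofReal_prod_of_nonneg fun i _ => integral_nonneg (h0 i)]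
  refine Finset.prod_congr rfl fun i _ => ?_
  rw [gaussianReal_apply_eq_integral _ one_ne_zero, integral_indicator (hs i)]

theorem Temp_eq (n : ℕ) (x : Fin n → ℝ) : Temp n x = (x ⬝ᵥ x) / n := by
  simp only [Temp, dotProduct, sq]

theorem Ham_eq (n r : ℕ) (x : Fin n → ℝ) :
    Ham n r x = -(x ⬝ᵥ (coupling n r).mulVec x) / 2 := by
  rw [dotProduct_coupling, Ham]
  simp only [rotate]
  ring

theorem preμ_eq {n : ℕ} (hn : 0 < n) (r : ℕ) :
    preμ n r = ENNReal.ofReal ((√(2 * π))⁻¹ ^ n) • gibbs (coupling n r) := by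
  have : Nonempty (Fin n) := ⟨⟨0, hn⟩⟩
  have hw := measurable_gibbsWeight (coupling n r)
  have hdot := PolyGrowth.dotProduct_self (ι := Fin n).1
  have hdens : Measurable fun x : Fin n → ℝ =>
      if 0 < Temp n x then ENNReal.ofReal (exp (-(Ham n r x) / Temp n x)) else 0 := by
    simp only [Temp_eq, Ham_eq]
    have hq := (PolyGrowth.quadForm (coupling n r)).1
    refine Measurable.ite (measurableSet_lt measurable_const (hdot.div_const _)) ?_ measurable_const
    exact (measurable_exp.comp (((hq.neg.div_const 2).neg).div (hdot.div_const _))).ennreal_ofReal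
  rw [preμ, pi_gaussianReal_eq_withDensity, ← withDensity_mul _ (by
    exact (measurable_const.mul (measurable_exp.comp (hdot.div_const 2).neg)).ennreal_ofReal) hdens,
    gibbs, ← withDensity_smul _ hw.ennreal_ofReal]
  refine withDensity_congr_ae ?_
  have hne : ∀ᵐ x : Fin n → ℝ, x ≠ 0 := Measure.ae_ne _ _
  filter_upwards [hne] with x hx
  have hx0 : 0 < x ⬝ᵥ x :=
    (dotProduct_self_nonneg' x).lt_of_ne' (by rwa [Ne, dotProduct_self_eq_zero])
  have hn' : (0 : ℝ) < n := by exact_mod_cast hn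
  simp only [Pi.mul_apply, Pi.smul_apply, smul_eq_mul, Temp_eq, Ham_eq]
  rw [if_pos (by positivity), ← ENNReal.ofReal_mul (by positivity),
    ← ENNReal.ofReal_mul (by positivity), mul_assoc, ← exp_add, gibbsWeight, Fintype.card_fin]
  congr 3
  field_simp
  ring

theorem integral_μmeas {n : ℕ} (hn : 0 < n) (r : ℕ) (φ : (Fin n → ℝ) → ℝ) :
    ∫ x, φ x ∂μmeas n r = (∫ x, φ x ∂gibbs (coupling n r)) /
      ∫ _, (1 : ℝ) ∂gibbs (coupling n r) := by
  rw [μmeas, preμ_eq hn, integral_smul_measure, integral_smul_measure, integral_const]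
  have hC : 0 < (√(2 * π))⁻¹ ^ n := by positivity
  simp only [Measure.smul_apply, smul_eq_mul, ENNReal.toReal_inv, ENNReal.toReal_mul,
    ENNReal.toReal_ofReal hC.le, mul_one, Measure.real]
  field_simp

theorem tendsto_atTop_of_pow_three {α : Type*} {l : Filter α} {u : α → ℝ}
    (hu : ∀ᶠ a in l, 0 ≤ u a) (h : Tendsto (fun a => u a ^ 3) l atTop) : Tendsto u l atTop := by
  refine tendsto_atTop.2 fun b => ?_
  filter_upwards [hu, h.eventually_ge_atTop (max b 0 ^ 3)] with a ha h1
  exact (le_max_left b 0).trans (le_of_pow_le_pow_left₀ three_ne_zero ha h1)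

/-- The critical shift, of order `r ^ (-2/3)`. -/
def shift (r : ℕ) : ℝ := (3 / (2 * (r : ℝ) ^ 2)) ^ ((1 : ℝ) / 3)

theorem shift_pos {r : ℕ} (hr : 0 < r) : 0 < shift r := by
  unfold shift; positivity

theorem shift_pow_three (r : ℕ) : shift r ^ 3 = 3 / (2 * (r : ℝ) ^ 2) := by
  rw [shift, ← rpow_natCast, ← rpow_mul (by positivity)]
  norm_num

theorem sqrt_mul_sqrt_shift {n r : ℕ} (hr : 0 < r) :
    √((2 / 3 : ℝ) ^ ((1 : ℝ) / 3)) * √(shift r / n) = ((r : ℝ) ^ ((1 : ℝ) / 3) * √n)⁻¹ := by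
  have hp : ((r : ℝ) ^ ((1 : ℝ) / 3)) ^ 3 = r := by
    rw [← rpow_natCast, ← rpow_mul (by positivity)]; norm_num
  have hv : ((2 / 3 : ℝ) ^ ((1 : ℝ) / 3)) ^ 3 = 2 / 3 := by
    rw [← rpow_natCast, ← rpow_mul (by positivity)]; norm_num
  have hc := shift_pow_three r
  have hp0 : 0 < (r : ℝ) ^ ((1 : ℝ) / 3) := by positivity
  have hv0 : 0 < (2 / 3 : ℝ) ^ ((1 : ℝ) / 3) := by positivity
  have hc0 := shift_pos hr
  set p := (r : ℝ) ^ ((1 : ℝ) / 3)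
  set v := (2 / 3 : ℝ) ^ ((1 : ℝ) / 3)
  have h1 : v * shift r * p ^ 2 = 1 := by
    rw [← pow_eq_one_iff_of_nonneg (by positivity) three_ne_zero, mul_pow, mul_pow, hv, hc,
      show (p ^ 2) ^ 3 = (p ^ 3) ^ 2 by ring, hp]
    field_simp
  rw [← sqrt_mul hv0.le, mul_inv, ← sqrt_inv, ← mul_div_assoc, div_eq_mul_inv,
    eq_div_of_mul_eq (by positivity) h1, sqrt_mul (by positivity), one_div, ← inv_pow,
    sqrt_sq (by positivity)]

section
variable {r : ℕ → ℕ}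

theorem tendsto_range_atTop
    (hlower : Tendsto (fun n : ℕ => (r n : ℝ) / √n) atTop atTop) : Tendsto r atTop atTop := by
  rw [← tendsto_natCast_atTop_iff (R := ℝ)]
  refine tendsto_atTop_mono' _ ?_ hlower
  filter_upwards [eventually_ge_atTop 1] with n hn
  exact div_le_self (by positivity) (one_le_sqrt.2 (by exact_mod_cast hn))

theorem tendsto_shift (hr : Tendsto r atTop atTop) :
    Tendsto (fun n => shift (r n)) atTop (𝓝 0) := by
  have h1 : Tendsto (fun n => 3 / (2 * (r n : ℝ) ^ 2)) atTop (𝓝 0) :=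
    (((tendsto_pow_atTop two_ne_zero).comp (tendsto_natCast_atTop_atTop.comp hr)).const_mul_atTop
      (by norm_num : (0 : ℝ) < 2)).const_div_atTop 3
  have h2 := h1.rpow_const (p := 1 / 3) (Or.inr (by norm_num))
  rwa [zero_rpow (by norm_num)] at h2

theorem tendsto_range_mul_shift (hr : Tendsto r atTop atTop) :
    Tendsto (fun n => r n * shift (r n)) atTop atTop := by
  refine tendsto_atTop_of_pow_three (Eventually.of_forall fun n => ?_) ?_
  · unfold shift; positivity
  · refine Tendsto.congr' ?_ ((tendsto_natCast_atTop_atTop.comp hr).const_mul_atTop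
      (by norm_num : (0 : ℝ) < 3 / 2))
    filter_upwards [hr.eventually_gt_atTop 0] with n hn
    rw [mul_pow, shift_pow_three, Function.comp_apply]
    field_simp

theorem tendsto_mul_shift_sq (hr : Tendsto r atTop atTop)
    (hupper : Tendsto (fun n : ℕ => (r n : ℝ) / (n : ℝ) ^ ((3 : ℝ) / 4)) atTop (𝓝 0)) :
    Tendsto (fun n : ℕ => n * shift (r n) ^ 2) atTop atTop := by
  refine tendsto_atTop_of_pow_three (Eventually.of_forall fun n => by positivity) ?_
  have h1 : Tendsto (fun n : ℕ => (r n : ℝ) / (n : ℝ) ^ ((3 : ℝ) / 4)) atTop (𝓝[>] 0) := by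
    refine tendsto_nhdsWithin_iff.2 ⟨hupper, ?_⟩
    filter_upwards [hr.eventually_gt_atTop 0, eventually_gt_atTop 0] with n hn hn'
    rw [Set.mem_Ioi]
    positivity
  refine Tendsto.congr' ?_ (((tendsto_pow_atTop (n := 4) (by norm_num)).comp
    (tendsto_inv_nhdsGT_zero.comp h1)).const_mul_atTop (by norm_num : (0 : ℝ) < 9 / 4))
  filter_upwards [hr.eventually_gt_atTop 0, eventually_gt_atTop 0] with n hn hn'
  have h2 : ((n : ℝ) ^ ((3 : ℝ) / 4)) ^ 4 = (n : ℝ) ^ 3 := by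
    rw [← rpow_natCast, ← rpow_mul (by positivity), ← rpow_natCast]; norm_num
  rw [mul_pow, ← pow_mul, mul_comm 2, pow_mul, shift_pow_three, Function.comp_apply,
    Function.comp_apply, inv_div, div_pow, h2]
  field_simp
  norm_num

end

/-- The bound on the standard deviation of `deviation` obtained from the resolvent traces. -/
def deviationBound (n r : ℕ) (c : ℝ) : ℝ :=
  √(18 * (-(n * c / (1 + c)) + resolventSum n r c / (1 + c) ^ 2) ^ 2 +
    12 * |-(n * c / (1 + c)) + resolventSum n r c / (1 + c) ^ 2| +
    96 * (2 * n + 2 / c * resolventSum n r c) + 1)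

theorem tendsto_deviationBound {r : ℕ → ℕ} {c : ℕ → ℝ} (hc : ∀ᶠ n in atTop, 0 < c n)
    (hc0 : Tendsto c atTop (𝓝 0)) (hnc : Tendsto (fun n : ℕ => n * c n ^ 2) atTop atTop)
    (hnc' : Tendsto (fun n : ℕ => n * c n) atTop atTop)
    (hT : Tendsto (fun n => resolventSum n (r n) (c n) / (n * c n)) atTop (𝓝 1)) :
    Tendsto (fun n => deviationBound n (r n) (c n) / (n * c n)) atTop (𝓝 0) := by
  have h1 : Tendsto (fun n => 1 + c n) atTop (𝓝 1) := by simpa using hc0.const_add 1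
  have hτ : Tendsto (fun n => -(1 / (1 + c n)) +
      resolventSum n (r n) (c n) / (n * c n) / (1 + c n) ^ 2) atTop (𝓝 0) := by
    have := ((tendsto_const_nhds (x := (1 : ℝ))).div h1 one_ne_zero).neg.add
      (hT.div (h1.pow 2) (by norm_num))
    simpa using this
  have hi := hnc'.inv_tendsto_atTop
  have hi2 := hnc.inv_tendsto_atTop
  have hlim : Tendsto (fun n => √(18 * (-(1 / (1 + c n)) +
      resolventSum n (r n) (c n) / (n * c n) / (1 + c n) ^ 2) ^ 2 +
      12 * (|-(1 / (1 + c n)) + resolventSum n (r n) (c n) / (n * c n) / (1 + c n) ^ 2| *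
        (n * c n)⁻¹) + 96 * (2 * (n * c n ^ 2)⁻¹ + 2 * (resolventSum n (r n) (c n) / (n * c n) *
        (n * c n ^ 2)⁻¹)) + (n * c n)⁻¹ ^ 2)) atTop (𝓝 0) := by
    have := (((((hτ.pow 2).const_mul 18).add ((hτ.abs.mul hi).const_mul 12)).add
      (((hi2.const_mul 2).add ((hT.mul hi2).const_mul 2)).const_mul 96)).add (hi.pow 2)).sqrt
    simpa using this
  refine hlim.congr' ?_
  filter_upwards [hc, hnc'.eventually_gt_atTop 0] with n hcn hq
  rw [deviationBound, eq_div_iff hq.ne']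
  have hn : (0 : ℝ) < n := pos_of_mul_pos_left hq hcn.le
  have e : -(n * c n / (1 + c n)) + resolventSum n (r n) (c n) / (1 + c n) ^ 2 =
      (-(1 / (1 + c n)) + resolventSum n (r n) (c n) / (n * c n) / (1 + c n) ^ 2) * (n * c n) := by
    field_simp
  have hs : ∀ X : ℝ, √X * (n * c n) = √(X * (n * c n) ^ 2) := fun X => by
    rw [sqrt_mul' _ (sq_nonneg _), sqrt_sq hq.le]
  rw [hs, e, abs_mul, abs_of_pos hq]
  generalize -(1 / (1 + c n)) + resolventSum n (r n) (c n) / (n * c n) / (1 + c n) ^ 2 = t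
  congr 1
  field_simp

theorem abs_integral_μmeas_le {n r : ℕ} {c : ℝ} (hr : 0 < r) (hrn : r < n) (hc0 : 0 < c)
    (hc1 : c ≤ 1) (hc : 32 ≤ n * c ^ 2) {f f' ψ : ℝ → ℝ} {K C : ℝ}
    (hf : ∀ x, HasDerivAt f (f' x) x) (hf' : Continuous f') (hψ : ∀ x, f' x - x * f x = ψ x)
    (hK : ∀ x, |f x| ≤ K) (hK1 : ∀ x, |x * f x| ≤ K) (hK' : ∀ x, |f' x| ≤ K)
    (hC : ∀ x, |ψ x| ≤ C) :
    |∫ x, ψ (√(c / n) * Mag n x) ∂μmeas n r| ≤ 3 * (K * √(10 / n) +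
      K * (deviationBound n r c + 2) / (n * c) + C * √(2 / n)) := by
  have hn : 0 < n := by omega
  have : Nonempty (Fin n) := ⟨⟨0, hn⟩⟩
  obtain ⟨R, hR⟩ := exists_isResolvent (abs_dotProduct_coupling_le n r) (coupling_isSymm n r)
    hc0 hc1
  have hT := resolventSum_nonneg n r hc0
  have h1 := hR.abs_integral_le (coupling_mulVec_one n r hr) (by simpa using hc)
    (κ := √(c / n)) (E := deviationBound n r c)
    (by rw [sq_sqrt (by positivity), Fintype.card_fin]; field_simp) hf hf' hψ hK hK1 hK' hC
    (by unfold deviationBound; positivity)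
    (by
      rw [deviationBound, sq_sqrt (by positivity), Fintype.card_fin, hR.trace_coupling hrn]
      linarith [hR.trace_sq_coupling_le])
  have hI := integral_one_gibbs_pos (abs_dotProduct_coupling_le n r)
  have hM : ∀ x : Fin n → ℝ, x ⬝ᵥ 1 = Mag n x := fun x => by simp [Mag, dotProduct]
  rw [integral_μmeas hn, abs_div, abs_of_pos hI, div_le_iff₀ hI]
  simpa only [Fintype.card_fin, hM] using h1

theorem isProbabilityMeasure_μmeas {n : ℕ} (hn : 0 < n) (r : ℕ) :
    IsProbabilityMeasure (μmeas n r) := by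
  refine ⟨?_⟩
  have h := integral_μmeas hn r fun _ => 1
  rw [div_self (integral_one_gibbs_pos (abs_dotProduct_coupling_le n r)).ne', integral_const,
    smul_eq_mul, mul_one, Measure.real, ENNReal.toReal_eq_one_iff] at h
  exact h

theorem integral_gaussianReal_eq_scale (φ : ℝ → ℝ) {v : ℝ} (hv : 0 ≤ v) :
    ∫ x, φ x ∂gaussianReal 0 v.toNNReal = ∫ x, φ (√v * x) ∂gaussianReal 0 1 := by
  have h := gaussianReal_map_const_mul (μ := 0) (v := 1) (√v)
  have e : NNReal.mk (√v ^ 2) (sq_nonneg _) * 1 = v.toNNReal := by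
    ext; simp [sq_sqrt hv, hv]
  by_cases h0 : v = 0
  · subst h0; simp
  have hs : √v ≠ 0 := (sqrt_pos.2 (hv.lt_of_ne' h0)).ne'
  rw [mul_zero] at h
  rw [← e, ← h]
  exact (measurableEmbedding_mulLeft₀ hs).integral_map _

theorem tendsto_integral_of_steinBound {r : ℕ → ℕ}
    (hr : ∀ n, 3 ≤ n → 0 < 2 * r n ∧ 2 * r n < n)
    (hlower : Tendsto (fun n : ℕ => (r n : ℝ) / √n) atTop atTop)
    (hupper : Tendsto (fun n : ℕ => (r n : ℝ) / (n : ℝ) ^ ((3 : ℝ) / 4)) atTop (𝓝 0))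
    {ψ : ℝ → ℝ} (hψ : Continuous ψ) {C : ℝ} (hC : ∀ x, |ψ x| ≤ C)
    (h0 : ∫ x, ψ x ∂gaussianReal 0 1 = 0) :
    Tendsto (fun n : ℕ => ∫ x, ψ (√(shift (r n) / n) * Mag n x) ∂μmeas n (r n)) atTop (𝓝 0) := by
  have h0' : ∫ x, ψ x * exp (-(x ^ 2 / 2)) = 0 := by
    rw [integral_gaussianReal_eq_integral_smul one_ne_zero] at h0
    have e : ∀ x, gaussianPDFReal 0 1 x • ψ x = (√(2 * π))⁻¹ * (ψ x * exp (-(x ^ 2 / 2))) := by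
      intro x
      simp [gaussianPDFReal, neg_div]
      ring
    simp only [e, integral_const_mul] at h0
    exact (mul_eq_zero.1 h0).resolve_left (by positivity)
  obtain ⟨f, f', K, hf, hf', hff, hK, hK1, hK'⟩ := exists_stein_solution hψ hC h0'
  have hrt := tendsto_range_atTop hlower
  have hc0 := tendsto_shift hrt
  have hrc := tendsto_range_mul_shift hrt
  have hnc2 := tendsto_mul_shift_sq hrt hupper
  have hr0 : ∀ᶠ n in atTop, 0 < r n := hrt.eventually_gt_atTop 0
  have hc : ∀ᶠ n in atTop, 0 < shift (r n) := hr0.mono fun n hn => shift_pos hn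
  have hc1 : ∀ᶠ n in atTop, shift (r n) ≤ 1 := hc0.eventually_le_const one_pos
  have hrn : ∀ᶠ n in atTop, 2 * r n < n :=
    (eventually_ge_atTop 3).mono fun n hn => (hr n hn).2
  have hnc : Tendsto (fun n : ℕ => n * shift (r n)) atTop atTop := by
    refine tendsto_atTop_mono' _ ?_ hnc2
    filter_upwards [hc, hc1] with n h1 h2
    exact mul_le_mul_of_nonneg_left (by nlinarith) n.cast_nonneg
  have hT := tendsto_resolventSum hrt hrn hc
    (hr0.mono fun n hn => by rw [shift_pow_three]; field_simp) hc0 hrc hnc2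
  have hD := tendsto_deviationBound hc hc0 hnc2 hnc hT
  have hsq : ∀ a : ℝ, Tendsto (fun n : ℕ => √(a / n)) atTop (𝓝 0) := fun a => by
    simpa using (tendsto_const_div_atTop_nhds_zero_nat a).sqrt
  have hlim : Tendsto (fun n : ℕ => 3 * (K * √(10 / n) +
      K * (deviationBound n (r n) (shift (r n)) + 2) / (n * shift (r n)) + C * √(2 / n)))
      atTop (𝓝 0) := by
    have := ((((hsq 10).const_mul K).add ((hD.add (hnc.const_div_atTop 2)).const_mul K)).add
      ((hsq 2).const_mul C)).const_mul 3
    simp only [mul_zero, add_zero] at this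
    refine this.congr fun n => ?_
    rw [mul_div_assoc, add_div]
  refine squeeze_zero_norm' ?_ hlim
  filter_upwards [hr0, hc, hc1, hrn, hnc2.eventually_ge_atTop 32] with n h1 h2 h3 h4 h5
  exact abs_integral_μmeas_le h1 (by omega) h2 h3 h5 hf hf' hff hK hK1 hK' hC

/-- **Theorem (intermediate regime).** If `r_n / √n → ∞` and `r_n / n^{3/4} → 0`, then under
`μ_n` the rescaled magnetization `S_n / (r_n^{1/3} √n)` converges in distribution to the
centered Gaussian law `N(0, (2/3)^{1/3})`. -/
theorem intermediate_regime_gaussian_fluctuations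
    (r : ℕ → ℕ) (hr : ∀ n, 3 ≤ n → 0 < 2 * r n ∧ 2 * r n < n)
    (hlower : Tendsto (fun n : ℕ => (r n : ℝ) / Real.sqrt n) atTop atTop)
    (hupper : Tendsto (fun n : ℕ => (r n : ℝ) / (n : ℝ) ^ ((3 : ℝ) / 4)) atTop (𝓝 0)) :
    ∀ φ : BoundedContinuousFunction ℝ ℝ,
      Tendsto (fun n : ℕ =>
          ∫ x, φ (Mag n x / ((r n : ℝ) ^ ((1 : ℝ) / 3) * Real.sqrt n)) ∂(μmeas n (r n))) atTop
        (𝓝 (∫ x, φ x ∂(gaussianReal 0 (Real.toNNReal ((2 / 3 : ℝ) ^ ((1 : ℝ) / 3)))))) := by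
  intro φ
  rw [integral_gaussianReal_eq_scale _ (by positivity)]
  set sv := √((2 / 3 : ℝ) ^ ((1 : ℝ) / 3)) with hsv
  set m := ∫ x, φ (sv * x) ∂gaussianReal 0 1 with hm
  have hcont : Continuous fun y => φ (sv * y) := by fun_prop
  have hint : ∀ {α : Type} [MeasurableSpace α] (μ : Measure α) [IsProbabilityMeasure μ]
      {u : α → ℝ}, Measurable u → Integrable (fun x => φ (sv * u x)) μ := fun μ _ u hu =>
    Integrable.of_bound (hcont.measurable.comp hu).aestronglyMeasurable ‖φ‖
      (Eventually.of_forall fun _ => φ.norm_coe_le_norm _)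
  have key := tendsto_integral_of_steinBound hr hlower hupper (ψ := fun y => φ (sv * y) - m)
    (by fun_prop) (C := ‖φ‖ + |m|)
    (fun x => (abs_sub _ _).trans (add_le_add_left (φ.norm_coe_le_norm _) _))
    (by rw [integral_sub (hint _ (u := fun y => y) measurable_id) (integrable_const _)]; simp [hm])
  rw [← tendsto_sub_nhds_zero_iff]
  refine key.congr' ?_
  filter_upwards [eventually_ge_atTop 3] with n hn
  have := isProbabilityMeasure_μmeas (n := n) (by omega) (r n)
  have hM : Measurable (Mag n) := by unfold Mag; fun_prop
  rw [integral_sub (hint _ (hM.const_mul _)) (integrable_const _)]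
  simp only [← mul_assoc, hsv, sqrt_mul_sqrt_shift (n := n) (r := r n) (by have := hr n hn; omega)]
  simp [div_eq_inv_mul]

end
end

section
/- Let n ≥ 1 and let Y_1,…,Y_n be i.i.d. standard normal random variables with joint law ν^{⊗n}, and set T_n = (Y_1²+⋯+Y_n²)/n. Then T_n is independent of the random vector (Y_1/√T_n,…,Y_n/√T_n). Moreover, for every measurable and bounded function g: ℝ^n → ℝ, one has ν^{⊗n}[g(Y_1/√T_n,…,Y_n/√T_n)] = (Γ(n/2)/(π^{n/2} n^{(n−2)/2})) ∫_{ℝ^{n−1}} (dz_1⋯dz_{n−1}/√(n−z_1²−⋯−z_{n−1}²)) 1_{z_1²+⋯+z_{n−1}² < n} g_s(z_1,…,z_{n−1}, √(n−z_1²−⋯−z_{n−1}²)), where g_s(z_1,…,z_n) = (g(z_1,…,z_{n−1},z_n) + g(z_1,…,z_{n−1},−z_n))/2 is the even part of g with respect to the last variable. -/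
open MeasureTheory ProbabilityTheory Real Filter Topology

noncomputable section

/-- The open ball of squared radius `N` for the Euclidean norm. -/
def sqBall (m : ℕ) (N : ℝ) : Set (Fin m → ℝ) := {z | ∑ j, z j ^ 2 < N}

/-- The height above `z` of the sphere of squared radius `N`. -/
def sphereHeight {m : ℕ} (N : ℝ) (z : Fin m → ℝ) : ℝ := √(N - ∑ j, z j ^ 2)

lemma measurable_sphereHeight {m : ℕ} (N : ℝ) : Measurable (sphereHeight (m := m) N) := by
  unfold sphereHeight; fun_prop

lemma measurableSet_sqBall (m : ℕ) (N : ℝ) : MeasurableSet (sqBall m N) :=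
  measurableSet_lt (by fun_prop) measurable_const

lemma sphereHeight_pos {m : ℕ} {N : ℝ} {z : Fin m → ℝ} (hz : z ∈ sqBall m N) :
    0 < sphereHeight N z :=
  Real.sqrt_pos.2 (sub_pos.2 hz)

lemma sq_sphereHeight {m : ℕ} {N : ℝ} {z : Fin m → ℝ} (hz : z ∈ sqBall m N) :
    sphereHeight N z ^ 2 = N - ∑ j, z j ^ 2 :=
  Real.sq_sqrt (sub_pos.2 hz).le

lemma det_smul_id_add_smulRight {m : ℕ} (a : ℝ) (L : (Fin m → ℝ) →L[ℝ] ℝ) (v : Fin m → ℝ) :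
    (a • (ContinuousLinearMap.id ℝ (Fin m → ℝ) + L.smulRight v)).det = a ^ m * (1 + L v) := by
  have h := LinearMap.transvection.det (R := ℝ) (L : (Fin m → ℝ) →ₗ[ℝ] ℝ) v
  have e : ((a • (ContinuousLinearMap.id ℝ (Fin m → ℝ) + L.smulRight v) :
      (Fin m → ℝ) →L[ℝ] (Fin m → ℝ)) : (Fin m → ℝ) →ₗ[ℝ] (Fin m → ℝ))
      = a • LinearMap.transvection (L : (Fin m → ℝ) →ₗ[ℝ] ℝ) v := by
    ext; simp [LinearMap.transvection, mul_add]
  rw [ContinuousLinearMap.det, e, LinearMap.det_smul, h]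
  simp

lemma hasFDerivAt_inv_sphereHeight {m : ℕ} {N : ℝ} {z : Fin m → ℝ} (hz : z ∈ sqBall m N) :
    HasFDerivAt (fun z => (sphereHeight N z)⁻¹)
      ((sphereHeight N z ^ 3)⁻¹ •
        ∑ j, z j • (ContinuousLinearMap.proj j : (Fin m → ℝ) →L[ℝ] ℝ)) z := by
  have h1 : HasFDerivAt (fun z : Fin m → ℝ => N - ∑ j, z j ^ 2)
      (-∑ j, (2 * z j) • (ContinuousLinearMap.proj j : (Fin m → ℝ) →L[ℝ] ℝ)) z := by
    have h : ∀ j ∈ Finset.univ, HasFDerivAt (fun z : Fin m → ℝ => z j ^ 2)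
        ((2 * z j) • (ContinuousLinearMap.proj j : (Fin m → ℝ) →L[ℝ] ℝ)) z :=
      fun j _ => by simpa using (hasFDerivAt_apply (𝕜 := ℝ) j z).pow 2
    exact (HasFDerivAt.fun_sum h).const_sub N
  have hp := sphereHeight_pos hz
  have h2 := (hasDerivAt_inv hp.ne').comp_hasFDerivAt z (h1.sqrt (sub_pos.2 hz).ne')
  convert! h2 using 1
  ext v
  simp [mul_assoc, ← Finset.mul_sum]
  change _ = _ * ((sphereHeight N z)⁻¹ * _)
  field_simp

lemma radial_bijOn {m : ℕ} {N t : ℝ} (hN : 0 < N) (ht : 0 < t) :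
    Set.BijOn (fun z : Fin m → ℝ => (t * (sphereHeight N z)⁻¹) • z) (sqBall m N) Set.univ := by
  refine ⟨fun _ _ => trivial, fun z hz w hw h => ?_, fun x _ => ?_⟩
  · have hz0 := sphereHeight_pos hz
    have hw0 := sphereHeight_pos hw
    have h1 : ∀ j, sphereHeight N w * z j = sphereHeight N z * w j := fun j => by
      have := congrFun h j
      simp only [Pi.smul_apply, smul_eq_mul] at this
      field_simp at this
      linarith
    have h2 : sphereHeight N w ^ 2 * ∑ j, z j ^ 2 = sphereHeight N z ^ 2 * ∑ j, w j ^ 2 := by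
      simp_rw [Finset.mul_sum, ← mul_pow, h1]
    have h3 : ∑ j, z j ^ 2 = N - sphereHeight N z ^ 2 := by rw [sq_sphereHeight hz]; ring
    have h4 : ∑ j, w j ^ 2 = N - sphereHeight N w ^ 2 := by rw [sq_sphereHeight hw]; ring
    have h5 : sphereHeight N w = sphereHeight N z := by
      rw [h3, h4] at h2
      have : N * (sphereHeight N w ^ 2) = N * sphereHeight N z ^ 2 := by linarith
      exact (pow_left_inj₀ hw0.le hz0.le two_ne_zero).1 (mul_left_cancel₀ hN.ne' this)
    funext j
    have := h1 j
    rw [h5] at this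
    exact mul_left_cancel₀ hz0.ne' this
  · set q := ∑ j, x j ^ 2 with hq
    have hq0 : 0 ≤ q := Finset.sum_nonneg fun _ _ => sq_nonneg _
    have hD : 0 < t ^ 2 + q := by positivity
    set a := √(N / (t ^ 2 + q)) with ha
    have ha2 : a ^ 2 = N / (t ^ 2 + q) := Real.sq_sqrt (by positivity)
    have ha0 : 0 < a := Real.sqrt_pos.2 (by positivity)
    have hs : ∑ j, (a • x) j ^ 2 = a ^ 2 * q := by
      simp [mul_pow, hq, Finset.mul_sum]
    have hd : N - a ^ 2 * q = (a * t) ^ 2 := by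
      rw [mul_pow, ha2]; field_simp; ring
    have hmem : a • x ∈ sqBall m N := by
      change ∑ j, (a • x) j ^ 2 < N
      rw [hs]
      have : 0 < (a * t) ^ 2 := by positivity
      linarith
    refine ⟨a • x, hmem, ?_⟩
    have : sphereHeight N (a • x) = a * t := by
      rw [sphereHeight, hs, hd, Real.sqrt_sq (by positivity)]
    funext j
    simp only [this, Pi.smul_apply, smul_eq_mul]
    field_simp

lemma lintegral_eq_lintegral_sqBall {m : ℕ} {N t : ℝ} (hN : 0 < N) (ht : 0 < t)
    (K : (Fin m → ℝ) → ENNReal) :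
    ∫⁻ x, K x = ∫⁻ z in sqBall m N,
      ENNReal.ofReal (t ^ m * N * (sphereHeight N z)⁻¹ ^ (m + 2))
        * K ((t * (sphereHeight N z)⁻¹) • z) := by
  have hb := radial_bijOn (m := m) hN ht
  rw [← setLIntegral_univ, ← hb.image_eq]
  rw [lintegral_image_eq_lintegral_abs_det_fderiv_mul volume (measurableSet_sqBall m N)
    (f' := fun z => (t * (sphereHeight N z)⁻¹) • (ContinuousLinearMap.id ℝ (Fin m → ℝ) +
      ((sphereHeight N z ^ 2)⁻¹ • ∑ j, z j •
        (ContinuousLinearMap.proj j : (Fin m → ℝ) →L[ℝ] ℝ)).smulRight z)) ?_ hb.injOn]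
  · refine setLIntegral_congr_fun (measurableSet_sqBall m N) fun z hz => ?_
    have hp := sphereHeight_pos hz
    have h3 : ∑ j, z j * z j = N - sphereHeight N z ^ 2 := by
      rw [sq_sphereHeight hz]; simp [sq]
    beta_reduce
    congr 2
    rw [det_smul_id_add_smulRight]
    simp only [_root_.smul_apply, _root_.sum_apply,
      ContinuousLinearMap.proj_apply, smul_eq_mul, h3]
    rw [show (t * (sphereHeight N z)⁻¹) ^ m *
        (1 + (sphereHeight N z ^ 2)⁻¹ * (N - sphereHeight N z ^ 2))
        = t ^ m * N * (sphereHeight N z)⁻¹ ^ (m + 2) by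
          rw [mul_pow, pow_add]; field_simp; ring]
    exact abs_of_pos (by positivity)
  · intro z hz
    have hp := sphereHeight_pos hz
    have := (((hasFDerivAt_inv_sphereHeight hz).const_mul t).smul (hasFDerivAt_id z))
    refine HasFDerivAt.hasFDerivWithinAt ?_
    convert! this using 1
    ext v j
    simp
    field_simp

lemma lintegral_Ioi_comp_mul {a : ℝ} (ha : 0 < a) (K : ℝ → ENNReal) :
    ∫⁻ t in Set.Ioi 0, K t = ∫⁻ r in Set.Ioi 0, ENNReal.ofReal a * K (r * a) := by
  have him : (fun r : ℝ => r * a) '' Set.Ioi 0 = Set.Ioi 0 := by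
    simpa [mul_comm] using Set.image_mul_left_Ioi ha 0
  conv_lhs => rw [← him]
  rw [lintegral_image_eq_lintegral_abs_deriv_mul measurableSet_Ioi
    (f' := fun _ => a) (fun x _ => by simpa using ((hasDerivAt_id x).mul_const a).hasDerivWithinAt)
    (mul_left_injective₀ ha.ne').injOn]
  simp [abs_of_pos ha]

lemma lintegral_halfSpace_eq {m : ℕ} {N : ℝ} (hN : 0 < N)
    {K : (Fin m → ℝ) × ℝ → ENNReal} (hK : Measurable K) :
    ∫⁻ t in Set.Ioi 0, ∫⁻ x, K (x, t) = ENNReal.ofReal N * ∫⁻ z in sqBall m N,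
      ENNReal.ofReal (sphereHeight N z)⁻¹ *
        ∫⁻ r in Set.Ioi 0, ENNReal.ofReal (r ^ m) * K (r • z, r * sphereHeight N z) := by
  have hmeas := measurable_sphereHeight (m := m) N
  calc _ = ∫⁻ t in Set.Ioi 0, ∫⁻ z in sqBall m N,
      ENNReal.ofReal (t ^ m * N * (sphereHeight N z)⁻¹ ^ (m + 2))
        * K ((t * (sphereHeight N z)⁻¹) • z, t) :=
        setLIntegral_congr_fun measurableSet_Ioi fun t ht =>
          lintegral_eq_lintegral_sqBall hN ht fun x => K (x, t)
    _ = ∫⁻ z in sqBall m N, ∫⁻ t in Set.Ioi 0,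
      ENNReal.ofReal (t ^ m * N * (sphereHeight N z)⁻¹ ^ (m + 2))
        * K ((t * (sphereHeight N z)⁻¹) • z, t) := by
        refine lintegral_lintegral_swap (Measurable.aemeasurable ?_)
        unfold Function.uncurry
        fun_prop
    _ = _ := by
        rw [← lintegral_const_mul' _ _ ENNReal.ofReal_ne_top]
        refine setLIntegral_congr_fun (measurableSet_sqBall m N) fun z hz => ?_
        have hp := sphereHeight_pos hz
        rw [lintegral_Ioi_comp_mul hp, ← mul_assoc, ← ENNReal.ofReal_mul hN.le,
          ← lintegral_const_mul' _ _ ENNReal.ofReal_ne_top]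
        refine setLIntegral_congr_fun measurableSet_Ioi fun r (hr : 0 < r) => ?_
        rw [← mul_assoc, ← mul_assoc, ← ENNReal.ofReal_mul hp.le,
          ← ENNReal.ofReal_mul (by positivity), mul_assoc r, mul_inv_cancel₀ hp.ne', mul_one]
        congr 2
        rw [mul_pow, pow_add, inv_pow]
        field_simp

lemma measurable_snoc {m : ℕ} :
    Measurable (fun p : (Fin m → ℝ) × ℝ => (Fin.snoc p.1 p.2 : Fin (m + 1) → ℝ)) := by
  refine measurable_pi_iff.2 fun i => ?_
  induction i using Fin.lastCases with
  | last => simpa using measurable_snd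
  | cast j => simp only [Fin.snoc_castSucc]; fun_prop

lemma lintegral_fin_succ {m : ℕ} {H : (Fin (m + 1) → ℝ) → ENNReal} (hH : Measurable H)
    (μ : Measure ℝ) [SigmaFinite μ] :
    ∫⁻ y, H y ∂(Measure.pi fun _ => μ) =
      ∫⁻ t, ∫⁻ x : Fin m → ℝ, H (Fin.snoc x t) ∂(Measure.pi fun _ => μ) ∂μ := by
  have h := (measurePreserving_piFinSuccAbove (fun _ : Fin (m + 1) => μ) (Fin.last m)).symm
  rw [← h.map_eq, lintegral_map hH (MeasurableEquiv.measurable _),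
    lintegral_prod (fun a => H ((MeasurableEquiv.piFinSuccAbove _ _).symm a))
      (hH.comp (MeasurableEquiv.measurable _)).aemeasurable]
  simp [MeasurableEquiv.piFinSuccAbove, Fin.snocEquiv]

lemma lintegral_eq_lintegral_Ioi_add_neg {f : ℝ → ENNReal} (hf : Measurable f) :
    ∫⁻ t, f t = ∫⁻ t in Set.Ioi 0, f t + f (-t) := by
  rw [lintegral_add_left hf, ← lintegral_add_compl f measurableSet_Ioi (A := Set.Ioi 0)]
  congr 1
  rw [Set.compl_Ioi, setLIntegral_congr Iio_ae_eq_Iic.symm]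
  have := (Measure.measurePreserving_neg (volume : Measure ℝ)).setLIntegral_comp_preimage
    (s := Set.Iio 0) measurableSet_Iio hf
  rw [← this]
  simp

lemma lintegral_eq_lintegral_sqBall_polar {m : ℕ} {N : ℝ} (hN : 0 < N)
    {H : (Fin (m + 1) → ℝ) → ENNReal} (hH : Measurable H) :
    ∫⁻ y, H y = ENNReal.ofReal N * ∫⁻ z in sqBall m N, ENNReal.ofReal (sphereHeight N z)⁻¹ *
      ∫⁻ r in Set.Ioi 0, ENNReal.ofReal (r ^ m) *
        (H (Fin.snoc (r • z) (r * sphereHeight N z))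
          + H (Fin.snoc (r • z) (-(r * sphereHeight N z)))) := by
  have hs := measurable_snoc (m := m)
  have hK : Measurable fun p : (Fin m → ℝ) × ℝ => H (Fin.snoc p.1 p.2) + H (Fin.snoc p.1 (-p.2)) :=
    (hH.comp hs).add (hH.comp (hs.comp (measurable_fst.prodMk measurable_snd.neg)))
  rw [← lintegral_halfSpace_eq hN hK, volume_pi, lintegral_fin_succ hH,
    lintegral_eq_lintegral_Ioi_add_neg]
  · refine lintegral_congr fun t => ?_
    rw [← lintegral_add_left]
    · rfl
    · exact hH.comp (hs.comp (measurable_id.prodMk measurable_const))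
  · exact Measurable.lintegral_prod_left' (f := fun p : (Fin m → ℝ) × ℝ => H (Fin.snoc p.1 p.2))
      (hH.comp hs)

lemma lintegral_pi_withDensity {n : ℕ} {f : ℝ → ENNReal} (hf : Measurable f)
    [SigmaFinite ((volume : Measure ℝ).withDensity f)]
    {H : (Fin n → ℝ) → ENNReal} (hH : Measurable H) :
    ∫⁻ y, H y ∂(Measure.pi fun _ => (volume : Measure ℝ).withDensity f) =
      ∫⁻ y, (∏ i, f (y i)) * H y := by
  induction n with
  | zero =>
    rw [volume_pi, Measure.pi_of_empty, Measure.pi_of_empty]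
    simp
  | succ n ih =>
    have hs := measurable_snoc (m := n)
    have hHt (t : ℝ) : Measurable fun x : Fin n → ℝ => H (Fin.snoc x t) :=
      hH.comp (hs.comp (measurable_id.prodMk measurable_const))
    have hg : Measurable fun y : Fin (n + 1) → ℝ => (∏ i, f (y i)) * H y := by fun_prop
    rw [volume_pi, lintegral_fin_succ hH, lintegral_fin_succ hg, ← volume_pi]
    simp_rw [ih (hHt _)]
    rw [lintegral_withDensity_eq_lintegral_mul _ hf]
    · refine lintegral_congr fun t => ?_
      rw [Pi.mul_apply, ← lintegral_const_mul]
      · refine lintegral_congr fun x => ?_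
        rw [Fin.prod_univ_castSucc]
        simp only [Fin.snoc_castSucc, Fin.snoc_last]
        ring
      · have := hHt t
        fun_prop
    · refine Measurable.lintegral_prod_left'
        (f := fun p : (Fin n → ℝ) × ℝ => (∏ i, f (p.1 i)) * H (Fin.snoc p.1 p.2)) ?_
      have := hH.comp hs
      fun_prop

lemma prod_gaussianPDF {n : ℕ} (y : Fin n → ℝ) :
    ∏ i, gaussianPDF 0 1 (y i) =
      ENNReal.ofReal ((√(2 * π))⁻¹ ^ n * rexp (-(∑ i, y i ^ 2) / 2)) := by
  simp only [gaussianPDF]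
  rw [← ENNReal.ofReal_prod_of_nonneg fun i _ => gaussianPDFReal_nonneg 0 1 (y i)]
  congr 1
  simp [gaussianPDFReal, Finset.prod_mul_distrib, ← Real.exp_sum, Finset.sum_div,
    Finset.sum_neg_distrib, neg_div]

/-- The projection to the first `m` coordinates of the surface measure on the upper half of the
sphere of squared radius `N`, up to a constant factor. -/
def sphereProjMeasure (m : ℕ) (N : ℝ) : Measure (Fin m → ℝ) :=
  (volume.restrict (sqBall m N)).withDensity fun z => ENNReal.ofReal (sphereHeight N z)⁻¹

/-- The surface measure on the sphere of squared radius `N`, up to a constant factor. -/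
def sphereMeasure (m : ℕ) (N : ℝ) : Measure (Fin (m + 1) → ℝ) :=
  (sphereProjMeasure m N).map (fun z => Fin.snoc z (sphereHeight N z)) +
    (sphereProjMeasure m N).map (fun z => Fin.snoc z (-sphereHeight N z))

lemma measurable_snoc_sphereHeight (m : ℕ) (N : ℝ) :
    Measurable fun z : Fin m → ℝ => (Fin.snoc z (sphereHeight N z) : Fin (m + 1) → ℝ) :=
  measurable_snoc.comp (measurable_id.prodMk (measurable_sphereHeight N))

lemma measurable_snoc_neg_sphereHeight (m : ℕ) (N : ℝ) :
    Measurable fun z : Fin m → ℝ => (Fin.snoc z (-sphereHeight N z) : Fin (m + 1) → ℝ) :=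
  measurable_snoc.comp (measurable_id.prodMk (measurable_sphereHeight N).neg)

lemma lintegral_sphereMeasure {m : ℕ} {N : ℝ} {G : (Fin (m + 1) → ℝ) → ENNReal}
    (hG : Measurable G) :
    ∫⁻ u, G u ∂(sphereMeasure m N) =
      ∫⁻ z in sqBall m N, ENNReal.ofReal (sphereHeight N z)⁻¹ *
        (G (Fin.snoc z (sphereHeight N z)) + G (Fin.snoc z (-sphereHeight N z))) := by
  have h1 := measurable_snoc_sphereHeight m N
  have h2 := measurable_snoc_neg_sphereHeight m N
  have h3 := measurable_sphereHeight (m := m) N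
  rw [sphereMeasure, lintegral_add_measure, lintegral_map hG h1, lintegral_map hG h2,
    ← lintegral_add_left (by exact hG.comp h1), sphereProjMeasure,
    lintegral_withDensity_eq_lintegral_mul _ (by fun_prop)
      (by exact (hG.comp h1).add (hG.comp h2))]
  rfl

/-- The integral of `F` against the law of the temperature of `m + 1` standard Gaussian variables,
up to a constant factor. -/
def radialLIntegral (m : ℕ) (F : ℝ → ENNReal) : ENNReal :=
  ∫⁻ r in Set.Ioi 0, ENNReal.ofReal ((m + 1 : ℝ) * (√(2 * π))⁻¹ ^ (m + 1) *
    (r ^ m * rexp (-((m + 1 : ℝ) / 2) * r ^ 2))) * F (r ^ 2)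

lemma measurable_temp (n : ℕ) : Measurable (Temp n) := by
  unfold Temp; fun_prop

lemma measurable_normalized (n : ℕ) :
    Measurable fun (y : Fin n → ℝ) (i : Fin n) => y i / √(Temp n y) := by
  have := measurable_temp n
  fun_prop

lemma temp_smul_snoc {m : ℕ} {r s : ℝ} {z : Fin m → ℝ} (hz : z ∈ sqBall m (m + 1))
    (hs : s ^ 2 = sphereHeight (m + 1) z ^ 2) :
    Temp (m + 1) (Fin.snoc (r • z) (r * s)) = r ^ 2 := by
  have : (m + 1 : ℝ) ≠ 0 := by positivity
  simp only [Temp, Fin.sum_univ_castSucc, Fin.snoc_castSucc, Fin.snoc_last, mul_pow, hs,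
    sq_sphereHeight hz, Pi.smul_apply, smul_eq_mul, ← Finset.mul_sum]
  push_cast
  field_simp
  ring

lemma normalized_smul_snoc {m : ℕ} {r s : ℝ} (hr : 0 < r) {z : Fin m → ℝ}
    (hz : z ∈ sqBall m (m + 1)) (hs : s ^ 2 = sphereHeight (m + 1) z ^ 2) :
    (fun i => (Fin.snoc (r • z) (r * s) : Fin (m + 1) → ℝ) i /
      √(Temp (m + 1) (Fin.snoc (r • z) (r * s)))) = Fin.snoc z s := by
  rw [temp_smul_snoc hz hs, Real.sqrt_sq hr.le]
  funext i
  induction i using Fin.lastCases with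
  | last => simp [hr.ne']
  | cast j => simp [hr.ne']

lemma lintegral_temp_mul_normalized (m : ℕ) {F : ℝ → ENNReal} (hF : Measurable F)
    {G : (Fin (m + 1) → ℝ) → ENNReal} (hG : Measurable G) :
    ∫⁻ y, F (Temp (m + 1) y) * G (fun i => y i / √(Temp (m + 1) y))
        ∂(Measure.pi fun _ : Fin (m + 1) => gaussianReal 0 1)
      = radialLIntegral m F * ∫⁻ u, G u ∂(sphereMeasure m (m + 1)) := by
  have hN : (0 : ℝ) < m + 1 := by positivity
  have hmT := measurable_temp (m + 1)
  have hFG : Measurable fun y => F (Temp (m + 1) y) * G (fun i => y i / √(Temp (m + 1) y)) :=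
    (hF.comp hmT).mul (hG.comp (measurable_normalized _))
  have hgauss : gaussianReal 0 1 = volume.withDensity (gaussianPDF 0 1) :=
    gaussianReal_of_var_ne_zero 0 one_ne_zero
  have hsf : SigmaFinite ((volume : Measure ℝ).withDensity (gaussianPDF 0 1)) := by
    rw [← hgauss]; infer_instance
  have hdens : Measurable (gaussianPDF 0 1) := measurable_gaussianPDF 0 1
  have hterm {r s : ℝ} (hr : 0 < r) {z : Fin m → ℝ} (hz : z ∈ sqBall m (m + 1))
      (hs : s ^ 2 = sphereHeight (m + 1) z ^ 2) :
      (∏ i, gaussianPDF 0 1 ((Fin.snoc (r • z) (r * s) : Fin (m + 1) → ℝ) i)) *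
        (F (Temp (m + 1) (Fin.snoc (r • z) (r * s))) *
        G (fun i => (Fin.snoc (r • z) (r * s) : Fin (m + 1) → ℝ) i /
          √(Temp (m + 1) (Fin.snoc (r • z) (r * s))))) =
      ENNReal.ofReal ((√(2 * π))⁻¹ ^ (m + 1) * rexp (-((m + 1 : ℝ) / 2) * r ^ 2)) *
        (F (r ^ 2) * G (Fin.snoc z s)) := by
    rw [normalized_smul_snoc hr hz hs, temp_smul_snoc hz hs, prod_gaussianPDF]
    have := temp_smul_snoc (r := r) hz hs
    rw [Temp, div_eq_iff (by positivity)] at this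
    rw [this]
    push_cast
    ring_nf
  have h3 := measurable_sphereHeight (m := m) (m + 1)
  rw [hgauss, lintegral_pi_withDensity hdens hFG,
    lintegral_eq_lintegral_sqBall_polar hN (by fun_prop), lintegral_sphereMeasure hG,
    ← lintegral_const_mul' _ _ ENNReal.ofReal_ne_top, ← lintegral_const_mul _
      (by
        have h1 := hG.comp (measurable_snoc_sphereHeight m (m + 1))
        have h2 := hG.comp (measurable_snoc_neg_sphereHeight m (m + 1))
        exact h3.inv.ennreal_ofReal.mul (h1.add h2))]
  refine setLIntegral_congr_fun (measurableSet_sqBall m _) fun z hz => ?_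
  rw [mul_left_comm, mul_left_comm (radialLIntegral m F)]
  congr 1
  rw [radialLIntegral, ← lintegral_const_mul' _ _ ENNReal.ofReal_ne_top,
    ← lintegral_mul_const _ (by fun_prop)]
  refine setLIntegral_congr_fun measurableSet_Ioi fun r (hr : 0 < r) => ?_
  have hconst : ENNReal.ofReal ((m + 1 : ℝ) * (√(2 * π))⁻¹ ^ (m + 1) *
      (r ^ m * rexp (-((m + 1 : ℝ) / 2) * r ^ 2))) =
      ENNReal.ofReal (m + 1) * (ENNReal.ofReal (r ^ m) *
        ENNReal.ofReal ((√(2 * π))⁻¹ ^ (m + 1) * rexp (-((m + 1 : ℝ) / 2) * r ^ 2))) := by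
    rw [← ENNReal.ofReal_mul (by positivity), ← ENNReal.ofReal_mul hN.le]
    congr 1
    ring
  rw [← mul_neg, hterm hr hz rfl, hterm hr hz (neg_sq _), hconst]
  ring

lemma radialLIntegral_one (m : ℕ) :
    radialLIntegral m (fun _ => 1) = ENNReal.ofReal
      (Real.Gamma ((m + 1 : ℝ) / 2)
            / (π ^ ((m + 1 : ℝ) / 2) * (m + 1 : ℝ) ^ (((m + 1 : ℝ) - 2) / 2)) / 2) := by
  have hN : (0 : ℝ) < m + 1 := by positivity
  have hm : (-1 : ℝ) < m := by linarith
  have hb : (0 : ℝ) < (m + 1) / 2 := by positivity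
  have hcongr : ∀ r ∈ Set.Ioi (0 : ℝ), r ^ (m : ℝ) * rexp (-((m + 1 : ℝ) / 2) * r ^ (2 : ℝ)) =
      r ^ m * rexp (-((m + 1 : ℝ) / 2) * r ^ 2) := fun r _ => by
    rw [Real.rpow_natCast, Real.rpow_two]
  have h_value := integral_rpow_mul_exp_neg_mul_rpow two_pos hm hb
  have h_intble := integrableOn_rpow_mul_exp_neg_mul_rpow hm two_pos hb
  rw [setIntegral_congr_fun measurableSet_Ioi hcongr] at h_value
  rw [integrableOn_congr_fun hcongr measurableSet_Ioi] at h_intble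
  simp only [radialLIntegral, mul_one]
  rw [← ofReal_integral_eq_lintegral_ofReal (h_intble.const_mul _), integral_const_mul, h_value]
  · congr 1
    rw [Real.sqrt_eq_rpow, ← Real.rpow_neg (by positivity), ← Real.rpow_natCast,
      ← Real.rpow_mul (by positivity), Real.mul_rpow (by positivity) (by positivity),
      Real.div_rpow hN.le (by positivity)]
    have e1 : (-(1 / 2) * ((m + 1 : ℕ) : ℝ)) = -((m + 1) / 2) := by push_cast; ring
    have e2 : (-((m : ℝ) + 1) / 2) = -((m + 1) / 2) := by ring
    have e3 : ((m + 1 : ℝ) - 2) / 2 = (m + 1) / 2 - 1 := by ring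
    rw [e1, e2, e3, Real.rpow_sub hN, Real.rpow_one, Real.rpow_neg hN.le,
      Real.rpow_neg zero_le_two, Real.rpow_neg pi_pos.le]
    have : (0 : ℝ) < 2 ^ ((m + 1 : ℝ) / 2) := by positivity
    have : (0 : ℝ) < π ^ ((m + 1 : ℝ) / 2) := by positivity
    have : (0 : ℝ) < (m + 1 : ℝ) ^ ((m + 1 : ℝ) / 2) := by positivity
    field_simp
  · refine (ae_restrict_iff' measurableSet_Ioi).2 (.of_forall fun r (hr : 0 < r) => ?_)
    simp only [Pi.zero_apply]
    positivity

lemma lintegral_normalized (m : ℕ) {G : (Fin (m + 1) → ℝ) → ENNReal} (hG : Measurable G) :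
    ∫⁻ y, G (fun i => y i / √(Temp (m + 1) y))
        ∂(Measure.pi fun _ : Fin (m + 1) => gaussianReal 0 1)
      = radialLIntegral m (fun _ => 1) * ∫⁻ u, G u ∂(sphereMeasure m (m + 1)) := by
  simpa using lintegral_temp_mul_normalized m (F := fun _ => 1) measurable_const hG

lemma radialLIntegral_one_mul_sphereMeasure_univ (m : ℕ) :
    radialLIntegral m (fun _ => 1) * sphereMeasure m (m + 1) Set.univ = 1 := by
  simpa using (lintegral_normalized m (G := fun _ => 1) measurable_const).symm

lemma map_normalized (m : ℕ) :
    (Measure.pi fun _ : Fin (m + 1) => gaussianReal 0 1).map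
        (fun (y : Fin (m + 1) → ℝ) i => y i / √(Temp (m + 1) y))
      = radialLIntegral m (fun _ => 1) • sphereMeasure m (m + 1) := by
  ext s hs
  have := lintegral_normalized m (G := s.indicator 1) (measurable_one.indicator hs)
  rw [← lintegral_map (measurable_one.indicator hs) (measurable_normalized _)] at this
  simpa [lintegral_indicator_one hs] using this

lemma indepFun_temp_normalized (m : ℕ) :
    IndepFun (fun y : Fin (m + 1) → ℝ => Temp (m + 1) y)
      (fun (y : Fin (m + 1) → ℝ) (i : Fin (m + 1)) => y i / √(Temp (m + 1) y))
      (Measure.pi fun _ : Fin (m + 1) => gaussianReal 0 1) := by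
  rw [indepFun_iff_measure_inter_preimage_eq_mul]
  intro s t hs ht
  have hT := measurable_temp (m + 1)
  have hV := measurable_normalized (m + 1)
  have hs1 : Measurable (s.indicator (1 : ℝ → ENNReal)) := measurable_one.indicator hs
  have ht1 : Measurable (t.indicator (1 : (Fin (m + 1) → ℝ) → ENNReal)) :=
    measurable_one.indicator ht
  have key := lintegral_temp_mul_normalized m hs1 ht1
  have key1 := lintegral_temp_mul_normalized m hs1 (G := fun _ => 1) measurable_const
  have key2 := lintegral_normalized m ht1
  have e0 : ∀ y : Fin (m + 1) → ℝ, s.indicator (1 : ℝ → ENNReal) (Temp (m + 1) y) *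
      t.indicator (1 : (Fin (m + 1) → ℝ) → ENNReal) (fun i => y i / √(Temp (m + 1) y)) =
      ((fun y => Temp (m + 1) y) ⁻¹' s ∩
        (fun (y : Fin (m + 1) → ℝ) i => y i / √(Temp (m + 1) y)) ⁻¹' t).indicator 1 y :=
    fun y => by rw [Set.inter_indicator_one]; rfl
  have e1 : ∀ y : Fin (m + 1) → ℝ, s.indicator (1 : ℝ → ENNReal) (Temp (m + 1) y) =
      ((fun y => Temp (m + 1) y) ⁻¹' s).indicator 1 y := fun y => rfl
  have e2 : ∀ y : Fin (m + 1) → ℝ,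
      t.indicator (1 : (Fin (m + 1) → ℝ) → ENNReal) (fun i => y i / √(Temp (m + 1) y)) =
      ((fun (y : Fin (m + 1) → ℝ) i => y i / √(Temp (m + 1) y)) ⁻¹' t).indicator 1 y :=
    fun y => rfl
  simp only [e0, mul_one] at key key1
  simp only [e1] at key1
  simp only [e2] at key2
  rw [lintegral_indicator_one ((hT hs).inter (hV ht)), lintegral_indicator_one ht] at key
  rw [lintegral_indicator_one (hT hs), lintegral_one] at key1
  rw [lintegral_indicator_one (hV ht), lintegral_indicator_one ht] at key2
  rw [key, key1, key2]
  have h := radialLIntegral_one_mul_sphereMeasure_univ m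
  calc _ = radialLIntegral m (s.indicator 1) * sphereMeasure m (m + 1) t *
      (radialLIntegral m (fun _ => 1) * sphereMeasure m (m + 1) Set.univ) := by rw [h, mul_one]
    _ = _ := by ring

/-- **Lemma (independence of the temperature).** If `Y_1, …, Y_n` are i.i.d. standard
normal variables (here `n = m + 1 ≥ 1`), then `T_n = (Y_1² + ⋯ + Y_n²)/n` is independent
of the vector `(Y_1/√T_n, …, Y_n/√T_n)`, and for every measurable bounded `g : ℝⁿ → ℝ`,
`ν^{⊗n}[g(Y/√T_n)]` equals
`Γ(n/2)/(π^{n/2} n^{(n-2)/2}) ∫_{ℝ^{n-1}} 1_{|z|²<n} g_s(z, √(n-|z|²)) / √(n-|z|²) dz`,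
where `g_s` is the even part of `g` in the last variable. -/
theorem temperature_independent_of_normalized_vector (m : ℕ) :
    IndepFun (fun y : Fin (m + 1) → ℝ => Temp (m + 1) y)
      (fun (y : Fin (m + 1) → ℝ) (i : Fin (m + 1)) => y i / Real.sqrt (Temp (m + 1) y))
      (Measure.pi fun _ : Fin (m + 1) => gaussianReal 0 1) ∧
    ∀ g : (Fin (m + 1) → ℝ) → ℝ, Measurable g → (∃ C, ∀ x, |g x| ≤ C) →
      ∫ y, g (fun i => y i / Real.sqrt (Temp (m + 1) y))
          ∂(Measure.pi fun _ : Fin (m + 1) => gaussianReal 0 1)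
        = Real.Gamma ((m + 1 : ℝ) / 2)
            / (π ^ ((m + 1 : ℝ) / 2) * (m + 1 : ℝ) ^ (((m + 1 : ℝ) - 2) / 2)) *
          ∫ z : Fin m → ℝ,
            Set.indicator {z : Fin m → ℝ | ∑ j, (z j) ^ 2 < (m + 1 : ℝ)}
              (fun z =>
                (1 / Real.sqrt ((m + 1 : ℝ) - ∑ j, (z j) ^ 2)) *
                ((g (Fin.snoc z (Real.sqrt ((m + 1 : ℝ) - ∑ j, (z j) ^ 2)))
                  + g (Fin.snoc z (-Real.sqrt ((m + 1 : ℝ) - ∑ j, (z j) ^ 2)))) / 2)) z := by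
  refine ⟨indepFun_temp_normalized m, fun g hg ⟨C, hC⟩ => ?_⟩
  have h1 := measurable_snoc_sphereHeight m (m + 1)
  have h2 := measurable_snoc_neg_sphereHeight m (m + 1)
  have h3 := measurable_sphereHeight (m := m) (m + 1)
  have hfin : IsFiniteMeasure (sphereMeasure m (m + 1)) := ⟨by
    have h := radialLIntegral_one_mul_sphereMeasure_univ m
    refine lt_top_iff_ne_top.2 fun htop => ?_
    rw [htop] at h
    by_cases h0 : radialLIntegral m (fun _ => 1) = 0
    · simp [h0] at h
    · simp [ENNReal.mul_top h0] at h⟩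
  have hg_int : Integrable g (sphereMeasure m (m + 1)) :=
    Integrable.of_bound hg.aestronglyMeasurable C (.of_forall hC)
  have hg_parts := integrable_add_measure.1 hg_int
  have i1 := hg_parts.1.comp_measurable h1
  have i2 := hg_parts.2.comp_measurable h2
  have hpos : 0 ≤ Real.Gamma ((m + 1 : ℝ) / 2)
      / (π ^ ((m + 1 : ℝ) / 2) * (m + 1 : ℝ) ^ (((m + 1 : ℝ) - 2) / 2)) / 2 := by positivity
  calc _ = ∫ u, g u ∂((Measure.pi fun _ : Fin (m + 1) => gaussianReal 0 1).map
        (fun (y : Fin (m + 1) → ℝ) i => y i / √(Temp (m + 1) y))) :=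
        (integral_map (measurable_normalized _).aemeasurable hg.aestronglyMeasurable).symm
    _ = _ := by
      rw [map_normalized, integral_smul_measure, radialLIntegral_one, ENNReal.toReal_ofReal hpos,
        sphereMeasure, integral_add_measure hg_parts.1 hg_parts.2,
        integral_map h1.aemeasurable hg.aestronglyMeasurable,
        integral_map h2.aemeasurable hg.aestronglyMeasurable,
        ← integral_add (by exact i1) (by exact i2), sphereProjMeasure,
        integral_withDensity_eq_integral_toReal_smul (by fun_prop)
          (.of_forall fun _ => ENNReal.ofReal_lt_top),
        smul_eq_mul, div_mul_eq_mul_div, mul_div_assoc, ← integral_div,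
        ← integral_indicator (measurableSet_sqBall m _)]
      congr 1
      refine integral_congr_ae (.of_forall fun z => ?_)
      refine congrFun (Set.indicator_congr fun w hw => ?_) z
      have hp := sphereHeight_pos hw
      rw [ENNReal.toReal_ofReal (by positivity), smul_eq_mul, mul_div_assoc, one_div]
      rfl

end
end
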